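/- arXiv:1602.02835 — 3 statements merged into one kernel-verified Lean document; each statement's English description precedes it below -/
import Mathlib

section
/- Every holomorphic eta quotient of weight 1/2 is the rescaling by some positive integer ν of one of the following fourteen eta quotients: η, η²/η₂, η₂²/η, η₂³/(η·η₄), η₂⁵/(η²·η₄²), η·η₄/η₂, η·η₆²/(η₂·η₃), η²·η₆/(η₂·η₃), η₂²·η₃/(η·η₆), η₂·η₃²/(η·η₆), η₂²·η₃·η₁₂/(η·η₄·η₆), η₂⁵·η₃·η₁₂/(η²·η₄²·η₆²), η·η₄·η₆²/(η₂·η₃·η₁₂), η·η₄·η₆⁵/(η₂²·η₃²·η₁₂²). Equivalently: if N ∈ ℕ and X : D_N → ℤ satisfies Σ_{d|N} X_d = 1 and for every t ∈ D_N the inequality Σ_{d|N} (N·gcd(d,t)²)/(d·gcd(t²,N))·X_d ≥ 0, then there exist ν ∈ ℕ and one of the fourteen exponent vectors Y above (supported on divisors of 12) such that X_e = Y_{e/ν} whenever ν | e and X_e = 0 whenever ν ∤ e. -/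
open Finset

/-- `24` times the order of the eta quotient `η^X` at the cusp `1/t` of `Γ₀(N)`:
`∑_{d ∣ N} (N · gcd(d,t)²)/(d · gcd(t²,N)) · X_d`. -/
def etaOrd (N : ℕ) (X : ℕ → ℤ) (t : ℕ) : ℚ :=
  ∑ d ∈ N.divisors,
    ((N : ℚ) * (Nat.gcd d t : ℚ) ^ 2 / ((d : ℚ) * (Nat.gcd (t ^ 2) N : ℚ))) * (X d : ℚ)

/-- The eta quotient `η^X` on `Γ₀(N)` is holomorphic: all cusp orders are nonnegative. -/
def IsHolEta (N : ℕ) (X : ℕ → ℤ) : Prop :=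
  ∀ t ∈ N.divisors, 0 ≤ etaOrd N X t

/-- The exponent vector `X` is supported on the divisors of `N`, i.e. `X : D_N → ℤ`. -/
def SuppIn (N : ℕ) (X : ℕ → ℤ) : Prop :=
  ∀ d : ℕ, ¬ d ∣ N → X d = 0

/-- Builds an exponent vector supported on the divisors `1, 2, 3, 4, 6, 12` of `12`. -/
def zvec (a b c d e f : ℤ) : ℕ → ℤ := fun n =>
  if n = 1 then a else if n = 2 then b else if n = 3 then c else
  if n = 4 then d else if n = 6 then e else if n = 12 then f else 0

/-- Zagier's list of fourteen primitive holomorphic eta quotients of weight `1/2`,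
given by their exponent vectors `(X_1, X_2, X_3, X_4, X_6, X_12)`:
η, η²/η₂, η₂²/η, η₂³/(η·η₄), η₂⁵/(η²·η₄²), η·η₄/η₂, η·η₆²/(η₂·η₃), η²·η₆/(η₂·η₃),
η₂²·η₃/(η·η₆), η₂·η₃²/(η·η₆), η₂²·η₃·η₁₂/(η·η₄·η₆), η₂⁵·η₃·η₁₂/(η²·η₄²·η₆²),
η·η₄·η₆²/(η₂·η₃·η₁₂), η·η₄·η₆⁵/(η₂²·η₃²·η₁₂²). -/
def zagierList : List (ℕ → ℤ) :=
  [zvec 1 0 0 0 0 0,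
   zvec 2 (-1) 0 0 0 0,
   zvec (-1) 2 0 0 0 0,
   zvec (-1) 3 0 (-1) 0 0,
   zvec (-2) 5 0 (-2) 0 0,
   zvec 1 (-1) 0 1 0 0,
   zvec 1 (-1) (-1) 0 2 0,
   zvec 2 (-1) (-1) 0 1 0,
   zvec (-1) 2 1 0 (-1) 0,
   zvec (-1) 1 2 0 (-1) 0,
   zvec (-1) 2 1 (-1) (-1) 1,
   zvec (-2) 5 1 (-2) (-2) 1,
   zvec 1 (-1) (-1) 1 2 (-1),
   zvec 1 (-2) (-2) 1 5 (-2)]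

/-- The symmetric kernel `gcd(d,t)² / (d t)`, which is the cusp order kernel up to a positive
factor depending only on `t`. -/
def cuspKer (d t : ℕ) : ℚ := (Nat.gcd d t : ℚ) ^ 2 / ((d : ℚ) * (t : ℚ))

/-- The one-dimensional kernel `p ^ (-|k|)`. -/
def geo (p : ℕ) (k : ℤ) : ℚ := ((p : ℚ)⁻¹) ^ k.natAbs

/-- The normalized order at the cusp `1/t`. -/
def cuspVal (N : ℕ) (X : ℕ → ℚ) (t : ℕ) : ℚ := ∑ d ∈ N.divisors, cuspKer d t * X d

/-- All normalized cusp orders are nonnegative. -/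
def CuspNonneg (N : ℕ) (X : ℕ → ℚ) : Prop := ∀ t ∈ N.divisors, 0 ≤ cuspVal N X t

/-- The sum of the exponents, i.e. twice the weight. -/
def totalExp (N : ℕ) (X : ℕ → ℚ) : ℚ := ∑ d ∈ N.divisors, X d

/-- The exponents obtained by evaluating the `p`-part of the kernel at `p ^ s`. -/
def twist (p n : ℕ) (X : ℕ → ℚ) (s : ℤ) (d : ℕ) : ℚ :=
  ∑ i ∈ range (n + 1), geo p (i - s) * X (p ^ i * d)

lemma geo_neg (p : ℕ) (k : ℤ) : geo p (-k) = geo p k := by simp [geo]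

lemma geo_zero (p : ℕ) : geo p 0 = 1 := by simp [geo]

lemma geo_nonneg (p : ℕ) (k : ℤ) : 0 ≤ geo p k := by
  unfold geo; positivity

lemma geo_add {p : ℕ} {k l : ℤ} (h : (k + l).natAbs = k.natAbs + l.natAbs) :
    geo p (k + l) = geo p k * geo p l := by
  simp [geo, h, pow_add]

lemma gcd_prime_pow_mul {p : ℕ} (hp : p.Prime) {d t : ℕ} (hd : ¬ p ∣ d)
    {i s : ℕ} (his : i ≤ s) : Nat.gcd (p ^ i * d) (p ^ s * t) = p ^ i * Nat.gcd d t := by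
  obtain ⟨c, rfl⟩ := Nat.exists_eq_add_of_le his
  rw [pow_add, mul_assoc, Nat.gcd_mul_left]
  congr 1
  exact Nat.Coprime.gcd_mul_left_cancel_right _
    ((Nat.Coprime.pow_left c ((Nat.Prime.coprime_iff_not_dvd hp).2 hd)))

lemma cuspKer_comm (d t : ℕ) : cuspKer d t = cuspKer t d := by
  simp [cuspKer, Nat.gcd_comm, mul_comm]

lemma cuspKer_prime_pow_mul_of_le {p : ℕ} (hp : p.Prime) {d t : ℕ} (hd : ¬ p ∣ d) (ht : ¬ p ∣ t)
    {i s : ℕ} (his : i ≤ s) :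
    cuspKer (p ^ i * d) (p ^ s * t) = geo p (i - s) * cuspKer d t := by
  have hp0 : (p : ℚ) ≠ 0 := by exact_mod_cast hp.ne_zero
  have hd0 : (d : ℚ) ≠ 0 := by
    rintro h; apply hd; have : d = 0 := by exact_mod_cast h
    simp [this]
  have ht0 : (t : ℚ) ≠ 0 := by
    rintro h; apply ht; have : t = 0 := by exact_mod_cast h
    simp [this]
  unfold cuspKer geo
  rw [gcd_prime_pow_mul hp hd his]
  obtain ⟨c, rfl⟩ := Nat.exists_eq_add_of_le his
  have : ((i : ℤ) - ((i + c : ℕ) : ℤ)).natAbs = c := by omega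
  rw [this]
  push_cast
  rw [inv_pow]
  field_simp
  ring

lemma cuspKer_prime_pow_mul {p : ℕ} (hp : p.Prime) {d t : ℕ} (hd : ¬ p ∣ d) (ht : ¬ p ∣ t)
    (i s : ℕ) :
    cuspKer (p ^ i * d) (p ^ s * t) = geo p (i - s) * cuspKer d t := by
  rcases le_total i s with h | h
  · exact cuspKer_prime_pow_mul_of_le hp hd ht h
  · rw [cuspKer_comm, cuspKer_prime_pow_mul_of_le hp ht hd h, cuspKer_comm d t, ← geo_neg]
    congr 2; ring

lemma sum_divisors_prime_pow_mul {p : ℕ} (hp : p.Prime) {m : ℕ} (hm : ¬ p ∣ m) (n : ℕ)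
    {M : Type*} [AddCommMonoid M] (g : ℕ → M) :
    ∑ d ∈ (p ^ n * m).divisors, g d =
      ∑ i ∈ range (n + 1), ∑ d ∈ m.divisors, g (p ^ i * d) := by
  have hc : Nat.Coprime (p ^ n) m :=
    Nat.Coprime.pow_left n ((Nat.Prime.coprime_iff_not_dvd hp).2 hm)
  rw [Nat.divisors_mul, Finset.mul_def, Finset.sum_image hc.mul_injOn_divisors,
    Finset.sum_product, Nat.divisors_prime_pow hp, Finset.sum_map]
  rfl

lemma not_dvd_of_mem_divisors {p m d : ℕ} (hm : ¬ p ∣ m) (hd : d ∈ m.divisors) : ¬ p ∣ d :=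
  fun h => hm (h.trans (Nat.dvd_of_mem_divisors hd))

lemma cuspVal_prime_pow_mul {p : ℕ} (hp : p.Prime) {m : ℕ} (hm : ¬ p ∣ m) (n s : ℕ)
    (X : ℕ → ℚ) {t : ℕ} (ht : t ∈ m.divisors) :
    cuspVal (p ^ n * m) X (p ^ s * t) = cuspVal m (twist p n X s) t := by
  have ht' := not_dvd_of_mem_divisors hm ht
  unfold cuspVal twist
  rw [sum_divisors_prime_pow_mul hp hm, Finset.sum_comm]
  refine Finset.sum_congr rfl fun d hd => ?_
  rw [Finset.mul_sum]
  refine Finset.sum_congr rfl fun i _ => ?_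
  rw [cuspKer_prime_pow_mul hp (not_dvd_of_mem_divisors hm hd) ht']
  ring

lemma cuspVal_congr {N : ℕ} {X Y : ℕ → ℚ} (h : ∀ d ∈ N.divisors, X d = Y d) (t : ℕ) :
    cuspVal N X t = cuspVal N Y t :=
  Finset.sum_congr rfl fun d hd => by rw [h d hd]

lemma cuspVal_smul (N : ℕ) (c : ℚ) (X : ℕ → ℚ) (t : ℕ) :
    cuspVal N (fun d => c * X d) t = c * cuspVal N X t := by
  simp only [cuspVal, Finset.mul_sum]
  exact Finset.sum_congr rfl fun d _ => by ring

lemma cuspVal_sub (N : ℕ) (X Y : ℕ → ℚ) (t : ℕ) :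
    cuspVal N (fun d => X d - Y d) t = cuspVal N X t - cuspVal N Y t := by
  simp only [cuspVal, ← Finset.sum_sub_distrib]
  exact Finset.sum_congr rfl fun d _ => by ring

lemma cuspVal_sum (N : ℕ) {ι : Type*} (s : Finset ι) (X : ι → ℕ → ℚ) (t : ℕ) :
    cuspVal N (fun d => ∑ i ∈ s, X i d) t = ∑ i ∈ s, cuspVal N (X i) t := by
  simp only [cuspVal, Finset.mul_sum]
  exact Finset.sum_comm

lemma prime_pow_mul_mem_divisors {p m n s t : ℕ} (hp : p.Prime) (ht : t ∈ m.divisors)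
    (hs : s ∈ range (n + 1)) : p ^ s * t ∈ (p ^ n * m).divisors := by
  rw [Nat.mem_divisors] at ht ⊢
  exact ⟨Nat.mul_dvd_mul (pow_dvd_pow p (by simpa [Nat.lt_succ_iff] using hs)) ht.1,
    mul_ne_zero (pow_ne_zero _ hp.ne_zero) ht.2⟩

/-- The weight attached to the index `s` of a chain of length `n + 1`, with heavier ends. -/
def edgeWt (p n s : ℕ) : ℚ :=
  1 + (if s = 0 then ((p : ℚ) - 1)⁻¹ else 0) + (if s = n then ((p : ℚ) - 1)⁻¹ else 0)

/-- The weight of the cusp `1/t` of level `N`. -/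
def cuspWt (N t : ℕ) : ℚ :=
  ∏ p ∈ N.primeFactors, edgeWt p (N.factorization p) (t.factorization p)

/-- The constant `∏_{p ∣ N} (p+1)/(p-1)`. -/
def valence (N : ℕ) : ℚ := ∏ p ∈ N.primeFactors, ((p : ℚ) + 1) / ((p : ℚ) - 1)

lemma one_lt_cast {p : ℕ} (hp : p.Prime) : (1 : ℚ) < p := by exact_mod_cast hp.one_lt

lemma edgeWt_pos {p : ℕ} (hp : p.Prime) (n s : ℕ) : 0 < edgeWt p n s := by
  have : 0 < (p : ℚ) - 1 := by linarith [one_lt_cast hp]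
  unfold edgeWt
  split_ifs <;> positivity

lemma cuspWt_pos (N t : ℕ) : 0 < cuspWt N t :=
  Finset.prod_pos fun _ hp => edgeWt_pos (Nat.prime_of_mem_primeFactors hp) _ _

lemma valence_pos (N : ℕ) : 0 < valence N := by
  refine Finset.prod_pos fun p hp => ?_
  have := one_lt_cast (Nat.prime_of_mem_primeFactors hp)
  have : 0 < (p : ℚ) - 1 := by linarith
  positivity

lemma valence_one : valence 1 = 1 := by simp [valence]

lemma cuspWt_one (t : ℕ) : cuspWt 1 t = 1 := by simp [cuspWt]

lemma primeFactors_prime_pow_mul {p m n : ℕ} (hp : p.Prime) (hm0 : m ≠ 0) (hn : n ≠ 0) :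
    (p ^ n * m).primeFactors = insert p m.primeFactors := by
  rw [Nat.primeFactors_mul (pow_ne_zero _ hp.ne_zero) hm0, Nat.primeFactors_prime_pow hn hp]
  rfl

lemma valence_prime_pow_mul {p m n : ℕ} (hp : p.Prime) (hm : ¬ p ∣ m) (hn : n ≠ 0) :
    valence (p ^ n * m) = ((p : ℚ) + 1) / ((p : ℚ) - 1) * valence m := by
  have hm0 : m ≠ 0 := by rintro rfl; simp at hm
  unfold valence
  rw [primeFactors_prime_pow_mul hp hm0 hn, Finset.prod_insert]
  simp [hm]

lemma factorization_prime_pow_mul_self {p t : ℕ} (hp : p.Prime) (ht : ¬ p ∣ t) (s : ℕ) :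
    (p ^ s * t).factorization p = s := by
  have ht0 : t ≠ 0 := by rintro rfl; simp at ht
  rw [Nat.factorization_mul (pow_ne_zero _ hp.ne_zero) ht0]
  simp [hp.factorization_pow, Nat.factorization_eq_zero_of_not_dvd ht]

lemma factorization_prime_pow_mul_of_ne {p q t : ℕ} (hp : p.Prime) (ht0 : t ≠ 0) (hq : q ≠ p)
    (s : ℕ) : (p ^ s * t).factorization q = t.factorization q := by
  rw [Nat.factorization_mul (pow_ne_zero _ hp.ne_zero) ht0]
  simp [hp.factorization_pow, hq]

lemma cuspWt_prime_pow_mul {p m n : ℕ} (hp : p.Prime) (hm : ¬ p ∣ m) (hn : n ≠ 0) (s : ℕ) {t : ℕ}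
    (ht : t ∈ m.divisors) :
    cuspWt (p ^ n * m) (p ^ s * t) = edgeWt p n s * cuspWt m t := by
  have hm0 : m ≠ 0 := by rintro rfl; simp at hm
  have htp := not_dvd_of_mem_divisors hm ht
  have ht0 : t ≠ 0 := by rintro rfl; simp at htp
  unfold cuspWt
  rw [primeFactors_prime_pow_mul hp hm0 hn, Finset.prod_insert (by simp [hm]),
    factorization_prime_pow_mul_self hp hm, factorization_prime_pow_mul_self hp htp]
  congr 1
  refine Finset.prod_congr rfl fun q hq => ?_
  have hqp : q ≠ p := by rintro rfl; exact hm (Nat.dvd_of_mem_primeFactors hq)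
  rw [factorization_prime_pow_mul_of_ne hp hm0 hqp, factorization_prime_pow_mul_of_ne hp ht0 hqp]

lemma sum_geo_chain {p : ℕ} (hp : p.Prime) (i c : ℕ) :
    ((p : ℚ) - 1) * ∑ s ∈ range (i + c + 1), geo p (i - (s : ℤ)) =
      p + 1 - ((p : ℚ)⁻¹) ^ i - ((p : ℚ)⁻¹) ^ c := by
  have hp0 : (p : ℚ) ≠ 0 := by exact_mod_cast hp.ne_zero
  induction c with
  | zero =>
    induction i with
    | zero => simp [geo]
    | succ i ih =>
      rw [Finset.sum_range_succ', mul_add]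
      have h1 : ∀ s : ℕ, geo p (((i + 1 : ℕ) : ℤ) - ((s + 1 : ℕ) : ℤ)) = geo p (i - (s : ℤ)) := by
        intro s; congr 1; push_cast; ring
      simp only [h1]
      have h2 : geo p (((i + 1 : ℕ) : ℤ) - ((0 : ℕ) : ℤ)) = ((p : ℚ)⁻¹) ^ (i + 1) := by
        unfold geo; congr 1
      rw [h2]
      simp only [add_zero] at ih ⊢
      rw [ih, pow_succ]
      field_simp
      ring
  | succ c ih =>
    rw [show i + (c + 1) + 1 = (i + c + 1) + 1 by ring, Finset.sum_range_succ, mul_add, ih]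
    have h2 : geo p ((i : ℤ) - ((i + c + 1 : ℕ) : ℤ)) = ((p : ℚ)⁻¹) ^ (c + 1) := by
      unfold geo; congr 1; omega
    rw [h2, pow_succ]
    field_simp
    ring

lemma sum_edgeWt_mul_geo {p : ℕ} (hp : p.Prime) {n i : ℕ} (hi : i ≤ n) :
    ∑ s ∈ range (n + 1), edgeWt p n s * geo p (i - (s : ℤ)) =
      ((p : ℚ) + 1) / ((p : ℚ) - 1) := by
  have hp1 : (p : ℚ) - 1 ≠ 0 := by linarith [one_lt_cast hp]
  obtain ⟨c, rfl⟩ := Nat.exists_eq_add_of_le hi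
  have h := sum_geo_chain hp i c
  have h0 : geo p ((i : ℤ) - ((0 : ℕ) : ℤ)) = ((p : ℚ)⁻¹) ^ i := by
    unfold geo; congr 1
  have h1 : geo p ((i : ℤ) - ((i + c : ℕ) : ℤ)) = ((p : ℚ)⁻¹) ^ c := by
    unfold geo; congr 1; omega
  simp only [edgeWt, add_mul, Finset.sum_add_distrib, ite_mul, zero_mul, one_mul,
    Finset.sum_ite_eq', Finset.mem_range]
  rw [if_pos (by omega), if_pos (by omega), h0, h1, eq_div_iff hp1]
  linear_combination h + (((p : ℚ)⁻¹) ^ i + ((p : ℚ)⁻¹) ^ c) * inv_mul_cancel₀ hp1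

lemma sum_edgeWt_mul_twist {p : ℕ} (hp : p.Prime) (n : ℕ) (X : ℕ → ℚ) (d : ℕ) :
    ∑ s ∈ range (n + 1), edgeWt p n s * twist p n X s d =
      ((p : ℚ) + 1) / ((p : ℚ) - 1) * ∑ i ∈ range (n + 1), X (p ^ i * d) := by
  simp only [twist, Finset.mul_sum]
  rw [Finset.sum_comm]
  refine Finset.sum_congr rfl fun i hi => ?_
  rw [← sum_edgeWt_mul_geo hp (Nat.lt_succ_iff.1 (Finset.mem_range.1 hi)), Finset.sum_mul]
  exact Finset.sum_congr rfl fun s _ => by ring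

/-- The valence formula. -/
lemma sum_cuspWt_mul_cuspVal {N : ℕ} (hN : N ≠ 0) (X : ℕ → ℚ) :
    ∑ t ∈ N.divisors, cuspWt N t * cuspVal N X t = valence N * totalExp N X := by
  induction N using Nat.recOnPrimePow generalizing X with
  | zero => exact absurd rfl hN
  | one => simp [cuspWt_one, valence_one, cuspVal, totalExp, cuspKer]
  | prime_pow_mul m p n hp hm hn ih =>
    have hm0 : m ≠ 0 := by rintro rfl; simp at hm
    rw [sum_divisors_prime_pow_mul hp hm, valence_prime_pow_mul hp hm hn.ne']
    calc _ = ∑ s ∈ range (n + 1), edgeWt p n s *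
          ∑ t ∈ m.divisors, cuspWt m t * cuspVal m (twist p n X s) t := by
          refine Finset.sum_congr rfl fun s _ => ?_
          rw [Finset.mul_sum]
          refine Finset.sum_congr rfl fun t ht => ?_
          rw [cuspWt_prime_pow_mul hp hm hn.ne' s ht, cuspVal_prime_pow_mul hp hm n s X ht]
          ring
      _ = valence m * ∑ d ∈ m.divisors, ∑ s ∈ range (n + 1), edgeWt p n s * twist p n X s d := by
          simp only [ih hm0]
          rw [Finset.sum_comm, Finset.mul_sum]
          refine Finset.sum_congr rfl fun s _ => ?_
          rw [totalExp, ← Finset.mul_sum]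
          ring
      _ = _ := by
          simp only [sum_edgeWt_mul_twist hp]
          rw [totalExp, sum_divisors_prime_pow_mul hp hm, ← Finset.mul_sum, Finset.sum_comm]
          ring

/-- The weighted `ℓ¹` norm of the normalized cusp orders. -/
def cuspNorm (N : ℕ) (X : ℕ → ℚ) : ℚ := ∑ t ∈ N.divisors, cuspWt N t * |cuspVal N X t|

lemma cuspNorm_nonneg (N : ℕ) (X : ℕ → ℚ) : 0 ≤ cuspNorm N X :=
  Finset.sum_nonneg fun t _ => mul_nonneg (cuspWt_pos N t).le (abs_nonneg _)

lemma cuspNorm_of_cuspNonneg {N : ℕ} (hN : N ≠ 0) {X : ℕ → ℚ} (hX : CuspNonneg N X) :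
    cuspNorm N X = valence N * totalExp N X := by
  rw [← sum_cuspWt_mul_cuspVal hN]
  exact Finset.sum_congr rfl fun t ht => by rw [abs_of_nonneg (hX t ht)]

lemma totalExp_nonneg {N : ℕ} (hN : N ≠ 0) {X : ℕ → ℚ} (hX : CuspNonneg N X) :
    0 ≤ totalExp N X := by
  have h := cuspNorm_of_cuspNonneg hN hX
  have h1 := cuspNorm_nonneg N X
  rw [h] at h1
  exact nonneg_of_mul_nonneg_right h1 (valence_pos N)

lemma cuspNorm_congr {N : ℕ} {X Y : ℕ → ℚ} (h : ∀ d ∈ N.divisors, X d = Y d) :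
    cuspNorm N X = cuspNorm N Y :=
  Finset.sum_congr rfl fun t _ => by rw [cuspVal_congr h]

lemma cuspNorm_smul (N : ℕ) {c : ℚ} (hc : 0 ≤ c) (X : ℕ → ℚ) :
    cuspNorm N (fun d => c * X d) = c * cuspNorm N X := by
  simp only [cuspNorm, Finset.mul_sum, cuspVal_smul, abs_mul, abs_of_nonneg hc]
  exact Finset.sum_congr rfl fun t _ => by ring

lemma cuspNorm_sub_le (N : ℕ) (X Y : ℕ → ℚ) :
    cuspNorm N (fun d => X d - Y d) ≤ cuspNorm N X + cuspNorm N Y := by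
  simp only [cuspNorm, ← Finset.sum_add_distrib, cuspVal_sub, ← mul_add]
  exact Finset.sum_le_sum fun t _ =>
    mul_le_mul_of_nonneg_left (abs_sub _ _) (cuspWt_pos N t).le

lemma cuspNorm_prime_pow_mul {p : ℕ} (hp : p.Prime) {m : ℕ} (hm : ¬ p ∣ m) {n : ℕ} (hn : n ≠ 0)
    (X : ℕ → ℚ) :
    cuspNorm (p ^ n * m) X =
      ∑ s ∈ range (n + 1), edgeWt p n s * cuspNorm m (twist p n X s) := by
  rw [cuspNorm, sum_divisors_prime_pow_mul hp hm]
  refine Finset.sum_congr rfl fun s _ => ?_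
  rw [cuspNorm, Finset.mul_sum]
  refine Finset.sum_congr rfl fun t ht => ?_
  rw [cuspWt_prime_pow_mul hp hm hn s ht, cuspVal_prime_pow_mul hp hm n s X ht]
  ring

lemma geo_eq_inv_mul_of_pos {p : ℕ} {k : ℤ} (hk : 0 < k) : geo p k = (p : ℚ)⁻¹ * geo p (k - 1) := by
  unfold geo
  rw [← pow_succ']
  congr 1
  omega

lemma geo_eq_inv_mul_of_neg {p : ℕ} {k : ℤ} (hk : k < 0) : geo p k = (p : ℚ)⁻¹ * geo p (k + 1) := by
  unfold geo
  rw [← pow_succ']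
  congr 1
  omega

lemma twist_eq_inv_mul_succ {p n : ℕ} {X : ℕ → ℚ} {s : ℤ} {d : ℕ}
    (h : ∀ i ∈ range (n + 1), (i : ℤ) ≤ s → X (p ^ i * d) = 0) :
    twist p n X s d = (p : ℚ)⁻¹ * twist p n X (s + 1) d := by
  unfold twist
  rw [Finset.mul_sum]
  refine Finset.sum_congr rfl fun i hi => ?_
  by_cases his : (i : ℤ) ≤ s
  · simp [h i hi his]
  · rw [geo_eq_inv_mul_of_pos (show (0 : ℤ) < i - s by omega), mul_assoc]
    congr 3; ring

lemma twist_eq_inv_mul_pred {p n : ℕ} {X : ℕ → ℚ} {s : ℤ} {d : ℕ}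
    (h : ∀ i ∈ range (n + 1), s ≤ (i : ℤ) → X (p ^ i * d) = 0) :
    twist p n X s d = (p : ℚ)⁻¹ * twist p n X (s - 1) d := by
  unfold twist
  rw [Finset.mul_sum]
  refine Finset.sum_congr rfl fun i hi => ?_
  by_cases his : s ≤ (i : ℤ)
  · simp [h i hi his]
  · rw [geo_eq_inv_mul_of_neg (show (i - s : ℤ) < 0 by omega), mul_assoc]
    congr 3; ring

lemma bottom_slice_eq {p n k : ℕ} {X : ℕ → ℚ} {d : ℕ} (hk : k ∈ range (n + 1))
    (h : ∀ i ∈ range (n + 1), i < k → X (p ^ i * d) = 0) :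
    (1 - ((p : ℚ)⁻¹) ^ 2) * X (p ^ k * d) =
      twist p n X k d - (p : ℚ)⁻¹ * twist p n X (k + 1) d := by
  unfold twist
  rw [Finset.mul_sum, ← Finset.sum_sub_distrib, Finset.sum_eq_single_of_mem k hk]
  · rw [sub_self, geo_zero, show (k : ℤ) - (k + 1) = -1 by ring]
    simp [geo]
    ring
  · intro i hi hik
    rcases lt_or_gt_of_ne hik with h1 | h1
    · simp [h i hi h1]
    · rw [geo_eq_inv_mul_of_pos (show (0 : ℤ) < i - k by omega),
        show (i : ℤ) - (k + 1) = i - k - 1 by ring]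
      ring

lemma top_slice_eq {p n k : ℕ} {X : ℕ → ℚ} {d : ℕ} (hk : k ∈ range (n + 1))
    (h : ∀ i ∈ range (n + 1), k < i → X (p ^ i * d) = 0) :
    (1 - ((p : ℚ)⁻¹) ^ 2) * X (p ^ k * d) =
      twist p n X k d - (p : ℚ)⁻¹ * twist p n X (k - 1) d := by
  unfold twist
  rw [Finset.mul_sum, ← Finset.sum_sub_distrib, Finset.sum_eq_single_of_mem k hk]
  · rw [sub_self, geo_zero, show (k : ℤ) - (k - 1) = 1 by ring]
    simp [geo]
    ring
  · intro i hi hik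
    rcases lt_or_gt_of_ne hik with h1 | h1
    · rw [geo_eq_inv_mul_of_neg (show (i - k : ℤ) < 0 by omega),
        show (i : ℤ) - (k - 1) = i - k + 1 by ring]
      ring
    · simp [h i hi h1]

lemma one_sub_inv_sq_nonneg {p : ℕ} (hp : p.Prime) : 0 ≤ 1 - ((p : ℚ)⁻¹) ^ 2 := by
  have h1 := one_lt_cast hp
  have h2 : (p : ℚ)⁻¹ ≤ 1 := inv_le_one_of_one_le₀ h1.le
  have h3 : 0 ≤ (p : ℚ)⁻¹ := by positivity
  nlinarith

lemma cuspNorm_sub_smul_le (m : ℕ) {c : ℚ} (hc : 0 ≤ c) (X Y : ℕ → ℚ) :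
    cuspNorm m (fun d => X d - c * Y d) ≤ cuspNorm m X + c * cuspNorm m Y := by
  have := cuspNorm_sub_le m X (fun d => c * Y d)
  rwa [cuspNorm_smul m hc] at this

lemma cuspNorm_bottom_slice_le {p : ℕ} (hp : p.Prime) (m : ℕ) {n k : ℕ} {X : ℕ → ℚ}
    (hk : k ∈ range (n + 1))
    (h : ∀ i ∈ range (n + 1), i < k → ∀ d ∈ m.divisors, X (p ^ i * d) = 0) :
    (1 - ((p : ℚ)⁻¹) ^ 2) * cuspNorm m (fun d => X (p ^ k * d)) ≤
      cuspNorm m (twist p n X k) + (p : ℚ)⁻¹ * cuspNorm m (twist p n X (k + 1)) := by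
  refine le_trans (le_of_eq ?_) (cuspNorm_sub_smul_le m (by positivity) _ _)
  rw [← cuspNorm_smul m (one_sub_inv_sq_nonneg hp)]
  exact cuspNorm_congr fun d hd => bottom_slice_eq hk fun i hi hik => h i hi hik d hd

lemma cuspNorm_top_slice_le {p : ℕ} (hp : p.Prime) (m : ℕ) {n k : ℕ} {X : ℕ → ℚ}
    (hk : k ∈ range (n + 1))
    (h : ∀ i ∈ range (n + 1), k < i → ∀ d ∈ m.divisors, X (p ^ i * d) = 0) :
    (1 - ((p : ℚ)⁻¹) ^ 2) * cuspNorm m (fun d => X (p ^ k * d)) ≤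
      cuspNorm m (twist p n X k) + (p : ℚ)⁻¹ * cuspNorm m (twist p n X (k - 1)) := by
  refine le_trans (le_of_eq ?_) (cuspNorm_sub_smul_le m (by positivity) _ _)
  rw [← cuspNorm_smul m (one_sub_inv_sq_nonneg hp)]
  exact cuspNorm_congr fun d hd => top_slice_eq hk fun i hi hik => h i hi hik d hd

/-- The weighted sum along a chain that grows geometrically up to `a` and decays geometrically
from `b` on. -/
lemma sum_edgeWt_mul_eq {p : ℕ} (hp : p.Prime) {n a b : ℕ} (hab : a ≤ b) (hb : b ≤ n) (y : ℕ → ℚ)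
    (hl : ∀ s < a, y s = (p : ℚ)⁻¹ * y (s + 1))
    (hr : ∀ s, b ≤ s → s < n → y (s + 1) = (p : ℚ)⁻¹ * y s) :
    ∑ s ∈ range (n + 1), edgeWt p n s * y s =
      ((p : ℚ) - 1)⁻¹ * (y a + y b) + ∑ s ∈ Ico a (b + 1), y s := by
  have hp0 : (p : ℚ) ≠ 0 := by exact_mod_cast hp.ne_zero
  have hp1 : (p : ℚ) - 1 ≠ 0 := by linarith [one_lt_cast hp]
  have hleft : ∀ c ≤ a, ∑ s ∈ range c, y s + ((p : ℚ) - 1)⁻¹ * y 0 = ((p : ℚ) - 1)⁻¹ * y c := by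
    intro c hc
    induction c with
    | zero => simp
    | succ c ih =>
      rw [Finset.sum_range_succ, add_right_comm, ih (by omega), hl c (by omega)]
      field_simp
      ring
  have hright : ∀ c, b ≤ c → c ≤ n → ∑ s ∈ range (c + 1), y s + ((p : ℚ) - 1)⁻¹ * y c =
      ∑ s ∈ range (b + 1), y s + ((p : ℚ) - 1)⁻¹ * y b := by
    intro c hbc
    induction c, hbc using Nat.le_induction with
    | base => intro _; rfl
    | succ c hbc ih =>
      intro hcn
      rw [← ih (by omega), Finset.sum_range_succ _ (c + 1), hr c hbc (by omega)]
      field_simp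
      ring
  have h1 := hleft a le_rfl
  have h2 := hright n hb le_rfl
  have h3 := Finset.sum_range_add_sum_Ico y (show a ≤ b + 1 by omega)
  simp only [edgeWt, add_mul, Finset.sum_add_distrib, ite_mul, zero_mul, one_mul,
    Finset.sum_ite_eq', Finset.mem_range]
  rw [if_pos (by omega), if_pos (by omega)]
  linarith

/-- A vanishing alternating chain of slices, each of norm zero or at least `B`, has large norm. -/
lemma le_sum_edgeWt_mul_cuspNorm_twist {p : ℕ} (hp : p.Prime) {m n : ℕ} {X : ℕ → ℚ} {B : ℚ}
    (hB0 : 0 ≤ B) (hsum : ∀ d ∈ m.divisors, ∑ i ∈ range (n + 1), X (p ^ i * d) = 0)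
    (hne : ∃ i ∈ range (n + 1), ∃ d ∈ m.divisors, X (p ^ i * d) ≠ 0)
    (hB : ∀ i ∈ range (n + 1), (∃ d ∈ m.divisors, X (p ^ i * d) ≠ 0) →
      B ≤ cuspNorm m (fun d => X (p ^ i * d))) :
    3 / 2 * B ≤ ∑ s ∈ range (n + 1), edgeWt p n s * cuspNorm m (twist p n X s) ∧
    (3 ≤ p → 2 * B ≤ ∑ s ∈ range (n + 1), edgeWt p n s * cuspNorm m (twist p n X s)) := by
  classical
  set S := (range (n + 1)).filter (fun i => ∃ d ∈ m.divisors, X (p ^ i * d) ≠ 0) with hS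
  have hSne : S.Nonempty := by
    obtain ⟨i, hi, h⟩ := hne
    exact ⟨i, Finset.mem_filter.2 ⟨hi, h⟩⟩
  set a := S.min' hSne with ha
  set b := S.max' hSne with hb
  have haS := Finset.mem_filter.1 (S.min'_mem hSne)
  have hbS := Finset.mem_filter.1 (S.max'_mem hSne)
  rw [← ha] at haS
  rw [← hb] at hbS
  have hlow : ∀ i ∈ range (n + 1), i < a → ∀ d ∈ m.divisors, X (p ^ i * d) = 0 := by
    intro i hi hia d hd
    by_contra hx
    have := S.min'_le i (Finset.mem_filter.2 ⟨hi, d, hd, hx⟩)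
    omega
  have hhigh : ∀ i ∈ range (n + 1), b < i → ∀ d ∈ m.divisors, X (p ^ i * d) = 0 := by
    intro i hi hia d hd
    by_contra hx
    have := S.le_max' i (Finset.mem_filter.2 ⟨hi, d, hd, hx⟩)
    omega
  have hab : a ≤ b := S.min'_le b (S.max'_mem hSne)
  have hab' : a < b := by
    refine lt_of_le_of_ne hab fun h => ?_
    obtain ⟨d, hd, hx⟩ := haS.2
    apply hx
    rw [← hsum d hd, Finset.sum_eq_single_of_mem a haS.1]
    intro i hi hia
    rcases lt_or_gt_of_ne hia with h1 | h1
    · exact hlow i hi h1 d hd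
    · exact hhigh i hi (h ▸ h1) d hd
  have hbn : b ≤ n := Nat.lt_succ_iff.1 (Finset.mem_range.1 hbS.1)
  have hP1 := one_lt_cast hp
  have hP0 : (0 : ℚ) < p := by linarith
  have hPm : (0 : ℚ) < (p : ℚ) - 1 := by linarith
  have hinv0 : 0 ≤ (p : ℚ)⁻¹ := by positivity
  set y : ℕ → ℚ := fun s => cuspNorm m (twist p n X s) with hy
  have hy0 : ∀ s, 0 ≤ y s := fun s => cuspNorm_nonneg _ _
  have htot := sum_edgeWt_mul_eq hp hab hbn y
    (fun s hs => by
      simp only [hy]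
      rw [← cuspNorm_smul m hinv0]
      refine cuspNorm_congr fun d hd => ?_
      rw [twist_eq_inv_mul_succ fun i hi his => hlow i hi (by omega) d hd]
      push_cast; rfl)
    (fun s hbs hsn => by
      simp only [hy]
      rw [← cuspNorm_smul m hinv0]
      refine cuspNorm_congr fun d hd => ?_
      rw [twist_eq_inv_mul_pred fun i hi his => hhigh i hi (by omega) d hd]
      push_cast; simp)
  have hBa := hB a haS.1 haS.2
  have hBb := hB b hbS.1 hbS.2
  change _ ≤ ∑ s ∈ range (n + 1), edgeWt p n s * y s ∧
    (_ → _ ≤ ∑ s ∈ range (n + 1), edgeWt p n s * y s)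
  rw [htot]
  by_cases hcase : b = a + 1
  · have hsl : ∀ d ∈ m.divisors, X (p ^ a * d) + X (p ^ b * d) = 0 := by
      intro d hd
      rw [← hsum d hd, ← Finset.sum_pair (show a ≠ b by omega) (f := fun i => X (p ^ i * d))]
      refine Finset.sum_subset ?_ fun i hi hiab => ?_
      · intro i hi
        rcases Finset.mem_insert.1 hi with rfl | hi
        · exact haS.1
        · rw [Finset.mem_singleton.1 hi]; exact hbS.1
      · simp only [Finset.mem_insert, Finset.mem_singleton, not_or] at hiab
        rcases lt_or_gt_of_ne hiab.1 with h1 | h1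
        · exact hlow i hi h1 d hd
        · exact hhigh i hi (by omega) d hd
    have htw : ∀ s : ℤ, ∀ d ∈ m.divisors, twist p n X s d =
        geo p (a - s) * X (p ^ a * d) + geo p (b - s) * X (p ^ b * d) := by
      intro s d hd
      unfold twist
      rw [← Finset.sum_pair (show a ≠ b by omega) (f := fun i : ℕ => geo p (i - s) * X (p ^ i * d))]
      symm
      refine Finset.sum_subset ?_ fun i hi hiab => ?_
      · intro i hi
        rcases Finset.mem_insert.1 hi with rfl | hi
        · exact haS.1
        · rw [Finset.mem_singleton.1 hi]; exact hbS.1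
      · simp only [Finset.mem_insert, Finset.mem_singleton, not_or] at hiab
        rcases lt_or_gt_of_ne hiab.1 with h1 | h1
        · simp [hlow i hi h1 d hd]
        · simp [hhigh i hi (by omega) d hd]
    have hinv : (p : ℚ)⁻¹ ≤ 1 := inv_le_one_of_one_le₀ hP1.le
    have hg1 : geo p 1 = (p : ℚ)⁻¹ := by simp [geo]
    have hya : y a = (1 - (p : ℚ)⁻¹) * cuspNorm m (fun d => X (p ^ a * d)) := by
      rw [← cuspNorm_smul m (show 0 ≤ 1 - (p : ℚ)⁻¹ by linarith)]
      refine cuspNorm_congr fun d hd => ?_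
      rw [htw _ d hd, sub_self, geo_zero, show (b : ℤ) - a = 1 by omega, hg1]
      linear_combination (p : ℚ)⁻¹ * hsl d hd
    have hyb : y b = (1 - (p : ℚ)⁻¹) * cuspNorm m (fun d => X (p ^ b * d)) := by
      rw [← cuspNorm_smul m (show 0 ≤ 1 - (p : ℚ)⁻¹ by linarith)]
      refine cuspNorm_congr fun d hd => ?_
      rw [htw _ d hd, sub_self, geo_zero, show (a : ℤ) - b = -1 by omega, geo_neg, hg1]
      linear_combination (p : ℚ)⁻¹ * hsl d hd
    have hI : ∑ s ∈ Ico a (b + 1), y s = y a + y b := by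
      rw [Finset.sum_Ico_succ_top hab, hcase]
      simp
    have key : ((p : ℚ) - 1)⁻¹ * (y a + y b) + (y a + y b) =
        cuspNorm m (fun d => X (p ^ a * d)) + cuspNorm m (fun d => X (p ^ b * d)) := by
      rw [hya, hyb]
      field_simp
      ring
    rw [hI, key]
    exact ⟨by linarith, fun _ => by linarith⟩
  · have hBa' := cuspNorm_bottom_slice_le hp m haS.1 hlow
    have hBb' := cuspNorm_top_slice_le hp m hbS.1 hhigh
    have e1 : cuspNorm m (twist p n X (a + 1)) = y (a + 1) := by simp [hy]
    have e2 : cuspNorm m (twist p n X (b - 1)) = y (b - 1) := by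
      simp only [hy]; rw [Nat.cast_sub (by omega)]; simp
    rw [e1] at hBa'
    rw [e2] at hBb'
    have hq := one_sub_inv_sq_nonneg hp
    have hA : (1 - ((p : ℚ)⁻¹) ^ 2) * B ≤ y a + (p : ℚ)⁻¹ * y (a + 1) :=
      (mul_le_mul_of_nonneg_left hBa hq).trans hBa'
    have hC : (1 - ((p : ℚ)⁻¹) ^ 2) * B ≤ y b + (p : ℚ)⁻¹ * y (b - 1) :=
      (mul_le_mul_of_nonneg_left hBb hq).trans hBb'
    have hI : y a + (y (a + 1) + y (b - 1)) / 2 + y b ≤ ∑ s ∈ Ico a (b + 1), y s := by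
      rw [Finset.sum_Ico_succ_top hab, Finset.sum_eq_sum_Ico_succ_bot hab']
      have h1 : y (a + 1) ≤ ∑ s ∈ Ico (a + 1) b, y s :=
        Finset.single_le_sum (fun i _ => hy0 i) (Finset.mem_Ico.2 ⟨le_rfl, by omega⟩)
      have h2 : y (b - 1) ≤ ∑ s ∈ Ico (a + 1) b, y s :=
        Finset.single_le_sum (fun i _ => hy0 i) (Finset.mem_Ico.2 ⟨by omega, by omega⟩)
      linarith
    have hstrong : 3 ≤ p → 2 * B ≤ ((p : ℚ) - 1)⁻¹ * (y a + y b) + ∑ s ∈ Ico a (b + 1), y s := by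
      intro hp3
      have hP3 : (3 : ℚ) ≤ p := by exact_mod_cast hp3
      set l : ℚ := ((p : ℚ) - 1)⁻¹ with hl
      have hl0 : 0 < l := by positivity
      have hl2 : l ≤ 1 / 2 := by
        rw [hl, inv_le_comm₀ hPm (by norm_num)]; linarith
      have hlp : (1 + l) * (p : ℚ)⁻¹ = l := by rw [hl]; field_simp; ring
      have hlq : (1 + l) * (1 - ((p : ℚ)⁻¹) ^ 2) = 1 + (p : ℚ)⁻¹ := by
        rw [hl]; field_simp; ring
      have hA2 := mul_le_mul_of_nonneg_left hA (show 0 ≤ 1 + l by linarith)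
      have hC2 := mul_le_mul_of_nonneg_left hC (show 0 ≤ 1 + l by linarith)
      rw [← mul_assoc, hlq, mul_add, ← mul_assoc, hlp] at hA2 hC2
      have hpB : 0 ≤ (p : ℚ)⁻¹ * B := by positivity
      have h3 := mul_le_mul_of_nonneg_right hl2 (hy0 (a + 1))
      have h4 := mul_le_mul_of_nonneg_right hl2 (hy0 (b - 1))
      linarith
    refine ⟨?_, hstrong⟩
    rcases le_or_gt 3 p with hp3 | hp3
    · linarith [hstrong hp3]
    · have hp2 : p = 2 := by have := hp.two_le; omega
      subst hp2
      norm_num at hA hC ⊢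
      linarith [hy0 a, hy0 b]

/-- All line sums over the divisors of `m` in each prime direction vanish. -/
def LineZero (m : ℕ) (Y : ℕ → ℚ) : Prop :=
  ∀ p : ℕ, p.Prime → p ∣ m → ∀ d ∈ m.divisors, ¬ p ∣ d →
    ∑ i ∈ range (m.factorization p + 1), Y (p ^ i * d) = 0

lemma LineZero.slice {p m n : ℕ} (hp : p.Prime) (hm : ¬ p ∣ m) {Y : ℕ → ℚ}
    (hY : LineZero (p ^ n * m) Y) {i : ℕ} (hi : i ∈ range (n + 1)) :
    LineZero m (fun d => Y (p ^ i * d)) := by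
  intro q hq hqm d hd hqd
  have hm0 : m ≠ 0 := by rintro rfl; simp at hm
  have hqp : q ≠ p := by rintro rfl; exact hm hqm
  have hqpi : ¬ q ∣ p ^ i * d := by
    rw [hq.dvd_mul, not_or]
    exact ⟨fun h => hqp ((Nat.prime_dvd_prime_iff_eq hq hp).1 (hq.dvd_of_dvd_pow h)), hqd⟩
  have h := hY q hq (hqm.mul_left _) (p ^ i * d) (prime_pow_mul_mem_divisors hp hd hi) hqpi
  rw [factorization_prime_pow_mul_of_ne hp hm0 hqp] at h
  rw [← h]
  exact Finset.sum_congr rfl fun j _ => by rw [mul_left_comm]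

lemma valence_le_cuspNorm {m : ℕ} (hm0 : m ≠ 0) (y : ℕ → ℤ)
    (hy : LineZero m (fun d => (y d : ℚ))) (hne : ∃ d ∈ m.divisors, (y d : ℚ) ≠ 0) :
    valence m ≤ 2 * cuspNorm m (fun d => (y d : ℚ)) ∧
      (¬ 2 ∣ m → valence m ≤ cuspNorm m (fun d => (y d : ℚ))) := by
  induction m using Nat.recOnPrimePow generalizing y with
  | zero => exact absurd rfl hm0
  | one =>
    have h1 : (1 : ℚ) ≤ |(y 1 : ℚ)| := by
      have : y 1 ≠ 0 := by simpa using hne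
      exact_mod_cast Int.one_le_abs this
    have h2 : cuspNorm 1 (fun d => (y d : ℚ)) = |(y 1 : ℚ)| := by
      simp [cuspNorm, cuspWt_one, cuspVal, cuspKer]
    rw [h2, valence_one]
    exact ⟨by linarith, fun _ => h1⟩
  | prime_pow_mul m p n hp hm hn ih =>
    have hm0 : m ≠ 0 := by rintro rfl; simp at hm
    have hP1 := one_lt_cast hp
    have hv := valence_pos m
    have hsum : ∀ d ∈ m.divisors, ∑ i ∈ range (n + 1), (y (p ^ i * d) : ℚ) = 0 := by
      intro d hd
      have := hy p hp ((dvd_pow_self p hn.ne').mul_right m) d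
        (by simpa using prime_pow_mul_mem_divisors hp hd (show 0 ∈ range (n + 1) by simp))
        (not_dvd_of_mem_divisors hm hd)
      rwa [factorization_prime_pow_mul_self hp hm] at this
    have hne' : ∃ i ∈ range (n + 1), ∃ d ∈ m.divisors, (y (p ^ i * d) : ℚ) ≠ 0 := by
      by_contra! hcon
      obtain ⟨d, hd, hyd⟩ := hne
      rw [Nat.divisors_mul, Nat.divisors_prime_pow hp] at hd
      obtain ⟨u, hu, v, hv, rfl⟩ := Finset.mem_mul.1 hd
      obtain ⟨i, hi, rfl⟩ := Finset.mem_map.1 hu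
      exact hyd (hcon i hi v hv)
    have hslice := fun i hi hnz => ih hm0 (fun d => y (p ^ i * d)) (hy.slice hp hm (i := i) hi) hnz
    rw [cuspNorm_prime_pow_mul hp hm hn.ne', valence_prime_pow_mul hp hm hn.ne']
    rcases le_or_gt 3 p with hp3 | hp3
    · have hP3 : (3 : ℚ) ≤ p := by exact_mod_cast hp3
      have hfac : ((p : ℚ) + 1) / ((p : ℚ) - 1) ≤ 2 := by
        rw [div_le_iff₀ (by linarith)]; linarith
      have hval := mul_le_mul_of_nonneg_right hfac hv.le
      constructor
      · have := (le_sum_edgeWt_mul_cuspNorm_twist hp (X := fun d => (y d : ℚ)) (B := valence m / 2)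
          (by positivity) hsum hne' fun i hi hnz => by linarith [(hslice i hi hnz).1]).2 hp3
        linarith
      · intro h2
        have h2m : ¬ 2 ∣ m := fun h => h2 (h.mul_left _)
        have := (le_sum_edgeWt_mul_cuspNorm_twist hp (X := fun d => (y d : ℚ)) (B := valence m)
          hv.le hsum hne' fun i hi hnz => (hslice i hi hnz).2 h2m).2 hp3
        linarith
    · have hp2 : p = 2 := by have := hp.two_le; omega
      subst hp2
      refine ⟨?_, fun h2 => absurd ((dvd_pow_self 2 hn.ne').mul_right m) h2⟩
      have := (le_sum_edgeWt_mul_cuspNorm_twist hp (X := fun d => (y d : ℚ)) (B := valence m)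
          hv.le hsum hne' fun i hi hnz => (hslice i hi hnz).2 hm).1
      norm_num
      linarith

lemma cuspNonneg_congr {N : ℕ} {X Y : ℕ → ℚ} (h : ∀ d ∈ N.divisors, X d = Y d)
    (hX : CuspNonneg N X) : CuspNonneg N Y := fun t ht => by
  rw [← cuspVal_congr h]; exact hX t ht

lemma cuspNonneg_smul {N : ℕ} {X : ℕ → ℚ} {c : ℚ} (hc : 0 ≤ c) (hX : CuspNonneg N X) :
    CuspNonneg N (fun d => c * X d) := fun t ht => by
  rw [cuspVal_smul]; exact mul_nonneg hc (hX t ht)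

lemma cuspNonneg_twist {p : ℕ} (hp : p.Prime) {m : ℕ} (hm : ¬ p ∣ m) {n : ℕ} {X : ℕ → ℚ}
    (hX : CuspNonneg (p ^ n * m) X) (s : ℤ) : CuspNonneg m (twist p n X s) := by
  have hnat : ∀ s ∈ range (n + 1), CuspNonneg m (twist p n X (s : ℕ)) := fun s hs t ht => by
    rw [← cuspVal_prime_pow_mul hp hm n s X ht]
    exact hX _ (prime_pow_mul_mem_divisors hp ht hs)
  rcases lt_or_ge s 0 with h0 | h0
  · refine cuspNonneg_congr (fun d _ => ?_)
      (cuspNonneg_smul (geo_nonneg p (-s)) (hnat 0 (by simp)))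
    simp only [twist, Finset.mul_sum]
    refine Finset.sum_congr rfl fun i _ => ?_
    rw [← mul_assoc, ← geo_add (by omega)]
    congr 2; push_cast; ring
  · rcases le_or_gt s n with h1 | h1
    · lift s to ℕ using h0
      exact hnat s (by simp; omega)
    · refine cuspNonneg_congr (fun d _ => ?_)
        (cuspNonneg_smul (geo_nonneg p (n - s)) (hnat n (by simp)))
      simp only [twist, Finset.mul_sum]
      refine Finset.sum_congr rfl fun i hi => ?_
      have := Finset.mem_range.1 hi
      rw [← mul_assoc, ← geo_add (by omega)]
      congr 2; ring

lemma totalExp_twist (p n m : ℕ) (X : ℕ → ℚ) (s : ℤ) :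
    totalExp m (twist p n X s) =
      ∑ i ∈ range (n + 1), geo p (i - s) * totalExp m (fun d => X (p ^ i * d)) := by
  simp only [totalExp, twist, Finset.mul_sum]
  exact Finset.sum_comm

/-- The sum of `W i` over the indices `i ≥ k`. -/
def tailSum {R : Type*} [AddCommMonoid R] (n : ℕ) (W : ℕ → R) (k : ℤ) : R :=
  ∑ i ∈ range (n + 1), if k ≤ (i : ℤ) then W i else 0

lemma tailSum_of_nonpos {R : Type*} [AddCommMonoid R] (n : ℕ) (W : ℕ → R) {k : ℤ} (hk : k ≤ 0) :
    tailSum n W k = ∑ i ∈ range (n + 1), W i :=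
  Finset.sum_congr rfl fun i _ => if_pos (by omega)

lemma tailSum_of_lt {R : Type*} [AddCommMonoid R] (n : ℕ) (W : ℕ → R) {k : ℤ} (hk : (n : ℤ) < k) :
    tailSum n W k = 0 :=
  Finset.sum_eq_zero fun i hi => if_neg (by have := Finset.mem_range.1 hi; omega)

lemma tailSum_sub_succ {R : Type*} [AddCommGroup R] {n : ℕ} (W : ℕ → R) {j : ℕ}
    (hj : j ∈ range (n + 1)) : tailSum n W j - tailSum n W (j + 1) = W j := by
  unfold tailSum
  rw [← Finset.sum_sub_distrib, Finset.sum_eq_single_of_mem j hj]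
  · rw [if_pos le_rfl, if_neg (by omega), sub_zero]
  · intro i _ hij
    by_cases h : (j : ℤ) ≤ i
    · rw [if_pos h, if_pos (by omega), sub_self]
    · rw [if_neg h, if_neg (by omega), sub_self]

/-- The fundamental solution for the second difference operator attached to `q`. -/
def tailKer (q : ℕ) (j : ℤ) : ℚ :=
  if 0 < j then q * geo q j / (q + 1) else 1 - geo q j / (q + 1)

lemma geo_succ_of_nonneg {q : ℕ} {j : ℤ} (hj : 0 ≤ j) : geo q (j + 1) = (q : ℚ)⁻¹ * geo q j := by
  rw [geo_eq_inv_mul_of_pos (show 0 < j + 1 by omega), add_sub_cancel_right]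

lemma geo_pred_of_nonpos {q : ℕ} {j : ℤ} (hj : j ≤ 0) : geo q (j - 1) = (q : ℚ)⁻¹ * geo q j := by
  rw [geo_eq_inv_mul_of_neg (show j - 1 < 0 by omega), sub_add_cancel]

lemma tailKer_sub_succ {q : ℕ} (hq : 2 ≤ q) (j : ℤ) :
    tailKer q j - tailKer q (j + 1) = ((q : ℚ) - 1) / (q + 1) * geo q j := by
  have hq0 : (q : ℚ) ≠ 0 := by positivity
  have hq1 : (q : ℚ) + 1 ≠ 0 := by positivity
  unfold tailKer
  rcases lt_trichotomy j 0 with h | rfl | h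
  · rw [if_neg (by omega), if_neg (by omega), geo_eq_inv_mul_of_neg h]
    field_simp; ring
  · rw [if_neg (by omega), if_pos (by omega), geo_succ_of_nonneg le_rfl, geo_zero]
    field_simp; ring
  · rw [if_pos h, if_pos (by omega), geo_succ_of_nonneg h.le]
    field_simp

lemma tailKer_second_difference {q : ℕ} (hq : 2 ≤ q) (j : ℤ) :
    ((q : ℚ) ^ 2 + 1) * tailKer q j - q * tailKer q (j - 1) - q * tailKer q (j + 1) =
      if j ≤ 0 then ((q : ℚ) - 1) ^ 2 else 0 := by
  have hq0 : (q : ℚ) ≠ 0 := by positivity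
  have hq1 : (q : ℚ) + 1 ≠ 0 := by positivity
  have h1 := tailKer_sub_succ hq j
  have h2 := tailKer_sub_succ hq (j - 1)
  rw [sub_add_cancel] at h2
  have h3 : tailKer q (j + 1) = tailKer q j - ((q : ℚ) - 1) / (q + 1) * geo q j := by linarith
  have h4 : tailKer q (j - 1) = tailKer q j + ((q : ℚ) - 1) / (q + 1) * geo q (j - 1) := by linarith
  rw [h3, h4]
  unfold tailKer
  by_cases h : j ≤ 0
  · rw [if_neg (by omega), if_pos h, geo_pred_of_nonpos h]
    field_simp; ring
  · rw [if_pos (by omega), if_neg h, geo_eq_inv_mul_of_pos (show 0 < j by omega)]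
    field_simp; ring

lemma exists_tail_sequence {q : ℕ} (hq : 2 ≤ q) (n : ℕ) (W : ℕ → ℚ)
    (hW : ∑ i ∈ range (n + 1), W i = 1)
    (hH : ∀ k : ℤ, 0 ≤ ∑ i ∈ range (n + 1), geo q (i - k) * W i) :
    ∃ r : ℤ → ℚ, Antitone r ∧ (∀ k, 0 ≤ r k) ∧ (∀ k, r k ≤ 1) ∧
      ∀ k, ((q : ℚ) ^ 2 + 1) * r k - q * r (k - 1) - q * r (k + 1) =
        ((q : ℚ) - 1) ^ 2 * tailSum n W k := by
  have hq2 : (2 : ℚ) ≤ q := by exact_mod_cast hq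
  have hH' : ∀ k : ℤ, 0 ≤ ∑ i ∈ range (n + 1), W i * geo q (k - i) := by
    intro k
    refine (hH k).trans_eq (Finset.sum_congr rfl fun i _ => ?_)
    rw [← geo_neg, neg_sub, mul_comm]
  set r : ℤ → ℚ := fun k => ∑ i ∈ range (n + 1), W i * tailKer q (k - i) with hr
  have hanti : Antitone r := by
    refine antitone_int_of_succ_le fun k => ?_
    have : r k - r (k + 1) =
        ((q : ℚ) - 1) / (q + 1) * ∑ i ∈ range (n + 1), W i * geo q (k - i) := by
      simp only [hr]
      rw [← Finset.sum_sub_distrib, Finset.mul_sum]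
      refine Finset.sum_congr rfl fun i _ => ?_
      rw [mul_left_comm, ← tailKer_sub_succ hq, add_sub_right_comm]
      ring
    have h2 : 0 ≤ ((q : ℚ) - 1) / (q + 1) := div_nonneg (by linarith) (by linarith)
    linarith [mul_nonneg h2 (hH' k)]
  have hpos : ∀ k : ℤ, (n : ℤ) < k → 0 ≤ r k := by
    intro k hk
    have : r k = (q : ℚ) / (q + 1) * ∑ i ∈ range (n + 1), W i * geo q (k - i) := by
      simp only [hr]
      rw [Finset.mul_sum]
      refine Finset.sum_congr rfl fun i hi => ?_
      have := Finset.mem_range.1 hi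
      rw [tailKer, if_pos (by omega)]
      ring
    rw [this]
    exact mul_nonneg (by positivity) (hH' k)
  have hone : ∀ k : ℤ, k ≤ 0 → r k ≤ 1 := by
    intro k hk
    have : r k = ∑ i ∈ range (n + 1), W i -
        1 / (q + 1) * ∑ i ∈ range (n + 1), W i * geo q (k - i) := by
      simp only [hr]
      rw [Finset.mul_sum, ← Finset.sum_sub_distrib]
      refine Finset.sum_congr rfl fun i hi => ?_
      rw [tailKer, if_neg (by omega)]
      ring
    rw [this, hW]
    have h2 : 0 ≤ 1 / ((q : ℚ) + 1) := by positivity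
    linarith [mul_nonneg h2 (hH' k)]
  refine ⟨r, hanti, fun k => ?_, fun k => ?_, fun k => ?_⟩
  · exact (hpos (max k (n + 1)) (by omega)).trans (hanti (le_max_left _ _))
  · exact (hanti (min_le_left k 0)).trans (hone (min k 0) (by omega))
  · simp only [hr, tailSum, Finset.mul_sum, ← Finset.sum_sub_distrib]
    refine Finset.sum_congr rfl fun i _ => ?_
    have h := tailKer_second_difference hq (k - i)
    rw [show k - 1 - (i : ℤ) = k - i - 1 by ring, show k + 1 - (i : ℤ) = k - i + 1 by ring]
    have h2 : (if k ≤ (i : ℤ) then W i else 0) * ((q : ℚ) - 1) ^ 2 =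
        W i * (if k - (i : ℤ) ≤ 0 then ((q : ℚ) - 1) ^ 2 else 0) := by
      by_cases hki : k ≤ (i : ℤ)
      · rw [if_pos hki, if_pos (by omega)]
      · rw [if_neg hki, if_neg (by omega)]; ring
    rw [mul_comm (((q : ℚ) - 1) ^ 2), h2, ← h]
    ring

/-- For `q ≥ 3` an integral one-dimensional exponent vector of total `1` is a unit vector. -/
lemma exists_eq_single_of_three_le {q : ℕ} (hq : 3 ≤ q) (n : ℕ) (W : ℕ → ℤ)
    (hW : ∑ i ∈ range (n + 1), W i = 1)
    (hH : ∀ k : ℤ, 0 ≤ ∑ i ∈ range (n + 1), geo q (i - k) * (W i : ℚ)) :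
    ∃ j ∈ range (n + 1), W j = 1 ∧ ∀ i ∈ range (n + 1), i ≠ j → W i = 0 := by
  have hq3 : (3 : ℚ) ≤ q := by exact_mod_cast hq
  obtain ⟨r, hanti, hr0, hr1, hrec⟩ := exists_tail_sequence (show 2 ≤ q by omega) n
    (fun i => (W i : ℚ)) (by exact_mod_cast hW) hH
  have hcast : ∀ k, tailSum n (fun i => (W i : ℚ)) k = (tailSum n W k : ℤ) := by
    intro k; simp [tailSum]
  simp only [hcast] at hrec
  have hκ : 4 * (q : ℚ) ≤ 3 * ((q : ℚ) - 1) ^ 2 := by nlinarith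
  have hbig : ∀ k, tailSum n W k ≤ 1 ∧ 0 ≤ tailSum n W k ∧
      (tailSum n W k = 1 → 4 / 7 ≤ r k) ∧ (tailSum n W k = 0 → r k ≤ 3 / 7) := by
    intro k
    have hQ : 0 < ((q : ℚ) - 1) ^ 2 := by nlinarith
    have h1 := hanti (show k - 1 ≤ k by omega)
    have h2 := hanti (show k ≤ k + 1 by omega)
    have hup : ((q : ℚ) - 1) ^ 2 * (tailSum n W k : ℤ) ≤ ((q : ℚ) - 1) ^ 2 * (7 / 4 * r k) := by
      rw [← hrec k]
      nlinarith [mul_le_mul_of_nonneg_right hκ (hr0 k), mul_nonneg (by linarith : (0 : ℚ) ≤ q)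
        (hr0 (k + 1)), mul_le_mul_of_nonneg_left h1 (by linarith : (0 : ℚ) ≤ q)]
    have hlo : ((q : ℚ) - 1) ^ 2 * (7 / 4 * r k - 3 / 4) ≤
        ((q : ℚ) - 1) ^ 2 * (tailSum n W k : ℤ) := by
      rw [← hrec k]
      nlinarith [mul_le_mul_of_nonneg_right hκ (sub_nonneg.2 (hr1 k)),
        mul_nonneg (by linarith : (0 : ℚ) ≤ q) (sub_nonneg.2 (hr1 (k - 1))),
        mul_le_mul_of_nonneg_left h2 (by linarith : (0 : ℚ) ≤ q)]
    have hup' := le_of_mul_le_mul_left hup hQ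
    have hlo' := le_of_mul_le_mul_left hlo hQ
    have a1 := hr0 k
    have a2 := hr1 k
    refine ⟨?_, ?_, fun h => ?_, fun h => ?_⟩
    · have : ((tailSum n W k : ℤ) : ℚ) < 2 := by linarith
      have : tailSum n W k < 2 := by exact_mod_cast this
      omega
    · have : (-1 : ℚ) < ((tailSum n W k : ℤ) : ℚ) := by linarith
      have : -1 < tailSum n W k := by exact_mod_cast this
      omega
    · rw [h] at hup'; push_cast at hup'; linarith
    · rw [h] at hlo'; push_cast at hlo'; linarith
  have hnn : ∀ i ∈ range (n + 1), 0 ≤ W i := by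
    intro i hi
    have h := tailSum_sub_succ W hi
    by_contra hneg
    have h1 := hbig i
    have h2 := hbig (i + 1)
    have e1 : tailSum n W i = 0 := by omega
    have e2 : tailSum n W (i + 1) = 1 := by omega
    have := h1.2.2.2 e1
    have := h2.2.2.1 e2
    have := hanti (show (i : ℤ) ≤ i + 1 by omega)
    linarith
  have hex : ∃ j ∈ range (n + 1), W j ≠ 0 := by
    by_contra! hcon
    rw [Finset.sum_eq_zero hcon] at hW
    exact zero_ne_one hW
  obtain ⟨j, hj, hWj⟩ := hex
  have hsplit := Finset.add_sum_erase (range (n + 1)) W hj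
  have hrest : 0 ≤ ∑ i ∈ (range (n + 1)).erase j, W i :=
    Finset.sum_nonneg fun i hi => hnn i (Finset.mem_of_mem_erase hi)
  have hj0 := hnn j hj
  refine ⟨j, hj, by omega, fun i hi hij => ?_⟩
  refine (Finset.sum_eq_zero_iff_of_nonneg fun i hi => hnn i (Finset.mem_of_mem_erase hi)).1
    (by omega) i (Finset.mem_erase.2 ⟨hij, hi⟩)

lemma exists_row_sum_eq_one {q m n : ℕ} (hq : q.Prime) (hq3 : 3 ≤ q) (hm : ¬ q ∣ m) {X : ℕ → ℤ}
    (hX : CuspNonneg (q ^ n * m) (fun d => (X d : ℚ)))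
    (hwt : ∑ d ∈ (q ^ n * m).divisors, X d = 1) :
    ∃ j ∈ range (n + 1), ∑ d ∈ m.divisors, X (q ^ j * d) = 1 ∧
      ∀ i ∈ range (n + 1), i ≠ j → ∑ d ∈ m.divisors, X (q ^ i * d) = 0 := by
  have hm0 : m ≠ 0 := by rintro rfl; simp at hm
  refine exists_eq_single_of_three_le hq3 n (fun i => ∑ d ∈ m.divisors, X (q ^ i * d)) ?_ fun k => ?_
  · rw [← hwt, sum_divisors_prime_pow_mul hq hm]
  · have := totalExp_nonneg hm0 (cuspNonneg_twist hq hm hX k)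
    rw [totalExp_twist] at this
    simpa [totalExp] using this

lemma cuspNorm_twist_of_row_sum {q m n j : ℕ} (hq : q.Prime) (hm : ¬ q ∣ m) {X : ℕ → ℤ}
    (hX : CuspNonneg (q ^ n * m) (fun d => (X d : ℚ))) (hj : j ∈ range (n + 1))
    (hj1 : ∑ d ∈ m.divisors, X (q ^ j * d) = 1)
    (hj0 : ∀ i ∈ range (n + 1), i ≠ j → ∑ d ∈ m.divisors, X (q ^ i * d) = 0) (s : ℤ) :
    cuspNorm m (twist q n (fun d => (X d : ℚ)) s) = valence m * geo q (j - s) := by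
  have hm0 : m ≠ 0 := by rintro rfl; simp at hm
  rw [cuspNorm_of_cuspNonneg hm0 (cuspNonneg_twist hq hm hX s), totalExp_twist,
    Finset.sum_eq_single_of_mem j hj]
  · have : totalExp m (fun d => (X (q ^ j * d) : ℚ)) = 1 := by
      rw [totalExp]; exact_mod_cast hj1
    rw [this, mul_one]
  · intro i hi hij
    have : totalExp m (fun d => (X (q ^ i * d) : ℚ)) = 0 := by
      rw [totalExp]; exact_mod_cast hj0 i hi hij
    rw [this, mul_zero]

/-- Slices far away from the row of total `1` vanish when all their line sums do. -/
lemma slice_eq_zero_of_lineZero {q m n j e : ℕ} (hq : q.Prime) (hm : ¬ q ∣ m) {X : ℕ → ℤ}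
    (hX : CuspNonneg (q ^ n * m) (fun d => (X d : ℚ))) (hj : j ∈ range (n + 1))
    (hj1 : ∑ d ∈ m.divisors, X (q ^ j * d) = 1)
    (hj0 : ∀ i ∈ range (n + 1), i ≠ j → ∑ d ∈ m.divisors, X (q ^ i * d) = 0)
    (hline : ∀ i ∈ range (n + 1), i ≠ j → LineZero m (fun d => (X (q ^ i * d) : ℚ)))
    (he0 : 1 ≤ e) (he : 4 * ((q : ℚ)⁻¹) ^ e < 1 - ((q : ℚ)⁻¹) ^ 2)
    {i : ℕ} (hi : i ∈ range (n + 1)) (hij : e ≤ ((j : ℤ) - i).natAbs) {d : ℕ}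
    (hd : d ∈ m.divisors) : X (q ^ i * d) = 0 := by
  classical
  have hm0 : m ≠ 0 := by rintro rfl; simp at hm
  have hv := valence_pos m
  have hnorm := cuspNorm_twist_of_row_sum hq hm hX hj hj1 hj0
  have hinv0 : 0 ≤ (q : ℚ)⁻¹ := by positivity
  have hinv1 : (q : ℚ)⁻¹ ≤ 1 := inv_le_one_of_one_le₀ (one_lt_cast hq).le
  have hgeo : ∀ k : ℤ, e ≤ k.natAbs → geo q k ≤ ((q : ℚ)⁻¹) ^ e := fun k hk =>
    pow_le_pow_of_le_one hinv0 hinv1 hk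
  -- a slice whose norm is controlled by the two neighbouring twists must vanish
  have hvan : ∀ k ∈ range (n + 1), e ≤ ((j : ℤ) - k).natAbs →
      (1 - ((q : ℚ)⁻¹) ^ 2) * cuspNorm m (fun d => (X (q ^ k * d) : ℚ)) ≤
        2 * (valence m * geo q (j - k)) → ∀ d ∈ m.divisors, (X (q ^ k * d) : ℚ) = 0 := by
    intro k hk hke hle
    by_contra! hne
    have h1 := (valence_le_cuspNorm hm0 (fun d => X (q ^ k * d))
      (hline k hk (by rintro rfl; simp at hke; omega)) hne).1
    have h2 := mul_le_mul_of_nonneg_left h1 (one_sub_inv_sq_nonneg hq)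
    have h3 := mul_le_mul_of_nonneg_left (hgeo _ hke) hv.le
    have h4 := mul_lt_mul_of_pos_left he hv
    linarith
  have hcast : ∀ k, (∀ d ∈ m.divisors, (X (q ^ k * d) : ℚ) = 0) ↔
      ∀ d ∈ m.divisors, X (q ^ k * d) = 0 := fun k => by simp
  by_contra hXd
  rcases le_total j i with hji | hji
  · set S := (range (n + 1)).filter (fun i => j + e ≤ i ∧ ∃ d ∈ m.divisors, X (q ^ i * d) ≠ 0)
    have hSne : S.Nonempty := ⟨i, Finset.mem_filter.2 ⟨hi, by omega, d, hd, hXd⟩⟩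
    obtain ⟨hk, hjk, d', hd', hXd'⟩ := Finset.mem_filter.1 (S.max'_mem hSne)
    set k := S.max' hSne
    have hhigh : ∀ i ∈ range (n + 1), k < i → ∀ d ∈ m.divisors, (X (q ^ i * d) : ℚ) = 0 := by
      intro i hi hki
      rw [hcast]
      intro d hd
      by_contra hx
      have := S.le_max' i (Finset.mem_filter.2 ⟨hi, by omega, d, hd, hx⟩)
      omega
    have hle := cuspNorm_top_slice_le hq m (X := fun d => (X d : ℚ)) hk hhigh
    rw [hnorm, hnorm] at hle
    have hg : geo q ((j : ℤ) - k) = (q : ℚ)⁻¹ * geo q (j - (k - 1)) := by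
      rw [geo_eq_inv_mul_of_neg (by omega)]; congr 2; ring
    refine hXd' ((hcast k).1 (hvan k hk (by omega) (hle.trans_eq ?_)) d' hd')
    rw [hg]; ring
  · set S := (range (n + 1)).filter (fun i => i + e ≤ j ∧ ∃ d ∈ m.divisors, X (q ^ i * d) ≠ 0)
    have hSne : S.Nonempty := ⟨i, Finset.mem_filter.2 ⟨hi, by omega, d, hd, hXd⟩⟩
    obtain ⟨hk, hjk, d', hd', hXd'⟩ := Finset.mem_filter.1 (S.min'_mem hSne)
    set k := S.min' hSne
    have hlow : ∀ i ∈ range (n + 1), i < k → ∀ d ∈ m.divisors, (X (q ^ i * d) : ℚ) = 0 := by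
      intro i hi hki
      rw [hcast]
      intro d hd
      by_contra hx
      have := S.min'_le i (Finset.mem_filter.2 ⟨hi, by omega, d, hd, hx⟩)
      omega
    have hle := cuspNorm_bottom_slice_le hq m (X := fun d => (X d : ℚ)) hk hlow
    rw [hnorm, hnorm] at hle
    have hg : geo q ((j : ℤ) - k) = (q : ℚ)⁻¹ * geo q (j - (k + 1)) := by
      rw [geo_eq_inv_mul_of_pos (by omega)]; congr 2; ring
    refine hXd' ((hcast k).1 (hvan k hk (by omega) (hle.trans_eq ?_)) d' hd')
    rw [hg]; ring

lemma cuspNonneg_lineSum {p m n : ℕ} (hp : p.Prime) (hm : ¬ p ∣ m) {X : ℕ → ℚ}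
    (hX : CuspNonneg (p ^ n * m) X) :
    CuspNonneg m (fun d => ∑ i ∈ range (n + 1), X (p ^ i * d)) := by
  intro t ht
  have hp1 := one_lt_cast hp
  have hc : 0 < ((p : ℚ) + 1) / ((p : ℚ) - 1) := div_pos (by linarith) (by linarith)
  refine (mul_nonneg_iff_of_pos_left hc).1 ?_
  rw [← cuspVal_smul]
  simp only [← sum_edgeWt_mul_twist hp]
  rw [cuspVal_sum]
  refine Finset.sum_nonneg fun s _ => ?_
  rw [cuspVal_smul]
  exact mul_nonneg (edgeWt_pos hp n s).le (cuspNonneg_twist hp hm hX s t ht)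

lemma exists_prime_pow_mul_of_mem_divisors {p m n d : ℕ} (hp : p.Prime)
    (hd : d ∈ (p ^ n * m).divisors) :
    ∃ i ∈ range (n + 1), ∃ d' ∈ m.divisors, d = p ^ i * d' := by
  rw [Nat.divisors_mul, Nat.divisors_prime_pow hp] at hd
  obtain ⟨u, hu, v, hv, rfl⟩ := Finset.mem_mul.1 hd
  obtain ⟨i, hi, rfl⟩ := Finset.mem_map.1 hu
  exact ⟨i, hi, v, hv, rfl⟩

/-- For a prime `q ≥ 5` the exponents are supported on a single power of `q`. -/
lemma exists_factorization_eq_of_five_le {q : ℕ} (hq : q.Prime) (hq5 : 5 ≤ q) {N : ℕ} (hN : N ≠ 0)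
    {X : ℕ → ℤ} (hX : CuspNonneg N (fun d => (X d : ℚ))) (hwt : ∑ d ∈ N.divisors, X d = 1) :
    ∃ j, ∀ d ∈ N.divisors, X d ≠ 0 → d.factorization q = j := by
  induction N using Nat.strong_induction_on generalizing X with
  | _ N ih =>
    obtain ⟨n, m, hm, rfl⟩ := Nat.exists_eq_pow_mul_and_not_dvd hN q hq.ne_one
    have hm0 : m ≠ 0 := by rintro rfl; simp at hm
    obtain ⟨j, hj, hj1, hj0⟩ := exists_row_sum_eq_one hq (by omega) hm hX hwt
    have hline : ∀ i ∈ range (n + 1), i ≠ j → LineZero m (fun d => (X (q ^ i * d) : ℚ)) := by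
      intro i hi hij p hp hpm d hd hpd
      have hpq : q ≠ p := by rintro rfl; exact hm hpm
      obtain ⟨l, m', hm', rfl⟩ := Nat.exists_eq_pow_mul_and_not_dvd hm0 p hp.ne_one
      have hm'0 : m' ≠ 0 := by rintro rfl; simp at hm'
      have hl : l ≠ 0 := by rintro rfl; simp [hm'] at hpm
      have hqm' : ¬ q ∣ m' := fun h => hm (h.mul_left _)
      rw [factorization_prime_pow_mul_self hp hm']
      have hpN : ¬ p ∣ q ^ n * m' := by
        rw [hp.dvd_mul, not_or]
        exact ⟨fun h => hpq.symm ((Nat.prime_dvd_prime_iff_eq hp hq).1 (hp.dvd_of_dvd_pow h)), hm'⟩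
      have hN' : q ^ n * m' ≠ 0 := mul_ne_zero (pow_ne_zero _ hq.ne_zero) hm'0
      have hNeq : q ^ n * (p ^ l * m') = p ^ l * (q ^ n * m') := by ring
      rw [hNeq] at hX hwt
      obtain ⟨j', hj'⟩ := ih (q ^ n * m')
        (by rw [hNeq]
            exact lt_mul_of_one_lt_left (Nat.pos_of_ne_zero hN') (Nat.one_lt_pow hl hp.one_lt)) hN'
        (X := fun d => ∑ i ∈ range (l + 1), X (p ^ i * d))
        (by simpa using cuspNonneg_lineSum hp hpN hX)
        (by rw [sum_divisors_prime_pow_mul hp hpN, Finset.sum_comm] at hwt; exact hwt)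
      have hjj : j' = j := by
        rw [sum_divisors_prime_pow_mul hp hm', Finset.sum_comm] at hj1
        obtain ⟨d, hd, hne⟩ := Finset.exists_ne_zero_of_sum_ne_zero
          (by rw [hj1]; exact one_ne_zero)
        rw [← hj' (q ^ j * d) (prime_pow_mul_mem_divisors hq hd hj)
          (by simpa only [mul_left_comm] using hne)]
        exact factorization_prime_pow_mul_self hq (not_dvd_of_mem_divisors hqm' hd) j
      obtain ⟨u, -, v, hv, rfl⟩ := exists_prime_pow_mul_of_mem_divisors hp hd
      have hu : u = 0 := by
        by_contra hu
        exact hpd ((dvd_pow_self p hu).mul_right v)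
      subst hu
      by_contra hne
      have hne' : ∑ i' ∈ range (l + 1), X (p ^ i' * (q ^ i * v)) ≠ 0 := by
        intro h0
        apply hne
        beta_reduce
        rw [pow_zero, one_mul]
        simp only [mul_left_comm (p ^ _)] at h0
        exact_mod_cast h0
      have := hj' (q ^ i * v) (prime_pow_mul_mem_divisors hq hv hi) hne'
      rw [factorization_prime_pow_mul_self hq (not_dvd_of_mem_divisors hqm' hv)] at this
      omega
    have he : 4 * ((q : ℚ)⁻¹) ^ 1 < 1 - ((q : ℚ)⁻¹) ^ 2 := by
      have hQ : (5 : ℚ) ≤ q := by exact_mod_cast hq5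
      have h1 : (q : ℚ)⁻¹ ≤ 5⁻¹ := inv_anti₀ (by norm_num) hQ
      have h2 : 0 < (q : ℚ)⁻¹ := by positivity
      nlinarith
    refine ⟨j, fun d hd hXd => ?_⟩
    obtain ⟨i, hi, u, hdm, rfl⟩ := exists_prime_pow_mul_of_mem_divisors hq hd
    rw [factorization_prime_pow_mul_self hq (not_dvd_of_mem_divisors hm hdm)]
    by_contra hij
    exact hXd (slice_eq_zero_of_lineZero hq hm hX hj hj1 hj0 hline le_rfl he hi (by omega) hdm)

/-- A `2`-adic tail sequence: `r` is antitone with values in `[0, 1]`, and its second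
difference is `A / 3` with `A` integral. -/
structure TailSeq (r : ℤ → ℚ) (A : ℤ → ℤ) : Prop where
  anti : Antitone r
  nonneg : ∀ k, 0 ≤ r k
  le_one : ∀ k, r k ≤ 1
  second_diff : ∀ k, 3 * (5 * r k - 2 * r (k - 1) - 2 * r (k + 1)) = A k

namespace TailSeq

variable {r : ℤ → ℚ} {A : ℤ → ℤ}

lemma second_diff_succ (h : TailSeq r A) (k : ℤ) :
    3 * (5 * r (k + 1) - 2 * r k - 2 * r (k + 2)) = A (k + 1) := by
  rw [← h.second_diff (k + 1), add_sub_cancel_right, add_assoc]; rfl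

lemma anti_succ (h : TailSeq r A) (k : ℤ) : r (k + 1) ≤ r k := h.anti (by omega)

lemma window_one (h : TailSeq r A) (k : ℤ) : -6 ≤ A (k + 1) ∧ A (k + 1) ≤ 9 := by
  have e1 := h.second_diff_succ k
  have m0 := h.anti_succ k
  have m1 := h.anti_succ (k + 1)
  rw [add_assoc k 1 1] at m1
  have b0 := h.le_one k
  have b1 := h.nonneg (k + 2)
  norm_num at *
  refine ⟨?_, ?_⟩ <;> qify <;> linarith

lemma window_two (h : TailSeq r A) (k : ℤ) :
    5 * A (k + 1) + 2 * A (k + 2) ≤ 33 ∧ A (k + 2) - A (k + 1) ≤ 6 ∧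
      -2 * A (k + 1) - 5 * A (k + 2) ≤ 12 := by
  have e1 := h.second_diff_succ k
  have e2 := h.second_diff_succ (k + 1)
  have m0 := h.anti_succ k
  have m1 := h.anti_succ (k + 1)
  have m2 := h.anti_succ (k + 2)
  have b0 := h.le_one k
  have b1 := h.nonneg (k + 3)
  norm_num [add_assoc] at *
  refine ⟨?_, ?_, ?_⟩ <;> qify <;> linarith

lemma window_three (h : TailSeq r A) (k : ℤ) :
    21 * A (k + 1) + 10 * A (k + 2) + 4 * A (k + 3) ≤ 129 ∧
      -11 * A (k + 1) + 15 * A (k + 2) + 6 * A (k + 3) ≤ 66 ∧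
      -6 * A (k + 1) - 15 * A (k + 2) + 11 * A (k + 3) ≤ 36 ∧
      -4 * A (k + 1) - 10 * A (k + 2) - 21 * A (k + 3) ≤ 24 := by
  have e1 := h.second_diff_succ k
  have e2 := h.second_diff_succ (k + 1)
  have e3 := h.second_diff_succ (k + 2)
  have m0 := h.anti_succ k
  have m1 := h.anti_succ (k + 1)
  have m2 := h.anti_succ (k + 2)
  have m3 := h.anti_succ (k + 3)
  have b0 := h.le_one k
  have b1 := h.nonneg (k + 4)
  norm_num [add_assoc] at *
  refine ⟨?_, ?_, ?_, ?_⟩ <;> qify <;> linarith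

lemma window_four (h : TailSeq r A) (k : ℤ) :
    85 * A (k + 1) + 42 * A (k + 2) + 20 * A (k + 3) + 8 * A (k + 4) ≤ 513 ∧
      -43 * A (k + 1) + 63 * A (k + 2) + 30 * A (k + 3) + 12 * A (k + 4) ≤ 258 ∧
      -2 * A (k + 1) - 5 * A (k + 2) + 5 * A (k + 3) + 2 * A (k + 4) ≤ 12 ∧
      -12 * A (k + 1) - 30 * A (k + 2) - 63 * A (k + 3) + 43 * A (k + 4) ≤ 72 ∧
      -8 * A (k + 1) - 20 * A (k + 2) - 42 * A (k + 3) - 85 * A (k + 4) ≤ 48 := by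
  have e1 := h.second_diff_succ k
  have e2 := h.second_diff_succ (k + 1)
  have e3 := h.second_diff_succ (k + 2)
  have e4 := h.second_diff_succ (k + 3)
  have m0 := h.anti_succ k
  have m1 := h.anti_succ (k + 1)
  have m2 := h.anti_succ (k + 2)
  have m3 := h.anti_succ (k + 3)
  have m4 := h.anti_succ (k + 4)
  have b0 := h.le_one k
  have b1 := h.nonneg (k + 5)
  norm_num [add_assoc] at *
  refine ⟨?_, ?_, ?_, ?_, ?_⟩ <;> qify <;> linarith

lemma not_alternating (h : TailSeq r A) (k : ℤ) (h1 : A (k + 1) = 3) (h2 : A (k + 2) = 0)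
    (h3 : A (k + 3) = 3) (h4 : A (k + 4) = 0) (h5 : A (k + 5) = 3) : False := by
  have e1 := h.second_diff_succ k
  have e2 := h.second_diff_succ (k + 1)
  have e3 := h.second_diff_succ (k + 2)
  have e4 := h.second_diff_succ (k + 3)
  have e5 := h.second_diff_succ (k + 4)
  have m0 := h.anti_succ k
  have m1 := h.anti_succ (k + 1)
  have m2 := h.anti_succ (k + 2)
  have m3 := h.anti_succ (k + 3)
  have m4 := h.anti_succ (k + 4)
  have m5 := h.anti_succ (k + 5)
  have b0 := h.le_one k
  have b1 := h.nonneg (k + 6)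
  norm_num [add_assoc] at e1 e2 e3 e4 e5 m1 m2 m3 m4 m5
  rw [h1] at e1
  rw [h2] at e2
  rw [h3] at e3
  rw [h4] at e4
  rw [h5] at e5
  norm_num at e1 e2 e3 e4 e5
  linarith

lemma abs_le_one_of_lt (h : TailSeq r A) {k : ℤ} (hk : r k < 2 / 9) :
    -1 ≤ A (k + 1) ∧ A (k + 1) ≤ 1 := by
  have e1 := h.second_diff_succ k
  have m0 := h.anti_succ k
  have m1 := h.anti_succ (k + 1)
  have b0 := h.nonneg (k + 1)
  have b1 := h.nonneg (k + 2)
  norm_num [add_assoc] at *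
  constructor
  · have : (-2 : ℚ) < A (k + 1) := by linarith
    have : -2 < A (k + 1) := by exact_mod_cast this
    omega
  · have : (A (k + 1) : ℚ) < 2 := by linarith
    have : A (k + 1) < 2 := by exact_mod_cast this
    omega

/-- Bound on the tail after a window of five values ending in two zeros. -/
lemma lt_of_window (h : TailSeq r A) (k : ℤ) (h1 : A (k + 1) = 3) (h4 : A (k + 4) = 0)
    (h5 : A (k + 5) = 0)
    (hA : (A (k + 2), A (k + 3)) ∈ ([(-3, 0), (-2, 0), (0, 0), (0, 3), (1, 2), (5, 0), (6, -3),
      (6, 0), (8, -5), (9, -6)] : List (ℤ × ℤ))) : r (k + 5) < 2 / 9 := by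
  have e1 := h.second_diff_succ k
  have e2 := h.second_diff_succ (k + 1)
  have e3 := h.second_diff_succ (k + 2)
  have e4 := h.second_diff_succ (k + 3)
  have e5 := h.second_diff_succ (k + 4)
  have m0 := h.anti_succ k
  have m1 := h.anti_succ (k + 1)
  have m2 := h.anti_succ (k + 2)
  have m3 := h.anti_succ (k + 3)
  have m4 := h.anti_succ (k + 4)
  have m5 := h.anti_succ (k + 5)
  have b0 := h.le_one k
  have b1 := h.nonneg (k + 6)
  norm_num [add_assoc] at e1 e2 e3 e4 e5 m1 m2 m3 m4 m5
  rw [h1] at e1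
  rw [h4] at e4
  rw [h5] at e5
  simp only [List.mem_cons, List.not_mem_nil, or_false, Prod.mk.injEq] at hA
  rcases hA with ⟨h2, h3⟩ | ⟨h2, h3⟩ | ⟨h2, h3⟩ | ⟨h2, h3⟩ | ⟨h2, h3⟩ | ⟨h2, h3⟩ | ⟨h2, h3⟩ |
    ⟨h2, h3⟩ | ⟨h2, h3⟩ | ⟨h2, h3⟩ <;>
  · rw [h2] at e2
    rw [h3] at e3
    norm_num at e1 e2 e3 e4 e5
    linarith

end TailSeq

/-- The possible pairs of consecutive tail sums at the first index where they change. -/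
def breakList : List (ℤ × ℤ × ℤ × ℤ × ℤ × ℤ) :=
  [(-1, 0, 0, 0, 0, 0), (-1, 0, 1, 0, 0, 0), (-1, 1, 0, 0, 0, 0), (0, 0, 0, 0, 0, 0),
   (0, 0, 0, 1, 0, 0), (0, 0, 1, 1, 0, -1), (0, 1, 0, 1, -1, 0), (2, -1, 0, 0, 0, 0),
   (2, 0, -1, 0, 0, 0), (2, 0, 0, -1, 0, 0), (2, 0, 0, 0, 0, 0), (3, -1, 0, -2, 1, 0),
   (3, 0, -1, -2, 0, 1), (3, 0, 0, -2, 0, 0)]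

/-- Three tail sequences whose second differences come from common integral tail sums. -/
structure TailTriple (r s t : ℤ → ℚ) (a e f : ℤ → ℤ) : Prop where
  fst : TailSeq r fun k => 3 * a k + e k + f k
  snd : TailSeq s fun k => 3 * a k + 9 * e k + f k
  trd : TailSeq t fun k => 3 * a k + 9 * f k + e k

namespace TailTriple

variable {r s t : ℤ → ℚ} {a e f : ℤ → ℤ}

lemma bounds (h : TailTriple r s t a e f) (k : ℤ) :
    (-1 ≤ e (k + 1) ∧ e (k + 1) ≤ 1) ∧ (-1 ≤ f (k + 1) ∧ f (k + 1) ≤ 1) ∧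
      (-2 ≤ a (k + 1) ∧ a (k + 1) ≤ 3) := by
  have h1 := h.fst.window_one k
  have h2 := h.snd.window_one k
  have h3 := h.trd.window_one k
  omega

lemma mem_breakList (h : TailTriple r s t a e f) (k : ℤ) (ha : a (k + 1) = 1) (he : e (k + 1) = 0)
    (hf : f (k + 1) = 0) (hne : ¬ (a (k + 2) = 1 ∧ e (k + 2) = 0 ∧ f (k + 2) = 0)) :
    (a (k + 2), e (k + 2), f (k + 2), a (k + 3), e (k + 3), f (k + 3)) ∈ breakList := by
  have b1 := h.bounds (k + 1)
  have b2 := h.bounds (k + 2)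
  have p1 := h.fst.window_two k
  have p2 := h.snd.window_two k
  have p3 := h.trd.window_two k
  have w1 := h.fst.window_three k
  have w2 := h.snd.window_three k
  have w3 := h.trd.window_three k
  rw [show k + 1 + 1 = k + 2 by ring] at b1
  rw [show k + 2 + 1 = k + 3 by ring] at b2
  simp only [ha, he, hf] at p1 p2 p3 w1 w2 w3
  generalize a (k + 2) = a₁ at *
  generalize e (k + 2) = e₁ at *
  generalize f (k + 2) = f₁ at *
  generalize a (k + 3) = a₂ at *
  generalize e (k + 3) = e₂ at *
  generalize f (k + 3) = f₂ at *
  obtain ⟨⟨_, _⟩, ⟨_, _⟩, _, _⟩ := b1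
  obtain ⟨⟨_, _⟩, ⟨_, _⟩, _, _⟩ := b2
  interval_cases e₁ <;> interval_cases f₁ <;> (try omega) <;> interval_cases a₁ <;> (try omega) <;>
    interval_cases e₂ <;> (try omega) <;> interval_cases f₂ <;> (try omega) <;>
    interval_cases a₂ <;> first | omega | decide

lemma eq_zero_add_four (h : TailTriple r s t a e f) (k : ℤ) (ha : a (k + 1) = 1)
    (he : e (k + 1) = 0) (hf : f (k + 1) = 0)
    (hb : (a (k + 2), e (k + 2), f (k + 2), a (k + 3), e (k + 3), f (k + 3)) ∈ breakList) :
    a (k + 4) = 0 ∧ e (k + 4) = 0 ∧ f (k + 4) = 0 := by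
  have b1 := h.bounds (k + 3)
  have w1 := h.fst.window_four k
  have w2 := h.snd.window_four k
  have w3 := h.trd.window_four k
  rw [show k + 3 + 1 = k + 4 by ring] at b1
  obtain ⟨⟨_, _⟩, ⟨_, _⟩, _, _⟩ := b1
  simp only [breakList, List.mem_cons, List.not_mem_nil, or_false, Prod.mk.injEq] at hb
  rcases hb with hb | hb | hb | hb | hb | hb | hb | hb | hb | hb | hb | hb | hb | hb <;>
  · obtain ⟨h1, h2, h3, h4, h5, h6⟩ := hb
    simp only [ha, he, hf, h1, h2, h3, h4, h5, h6] at w1 w2 w3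
    omega

lemma eq_zero_add_five (h : TailTriple r s t a e f) (k : ℤ) (ha : a (k + 1) = 1)
    (he : e (k + 1) = 0) (hf : f (k + 1) = 0)
    (hb : (a (k + 2), e (k + 2), f (k + 2), a (k + 3), e (k + 3), f (k + 3)) ∈ breakList) :
    a (k + 5) = 0 ∧ e (k + 5) = 0 ∧ f (k + 5) = 0 := by
  obtain ⟨ha4, he4, hf4⟩ := h.eq_zero_add_four k ha he hf hb
  have b1 := h.bounds (k + 4)
  have w1 := h.fst.window_four (k + 1)
  have w2 := h.snd.window_four (k + 1)
  have w3 := h.trd.window_four (k + 1)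
  have hno := h.fst.not_alternating k
  rw [show k + 4 + 1 = k + 5 by ring] at b1
  rw [show k + 1 + 1 = k + 2 by ring, show k + 1 + 2 = k + 3 by ring,
    show k + 1 + 3 = k + 4 by ring, show k + 1 + 4 = k + 5 by ring] at w1 w2 w3
  obtain ⟨⟨_, _⟩, ⟨_, _⟩, _, _⟩ := b1
  simp only [breakList, List.mem_cons, List.not_mem_nil, or_false, Prod.mk.injEq] at hb
  rcases hb with hb | hb | hb | hb | hb | hb | hb | hb | hb | hb | hb | hb | hb | hb <;>
  · obtain ⟨h1, h2, h3, h4, h5, h6⟩ := hb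
    simp only [ha, he, hf, h1, h2, h3, h4, h5, h6, ha4, he4, hf4] at w1 w2 w3 hno
    by_contra hcon
    first
      | omega
      | exact hno (by norm_num) (by norm_num) (by norm_num) (by norm_num) (by omega)

lemma eq_zero_of_lt (h : TailTriple r s t a e f) {k : ℤ} (hr : r k < 2 / 9) (hs : s k < 2 / 9)
    (ht : t k < 2 / 9) : a (k + 1) = 0 ∧ e (k + 1) = 0 ∧ f (k + 1) = 0 := by
  have h1 := h.fst.abs_le_one_of_lt hr
  have h2 := h.snd.abs_le_one_of_lt hs
  have h3 := h.trd.abs_le_one_of_lt ht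
  omega

lemma eq_zero_of_ge (h : TailTriple r s t a e f) (k : ℤ) (ha : a (k + 1) = 1)
    (he : e (k + 1) = 0) (hf : f (k + 1) = 0)
    (hb : (a (k + 2), e (k + 2), f (k + 2), a (k + 3), e (k + 3), f (k + 3)) ∈ breakList)
    {l : ℤ} (hl : k + 4 ≤ l) : a l = 0 ∧ e l = 0 ∧ f l = 0 := by
  have h4 := h.eq_zero_add_four k ha he hf hb
  have h5 := h.eq_zero_add_five k ha he hf hb
  obtain rfl | rfl | hl' : l = k + 4 ∨ l = k + 5 ∨ k + 5 ≤ l - 1 := by omega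
  · exact h4
  · exact h5
  have hb' := hb
  simp only [breakList, List.mem_cons, List.not_mem_nil, or_false, Prod.mk.injEq] at hb
  have hlt : r (k + 5) < 2 / 9 ∧ s (k + 5) < 2 / 9 ∧ t (k + 5) < 2 / 9 := by
    refine ⟨h.fst.lt_of_window k ?_ ?_ ?_ ?_, h.snd.lt_of_window k ?_ ?_ ?_ ?_,
      h.trd.lt_of_window k ?_ ?_ ?_ ?_⟩
    all_goals first
      | omega
      | (rcases hb with hb | hb | hb | hb | hb | hb | hb | hb | hb | hb | hb | hb | hb | hb <;>
          (obtain ⟨h1, h2, h3, h4, h5, h6⟩ := hb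
           simp only [h1, h2, h3, h4, h5, h6]
           decide))
  have := h.eq_zero_of_lt (k := l - 1) ((h.fst.anti hl').trans_lt hlt.1)
    ((h.snd.anti hl').trans_lt hlt.2.1) ((h.trd.anti hl').trans_lt hlt.2.2)
  rwa [sub_add_cancel] at this

/-- The tail sums are `(1, 0, 0)`, then take two values from `breakList`, then vanish. -/
theorem classification (h : TailTriple r s t a e f) {n : ℤ}
    (h0 : ∀ k ≤ 0, a k = 1 ∧ e k = 0 ∧ f k = 0) (hn : a n = 0) :
    ∃ κ : ℕ, (∀ k : ℤ, k ≤ κ → a k = 1 ∧ e k = 0 ∧ f k = 0) ∧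
      (a (κ + 1), e (κ + 1), f (κ + 1), a (κ + 2), e (κ + 2), f (κ + 2)) ∈ breakList ∧
      ∀ k : ℤ, κ + 3 ≤ k → a k = 0 ∧ e k = 0 ∧ f k = 0 := by
  classical
  have hex : ∃ k : ℕ, ¬ (a k = 1 ∧ e k = 0 ∧ f k = 0) := by
    have hn0 : 0 ≤ n := by
      by_contra hneg
      have := (h0 n (by omega)).1
      omega
    lift n to ℕ using hn0
    exact ⟨n, by omega⟩
  have hmin := fun k => Nat.find_min hex (m := k)
  have hspec := Nat.find_spec hex
  generalize Nat.find hex = K at *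
  have hK : K ≠ 0 := by
    rintro rfl
    exact hspec (h0 _ le_rfl)
  obtain ⟨κ, rfl⟩ := Nat.exists_eq_succ_of_ne_zero hK
  have hO : ∀ k : ℤ, k ≤ κ → a k = 1 ∧ e k = 0 ∧ f k = 0 := by
    intro k hk
    rcases le_total k 0 with hk0 | hk0
    · exact h0 k hk0
    · lift k to ℕ using hk0
      exact not_not.1 (hmin k (by omega))
  have hκ := hO κ le_rfl
  have e1 : (κ : ℤ) - 1 + 1 = κ := by ring
  have e2 : (κ : ℤ) - 1 + 2 = κ + 1 := by ring
  have e3 : (κ : ℤ) - 1 + 3 = κ + 2 := by ring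
  have hb := h.mem_breakList (κ - 1) (by rw [e1]; exact hκ.1) (by rw [e1]; exact hκ.2.1)
    (by rw [e1]; exact hκ.2.2) (by rw [e2]; exact_mod_cast hspec)
  refine ⟨κ, hO, ?_, fun k hk => ?_⟩
  · rwa [e2, e3] at hb
  · exact h.eq_zero_of_ge (κ - 1) (by rw [e1]; exact hκ.1) (by rw [e1]; exact hκ.2.1)
      (by rw [e1]; exact hκ.2.2) hb (by omega)

end TailTriple

lemma sum_range_eq_three_terms {b j : ℕ} {g : ℕ → ℚ} (hb : ∀ i, b < i → g i = 0)
    (hj : ∀ i : ℕ, 2 ≤ ((j : ℤ) - i).natAbs → g i = 0) :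
    ∑ i ∈ range (b + 1), g i = g j + g (j + 1) + if 1 ≤ j then g (j - 1) else 0 := by
  have h1 : ∑ i ∈ range (b + 1), g i = ∑ i ∈ range (b + j + 3), g i :=
    Finset.sum_subset (Finset.range_subset_range.2 (by omega)) fun i _ hi => hb i (by simpa using hi)
  have h2 : ∑ i ∈ range (j + 2), g i = ∑ i ∈ range (b + j + 3), g i :=
    Finset.sum_subset (Finset.range_subset_range.2 (by omega)) fun i _ hi => hj i (by
      simp only [mem_range] at hi; omega)
  rw [h1, ← h2, Finset.sum_range_succ, Finset.sum_range_succ]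
  rcases j with _ | j
  · simp
  · rw [Finset.sum_range_succ, Finset.sum_eq_zero fun i hi => hj i (by
      simp only [mem_range] at hi; push_cast; omega)]
    simp
    ring

lemma sum_divisors_two_pow (a : ℕ) {M : Type*} [AddCommMonoid M] (g : ℕ → M) :
    ∑ d ∈ (2 ^ a).divisors, g d = ∑ i ∈ range (a + 1), g (2 ^ i) := by
  rw [Nat.divisors_prime_pow Nat.prime_two, Finset.sum_map]
  rfl

lemma lineZero_two_pow {a : ℕ} {Y : ℕ → ℚ} (h : ∑ d ∈ (2 ^ a).divisors, Y d = 0) :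
    LineZero (2 ^ a) Y := by
  intro p hp hpa d hd hpd
  obtain rfl : p = 2 := (Nat.prime_dvd_prime_iff_eq hp Nat.prime_two).1 (hp.dvd_of_dvd_pow hpa)
  obtain ⟨k, -, rfl⟩ := (Nat.dvd_prime_pow Nat.prime_two).1 (Nat.dvd_of_mem_divisors hd)
  obtain rfl : k = 0 := by
    by_contra hk
    exact hpd (dvd_pow_self 2 hk)
  rw [sum_divisors_two_pow] at h
  simpa [Nat.prime_two.factorization_pow] using h

lemma cuspNonneg_one {Y : ℕ → ℚ} (h : CuspNonneg 1 Y) : 0 ≤ Y 1 := by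
  simpa [CuspNonneg, cuspVal, cuspKer] using h

/-- `X` is the rescaling of a member of Zagier's list. -/
def IsZagierRescaling (X : ℕ → ℤ) : Prop :=
  ∃ ν : ℕ, 0 < ν ∧ ∃ Y ∈ zagierList, (∀ g, X (ν * g) = Y g) ∧ ∀ e, X e ≠ 0 → ν ∣ e

lemma TailSeq.of_exists {n : ℕ} {W : ℕ → ℚ} {A : ℤ → ℤ}
    (hW : ∑ i ∈ range (n + 1), W i = 1)
    (hH : ∀ k : ℤ, 0 ≤ ∑ i ∈ range (n + 1), geo 2 (i - k) * W i)
    (hA : ∀ k, 3 * tailSum n W k = A k) : ∃ r, TailSeq r A := by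
  obtain ⟨r, h1, h2, h3, h4⟩ := exists_tail_sequence le_rfl n W hW hH
  refine ⟨r, ⟨h1, h2, h3, fun k => ?_⟩⟩
  have := h4 k
  rw [← hA]
  push_cast at this
  linarith

lemma exists_tailTriple {n : ℕ} {x y z : ℕ → ℤ} (hx : ∑ i ∈ range (n + 1), x i = 1)
    (hy : ∑ i ∈ range (n + 1), y i = 0) (hz : ∑ i ∈ range (n + 1), z i = 0)
    (h0 : ∀ k : ℤ, 0 ≤ ∑ i ∈ range (n + 1), geo 2 (i - k) * (x i + (y i + z i) / 3 : ℚ))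
    (h1 : ∀ k : ℤ, 0 ≤ ∑ i ∈ range (n + 1), geo 2 (i - k) * (x i + 3 * y i + z i / 3 : ℚ))
    (h2 : ∀ k : ℤ, 0 ≤ ∑ i ∈ range (n + 1), geo 2 (i - k) * (x i + 3 * z i + y i / 3 : ℚ)) :
    ∃ r s t, TailTriple r s t (tailSum n x) (tailSum n y) (tailSum n z) := by
  have hx' : ∑ i ∈ range (n + 1), (x i : ℚ) = 1 := by exact_mod_cast hx
  have hy' : ∑ i ∈ range (n + 1), (y i : ℚ) = 0 := by exact_mod_cast hy
  have hz' : ∑ i ∈ range (n + 1), (z i : ℚ) = 0 := by exact_mod_cast hz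
  have key : ∀ (k : ℤ) (c d : ℚ), tailSum n (fun i => (x i : ℚ) + c * y i + d * z i) k =
      tailSum n x k + c * tailSum n y k + d * tailSum n z k := fun k c d => by
    simp only [tailSum, Int.cast_sum, Finset.mul_sum, ← Finset.sum_add_distrib]
    refine Finset.sum_congr rfl fun i _ => ?_
    split_ifs <;> simp
  have hsum : ∀ c d : ℚ, ∑ i ∈ range (n + 1), ((x i : ℚ) + c * y i + d * z i) = 1 := fun c d => by
    simp only [Finset.sum_add_distrib, ← Finset.mul_sum, hx', hy', hz']
    ring
  obtain ⟨r, hr⟩ := TailSeq.of_exists (A := fun k => 3 * tailSum n x k + tailSum n y k + tailSum n z k)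
    (hsum (1 / 3) (1 / 3)) (fun k => (h0 k).trans_eq (Finset.sum_congr rfl fun i _ => by ring))
    (fun k => by rw [key]; push_cast; ring)
  obtain ⟨s, hs⟩ := TailSeq.of_exists
    (A := fun k => 3 * tailSum n x k + 9 * tailSum n y k + tailSum n z k)
    (hsum 3 (1 / 3)) (fun k => (h1 k).trans_eq (Finset.sum_congr rfl fun i _ => by ring))
    (fun k => by rw [key]; push_cast; ring)
  obtain ⟨t, ht⟩ := TailSeq.of_exists
    (A := fun k => 3 * tailSum n x k + 9 * tailSum n z k + tailSum n y k)
    (hsum (1 / 3) 3) (fun k => (h2 k).trans_eq (Finset.sum_congr rfl fun i _ => by ring))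
    (fun k => by rw [key]; push_cast; ring)
  exact ⟨r, s, t, hr, hs, ht⟩

lemma eq_tailSum_sub {n : ℕ} {x : ℕ → ℤ} (hx : ∀ i, n < i → x i = 0) (i : ℕ) :
    x i = tailSum n x i - tailSum n x (i + 1) := by
  by_cases hi : i ≤ n
  · rw [tailSum_sub_succ x (by simpa [Nat.lt_succ_iff] using hi)]
  · rw [hx i (by omega), tailSum_of_lt _ _ (by omega), tailSum_of_lt _ _ (by omega), sub_zero]

lemma cuspNonneg_of_isHolEta {N : ℕ} {X : ℕ → ℤ} (h : IsHolEta N X) :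
    CuspNonneg N fun d => (X d : ℚ) := by
  intro t ht
  have hN : N ≠ 0 := (Nat.mem_divisors.1 ht).2
  have ht0 : (0 : ℚ) < t := by exact_mod_cast Nat.pos_of_mem_divisors ht
  have hg : (0 : ℚ) < Nat.gcd (t ^ 2) N := by
    exact_mod_cast Nat.gcd_pos_of_pos_right _ (Nat.pos_of_ne_zero hN)
  have hN' : (0 : ℚ) < N := by exact_mod_cast Nat.pos_of_ne_zero hN
  have heq : etaOrd N X t = N * t / Nat.gcd (t ^ 2) N * cuspVal N (fun d => (X d : ℚ)) t := by
    rw [etaOrd, cuspVal, Finset.mul_sum]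
    refine Finset.sum_congr rfl fun d hd => ?_
    have hd0 : (d : ℚ) ≠ 0 := by exact_mod_cast (Nat.pos_of_mem_divisors hd).ne'
    unfold cuspKer
    field_simp
  have := h t ht
  rw [heq] at this
  exact nonneg_of_mul_nonneg_right this (by positivity)

lemma zvec_eq_zero_of_ne {A B C D E F : ℤ} {g : ℕ}
    (h : g ≠ 1 ∧ g ≠ 2 ∧ g ≠ 3 ∧ g ≠ 4 ∧ g ≠ 6 ∧ g ≠ 12) : zvec A B C D E F g = 0 := by
  simp [zvec, h]

lemma isZagierRescaling_of_window {X : ℕ → ℤ} {c κ : ℕ} {A B C D E F : ℤ}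
    (hY : zvec A B C D E F ∈ zagierList)
    (hsm : ∀ e, X e ≠ 0 → ∃ i k, e = 3 ^ i * 2 ^ k)
    (hwin : ∀ i k, X (3 ^ i * 2 ^ k) ≠ 0 → (i = c ∨ i = c + 1) ∧ κ ≤ k ∧ k ≤ κ + 2)
    (hA : X (3 ^ c * 2 ^ κ) = A) (hB : X (3 ^ c * 2 ^ (κ + 1)) = B)
    (hC : X (3 ^ (c + 1) * 2 ^ κ) = C) (hD : X (3 ^ c * 2 ^ (κ + 2)) = D)
    (hE : X (3 ^ (c + 1) * 2 ^ (κ + 1)) = E) (hF : X (3 ^ (c + 1) * 2 ^ (κ + 2)) = F) :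
    IsZagierRescaling X := by
  refine ⟨3 ^ c * 2 ^ κ, by positivity, _, hY, fun g => ?_, fun e he => ?_⟩
  · have hpos : 0 < 3 ^ c * 2 ^ κ := by positivity
    by_cases hg : g ≠ 1 ∧ g ≠ 2 ∧ g ≠ 3 ∧ g ≠ 4 ∧ g ≠ 6 ∧ g ≠ 12
    · rw [zvec_eq_zero_of_ne hg]
      by_contra hne
      obtain ⟨i, k, hik⟩ := hsm _ hne
      obtain ⟨hi, hk1, hk2⟩ := hwin i k (hik ▸ hne)
      obtain ⟨u, rfl⟩ := Nat.exists_eq_add_of_le hk1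
      have hu : u = 0 ∨ u = 1 ∨ u = 2 := by omega
      rcases hi with rfl | rfl <;> rcases hu with rfl | rfl | rfl
      · exact hg.1 (Nat.eq_of_mul_eq_mul_left hpos (hik.trans (by ring)))
      · exact hg.2.1 (Nat.eq_of_mul_eq_mul_left hpos (hik.trans (by ring)))
      · exact hg.2.2.2.1 (Nat.eq_of_mul_eq_mul_left hpos (hik.trans (by ring)))
      · exact hg.2.2.1 (Nat.eq_of_mul_eq_mul_left hpos (hik.trans (by ring)))
      · exact hg.2.2.2.2.1 (Nat.eq_of_mul_eq_mul_left hpos (hik.trans (by ring)))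
      · exact hg.2.2.2.2.2 (Nat.eq_of_mul_eq_mul_left hpos (hik.trans (by ring)))
    · have hg' : g = 1 ∨ g = 2 ∨ g = 3 ∨ g = 4 ∨ g = 6 ∨ g = 12 := by omega
      rcases hg' with rfl | rfl | rfl | rfl | rfl | rfl
      · rw [mul_one, hA]; rfl
      · rw [show 3 ^ c * 2 ^ κ * 2 = 3 ^ c * 2 ^ (κ + 1) by ring, hB]; rfl
      · rw [show 3 ^ c * 2 ^ κ * 3 = 3 ^ (c + 1) * 2 ^ κ by ring, hC]; rfl
      · rw [show 3 ^ c * 2 ^ κ * 4 = 3 ^ c * 2 ^ (κ + 2) by ring, hD]; rfl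
      · rw [show 3 ^ c * 2 ^ κ * 6 = 3 ^ (c + 1) * 2 ^ (κ + 1) by ring, hE]; rfl
      · rw [show 3 ^ c * 2 ^ κ * 12 = 3 ^ (c + 1) * 2 ^ (κ + 2) by ring, hF]; rfl
  · obtain ⟨i, k, rfl⟩ := hsm e he
    obtain ⟨hi, hk, -⟩ := hwin i k he
    exact Nat.mul_dvd_mul (pow_dvd_pow 3 (by omega)) (pow_dvd_pow 2 hk)

/-- A window of length three determined by the jumps of three tail sums. -/
lemma window_of_tailTriple {n : ℕ} {x y z : ℕ → ℤ} {r s t : ℤ → ℚ}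
    (hx : ∑ i ∈ range (n + 1), x i = 1)
    (hy : ∑ i ∈ range (n + 1), y i = 0) (hz : ∑ i ∈ range (n + 1), z i = 0)
    (hx0 : ∀ i, n < i → x i = 0) (hy0 : ∀ i, n < i → y i = 0) (hz0 : ∀ i, n < i → z i = 0)
    (h : TailTriple r s t (tailSum n x) (tailSum n y) (tailSum n z)) :
    ∃ κ : ℕ, ∃ a₁ e₁ f₁ a₂ e₂ f₂ : ℤ, (a₁, e₁, f₁, a₂, e₂, f₂) ∈ breakList ∧
      (∀ i, i < κ ∨ κ + 2 < i → x i = 0 ∧ y i = 0 ∧ z i = 0) ∧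
      (x κ = 1 - a₁ ∧ x (κ + 1) = a₁ - a₂ ∧ x (κ + 2) = a₂) ∧
      (y κ = -e₁ ∧ y (κ + 1) = e₁ - e₂ ∧ y (κ + 2) = e₂) ∧
      (z κ = -f₁ ∧ z (κ + 1) = f₁ - f₂ ∧ z (κ + 2) = f₂) := by
  obtain ⟨κ, hlo, hmem, hhi⟩ := h.classification (n := n + 1)
    (fun k hk => by simp only [tailSum_of_nonpos _ _ hk, hx, hy, hz, and_self])
    (tailSum_of_lt _ _ (by omega))
  refine ⟨κ, _, _, _, _, _, _, hmem, fun i hi => ?_, ⟨?_, ?_, ?_⟩, ⟨?_, ?_, ?_⟩, ⟨?_, ?_, ?_⟩⟩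
  · rw [eq_tailSum_sub hx0 i, eq_tailSum_sub hy0 i, eq_tailSum_sub hz0 i]
    rcases hi with hi | hi
    · obtain ⟨h1, h2, h3⟩ := hlo i (by omega)
      obtain ⟨h4, h5, h6⟩ := hlo (i + 1) (by omega)
      omega
    · obtain ⟨h1, h2, h3⟩ := hhi i (by omega)
      obtain ⟨h4, h5, h6⟩ := hhi (i + 1) (by omega)
      omega
  all_goals
    obtain ⟨h1, h2, h3⟩ := hlo κ le_rfl
    obtain ⟨h4, h5, h6⟩ := hhi (κ + 3) le_rfl
    first
      | rw [eq_tailSum_sub hx0]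
      | rw [eq_tailSum_sub hy0]
      | rw [eq_tailSum_sub hz0]
    push_cast
    first | omega | simp only [add_assoc, Int.reduceAdd, h4, h5, h6, sub_zero]

lemma three_smooth_row_bounds {a b : ℕ} {X : ℕ → ℤ} (hsupp : SuppIn (3 ^ b * 2 ^ a) X) (i k : ℕ)
    (h : X (3 ^ i * 2 ^ k) ≠ 0) : i ≤ b ∧ k ≤ a := by
  have hd : 3 ^ i * 2 ^ k ∣ 3 ^ b * 2 ^ a := by
    by_contra hd
    exact h (hsupp _ hd)
  have h32 : ∀ u v, Nat.Coprime (3 ^ u) (2 ^ v) := fun u v => Nat.Coprime.pow u v (by norm_num)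
  exact ⟨(Nat.pow_dvd_pow_iff_le_right (by norm_num)).1
      ((h32 i a).dvd_of_dvd_mul_right ((dvd_mul_right _ _).trans hd)),
    (Nat.pow_dvd_pow_iff_le_right (by norm_num)).1
      ((h32 b k).symm.dvd_of_dvd_mul_left ((dvd_mul_left _ _).trans hd))⟩

lemma exists_eq_three_pow_mul_two_pow {a b : ℕ} {X : ℕ → ℤ} (hsupp : SuppIn (3 ^ b * 2 ^ a) X)
    {e : ℕ} (he : X e ≠ 0) : ∃ i k, e = 3 ^ i * 2 ^ k := by
  have hd : e ∣ 3 ^ b * 2 ^ a := by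
    by_contra hd
    exact he (hsupp e hd)
  obtain ⟨u, v, hu, hv, rfl⟩ := (Nat.dvd_mul).1 hd
  obtain ⟨i, -, rfl⟩ := (Nat.dvd_prime_pow Nat.prime_three).1 hu
  obtain ⟨k, -, rfl⟩ := (Nat.dvd_prime_pow Nat.prime_two).1 hv
  exact ⟨i, k, rfl⟩

lemma isZagierRescaling_of_breakList {X z : ℕ → ℤ} {j κ : ℕ} {a₁ e₁ f₁ a₂ e₂ f₂ : ℤ}
    (hsm : ∀ e, X e ≠ 0 → ∃ i k, e = 3 ^ i * 2 ^ k)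
    (hfar : ∀ i k : ℕ, 2 ≤ ((j : ℤ) - i).natAbs → X (3 ^ i * 2 ^ k) = 0)
    (hz : ∀ k, z k = if 1 ≤ j then X (3 ^ (j - 1) * 2 ^ k) else 0)
    (hmem : (a₁, e₁, f₁, a₂, e₂, f₂) ∈ breakList)
    (hout : ∀ k, k < κ ∨ κ + 2 < k →
      X (3 ^ j * 2 ^ k) = 0 ∧ X (3 ^ (j + 1) * 2 ^ k) = 0 ∧ z k = 0)
    (hx : X (3 ^ j * 2 ^ κ) = 1 - a₁ ∧ X (3 ^ j * 2 ^ (κ + 1)) = a₁ - a₂ ∧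
      X (3 ^ j * 2 ^ (κ + 2)) = a₂)
    (hy : X (3 ^ (j + 1) * 2 ^ κ) = -e₁ ∧ X (3 ^ (j + 1) * 2 ^ (κ + 1)) = e₁ - e₂ ∧
      X (3 ^ (j + 1) * 2 ^ (κ + 2)) = e₂)
    (hzκ : z κ = -f₁ ∧ z (κ + 1) = f₁ - f₂ ∧ z (κ + 2) = f₂) : IsZagierRescaling X := by
  obtain ⟨hx0, hx1, hx2⟩ := hx
  obtain ⟨hy0, hy1, hy2⟩ := hy
  obtain ⟨hzκ0, hzκ1, hzκ2⟩ := hzκ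
  have hnear : ∀ i k, X (3 ^ i * 2 ^ k) ≠ 0 →
      (i = j ∨ i = j + 1 ∨ (i + 1 = j ∧ z k ≠ 0)) ∧ κ ≤ k ∧ k ≤ κ + 2 := fun i k hne => by
    have hij : i = j ∨ i = j + 1 ∨ i + 1 = j := by
      by_contra h
      exact hne (hfar i k (by omega))
    have hzk : i + 1 = j → z k ≠ 0 := fun h => by
      subst h
      simpa [hz] using hne
    refine ⟨by tauto, ?_⟩
    by_contra hk
    obtain ⟨h1, h2, h3⟩ := hout k (by omega)
    rcases hij with rfl | rfl | h
    exacts [hne h1, hne h2, hzk h h3]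
  by_cases hf : f₁ = 0 ∧ f₂ = 0
  · obtain ⟨rfl, rfl⟩ := hf
    have hzero : ∀ k, κ ≤ k → k ≤ κ + 2 → z k = 0 := fun k h1 h2 => by
      have : k = κ ∨ k = κ + 1 ∨ k = κ + 2 := by omega
      rcases this with rfl | rfl | rfl <;> assumption
    refine isZagierRescaling_of_window (c := j) (κ := κ) ?_ hsm (fun i k hne => ?_)
      hx0 hx1 hy0 hx2 hy1 hy2
    · simp only [breakList, List.mem_cons, List.not_mem_nil, or_false, Prod.mk.injEq] at hmem
      rcases hmem with h | h | h | h | h | h | h | h | h | h | h | h | h | h <;>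
        first | omega | (obtain ⟨rfl, rfl, -, rfl, rfl, -⟩ := h; norm_num [zagierList])
    · obtain ⟨hi, hk⟩ := hnear i k hne
      exact ⟨by have := hzero k hk.1 hk.2; tauto, hk⟩
  · have hj' : 1 ≤ j := by
      by_contra h
      simp only [hz, if_neg h] at hzκ0 hzκ2
      omega
    obtain ⟨c, rfl⟩ := Nat.exists_eq_add_of_le' hj'
    have he : e₁ = 0 ∧ e₂ = 0 := by
      simp only [breakList, List.mem_cons, List.not_mem_nil, or_false, Prod.mk.injEq] at hmem
      omega
    obtain ⟨rfl, rfl⟩ := he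
    have hzero : ∀ k, κ ≤ k → k ≤ κ + 2 → X (3 ^ (c + 1 + 1) * 2 ^ k) = 0 := fun k h1 h2 => by
      have : k = κ ∨ k = κ + 1 ∨ k = κ + 2 := by omega
      rcases this with rfl | rfl | rfl <;> assumption
    simp only [hz, if_pos hj', Nat.add_sub_cancel] at hzκ0 hzκ1 hzκ2
    refine isZagierRescaling_of_window (c := c) (κ := κ) ?_ hsm (fun i k hne => ?_)
      hzκ0 hzκ1 hx0 hzκ2 hx1 hx2
    · simp only [breakList, List.mem_cons, List.not_mem_nil, or_false, Prod.mk.injEq] at hmem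
      rcases hmem with h | h | h | h | h | h | h | h | h | h | h | h | h | h <;>
        first | omega | (obtain ⟨rfl, -, rfl, rfl, -, rfl⟩ := h; norm_num [zagierList])
    · obtain ⟨hi, hk⟩ := hnear i k hne
      have hi2 : i ≠ c + 1 + 1 := by
        rintro rfl
        exact hne (hzero k hk.1 hk.2)
      exact ⟨by omega, hk⟩

lemma isZagierRescaling_of_three_smooth {a b : ℕ} {X : ℕ → ℤ} (hsupp : SuppIn (3 ^ b * 2 ^ a) X)
    (hX : CuspNonneg (3 ^ b * 2 ^ a) fun d => (X d : ℚ))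
    (hwt : ∑ d ∈ (3 ^ b * 2 ^ a).divisors, X d = 1) : IsZagierRescaling X := by
  have h3 : ¬ 3 ∣ 2 ^ a := fun h => by
    have := Nat.prime_three.dvd_of_dvd_pow h
    omega
  have hbd := three_smooth_row_bounds hsupp
  have hsm := fun e => exists_eq_three_pow_mul_two_pow hsupp (e := e)
  obtain ⟨j, hj, hj1, hj0⟩ := exists_row_sum_eq_one Nat.prime_three le_rfl h3 hX hwt
  have hfar : ∀ i k : ℕ, 2 ≤ ((j : ℤ) - i).natAbs → X (3 ^ i * 2 ^ k) = 0 := fun i k hij => by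
    by_contra hne
    obtain ⟨hi, hk⟩ := hbd i k hne
    refine hne (slice_eq_zero_of_lineZero (e := 2) Nat.prime_three h3 hX hj hj1 hj0
      (fun i hi hij => lineZero_two_pow (by exact_mod_cast hj0 i hi hij)) (by norm_num)
      (by norm_num) (by simpa [Nat.lt_succ_iff] using hi) hij ?_)
    rw [Nat.mem_divisors]
    exact ⟨pow_dvd_pow 2 hk, by positivity⟩
  have hrow : ∀ i, i ≠ j → ∑ k ∈ range (a + 1), X (3 ^ i * 2 ^ k) = 0 := fun i hij => by
    by_cases hi : i ∈ range (b + 1)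
    · rw [← hj0 i hi hij, sum_divisors_two_pow]
    · refine Finset.sum_eq_zero fun k _ => by_contra fun hne => hi ?_
      simpa [Nat.lt_succ_iff] using (hbd i k hne).1
  rw [sum_divisors_two_pow] at hj1
  set z : ℕ → ℤ := fun k => if 1 ≤ j then X (3 ^ (j - 1) * 2 ^ k) else 0 with hz
  have hz0 : ∑ k ∈ range (a + 1), z k = 0 := by
    by_cases h : 1 ≤ j
    · simp only [hz, if_pos h, hrow (j - 1) (by omega)]
    · simp only [hz, if_neg h, Finset.sum_const_zero]
  have htw : ∀ (σ : ℤ) (k : ℕ), twist 3 b (fun d => (X d : ℚ)) (j + σ) (2 ^ k) =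
      geo 3 (-σ) * X (3 ^ j * 2 ^ k) + geo 3 (1 - σ) * X (3 ^ (j + 1) * 2 ^ k) +
        geo 3 (-1 - σ) * z k := fun σ k => by
    rw [twist, sum_range_eq_three_terms (j := j)]
    · rw [show (j : ℤ) - (j + σ) = -σ by ring,
        show ((j + 1 : ℕ) : ℤ) - (j + σ) = 1 - σ by push_cast; ring]
      by_cases h : 1 ≤ j
      · simp only [hz, if_pos h]
        rw [show ((j - 1 : ℕ) : ℤ) - (j + σ) = -1 - σ by omega]
      · simp [hz, if_neg h]
    · intro i hi
      rw [by_contra fun hne => absurd (hbd i k hne).1 (by omega)]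
      simp
    · intro i hi
      rw [hfar i k hi]
      simp
  have hpos : ∀ σ κ : ℤ, 0 ≤ ∑ k ∈ range (a + 1), geo 2 (k - κ) *
      (geo 3 (-σ) * X (3 ^ j * 2 ^ k) + geo 3 (1 - σ) * X (3 ^ (j + 1) * 2 ^ k) +
        geo 3 (-1 - σ) * z k) := fun σ κ => by
    have h1 := cuspNonneg_twist Nat.prime_three h3 hX (j + σ)
    rw [← mul_one (2 ^ a)] at h1
    have h2 := cuspNonneg_one (cuspNonneg_twist Nat.prime_two (by norm_num) h1 κ)
    rw [twist] at h2
    simpa only [mul_one, htw] using h2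
  have g1 : geo 3 1 = 1 / 3 := by norm_num [geo]
  have g1' : geo 3 (-1) = 1 / 3 := by norm_num [geo]
  have g2 : geo 3 2 = 1 / 9 := by norm_num [geo]
  have g2' : geo 3 (-2) = 1 / 9 := by norm_num [geo]
  obtain ⟨r, s, t, htri⟩ := exists_tailTriple (n := a) (x := fun k => X (3 ^ j * 2 ^ k))
    (y := fun k => X (3 ^ (j + 1) * 2 ^ k)) (z := z) hj1 (hrow (j + 1) (by omega)) hz0
    (fun κ => (hpos 0 κ).trans_eq (Finset.sum_congr rfl fun k _ => by
      rw [neg_zero, sub_zero, sub_zero, geo_zero, g1, g1']; ring))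
    (fun κ => (mul_nonneg (by norm_num : (0 : ℚ) ≤ 3) (hpos 1 κ)).trans_eq (by
      rw [Finset.mul_sum]
      exact Finset.sum_congr rfl fun k _ => by norm_num [g1', g2', geo_zero]; ring))
    (fun κ => (mul_nonneg (by norm_num : (0 : ℚ) ≤ 3) (hpos (-1) κ)).trans_eq (by
      rw [Finset.mul_sum]
      exact Finset.sum_congr rfl fun k _ => by norm_num [g1, g2, geo_zero]; ring))
  have hcol : ∀ i k, a < k → X (3 ^ i * 2 ^ k) = 0 := fun i k hk =>
    by_contra fun hne => absurd (hbd i k hne).2 (by omega)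
  obtain ⟨κ, a₁, e₁, f₁, a₂, e₂, f₂, hmem, hout, ⟨hx0, hx1, hx2⟩, ⟨hy0, hy1, hy2⟩,
    hzκ0, hzκ1, hzκ2⟩ := window_of_tailTriple hj1 (hrow (j + 1) (by omega)) hz0 (hcol j)
      (hcol (j + 1)) (fun k hk => by simp only [hz]; split_ifs <;> simp [hcol _ k hk]) htri
  exact isZagierRescaling_of_breakList hsm hfar (fun _ => rfl) hmem hout ⟨hx0, hx1, hx2⟩ ⟨hy0, hy1, hy2⟩
    ⟨hzκ0, hzκ1, hzκ2⟩

lemma isZagierRescaling_of_cuspNonneg {N : ℕ} (hN : N ≠ 0) {X : ℕ → ℤ} (hsupp : SuppIn N X)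
    (hX : CuspNonneg N fun d => (X d : ℚ)) (hwt : ∑ d ∈ N.divisors, X d = 1) :
    IsZagierRescaling X := by
  induction N using Nat.strong_induction_on generalizing X with
  | _ N ih =>
    by_cases hq : ∃ q, q.Prime ∧ 5 ≤ q ∧ q ∣ N
    · obtain ⟨q, hq, hq5, hqN⟩ := hq
      obtain ⟨j, hj⟩ := exists_factorization_eq_of_five_le hq hq5 hN hX hwt
      obtain ⟨n, m, hm, rfl⟩ := Nat.exists_eq_pow_mul_and_not_dvd hN q hq.ne_one
      have hm0 : m ≠ 0 := by rintro rfl; simp at hm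
      have hn : n ≠ 0 := by rintro rfl; simp [hm] at hqN
      have hlt : m < q ^ n * m :=
        lt_mul_of_one_lt_left (Nat.pos_of_ne_zero hm0) (Nat.one_lt_pow hn hq.one_lt)
      have hsl : ∀ i ∈ range (n + 1), i ≠ j → ∀ d ∈ m.divisors, X (q ^ i * d) = 0 :=
        fun i hi hij d hd => by_contra fun hne => hij (by
          rw [← hj _ (prime_pow_mul_mem_divisors hq hd hi) hne,
            factorization_prime_pow_mul_self hq (not_dvd_of_mem_divisors hm hd)])
      have hjn : j ∈ range (n + 1) := by
        by_contra hjn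
        rw [sum_divisors_prime_pow_mul hq hm, Finset.sum_eq_zero] at hwt
        · exact zero_ne_one hwt
        · exact fun i hi => Finset.sum_eq_zero (hsl i hi (by rintro rfl; exact hjn hi))
      obtain ⟨ν, hν, Y, hY, h1, h2⟩ := ih m hlt hm0
        (X := fun d => if d ∣ m then X (q ^ j * d) else 0)
        (fun d hd => if_neg hd)
        (cuspNonneg_congr (fun d hd => by
          rw [twist, Finset.sum_eq_single_of_mem j hjn]
          · rw [sub_self, geo_zero, one_mul, if_pos (Nat.dvd_of_mem_divisors hd)]
          · intro i hi hij
            rw [hsl i hi hij d hd]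
            simp) (cuspNonneg_twist hq hm hX j))
        (by
          rw [← hwt, sum_divisors_prime_pow_mul hq hm, Finset.sum_eq_single_of_mem j hjn]
          · exact Finset.sum_congr rfl fun d hd => if_pos (Nat.dvd_of_mem_divisors hd)
          · exact fun i hi hij => Finset.sum_eq_zero (hsl i hi hij))
      simp only at h1 h2
      have key : ∀ e, X e ≠ 0 → ∃ d, d ∣ m ∧ e = q ^ j * d := fun e he => by
        have hd : e ∈ (q ^ n * m).divisors :=
          Nat.mem_divisors.2 ⟨by_contra fun hd => he (hsupp e hd), hN⟩
        obtain ⟨i, hi, d, hdm, rfl⟩ := exists_prime_pow_mul_of_mem_divisors hq hd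
        obtain rfl : i = j := by_contra fun hij => he (hsl i hi hij d hdm)
        exact ⟨d, Nat.dvd_of_mem_divisors hdm, rfl⟩
      refine ⟨q ^ j * ν, Nat.mul_pos (pow_pos hq.pos j) hν, Y, hY, fun g => ?_, fun e he => ?_⟩
      · rw [← h1 g, mul_assoc]
        split_ifs with hd
        · rfl
        · by_contra hne
          obtain ⟨d, hdm, hd'⟩ := key _ hne
          exact hd (Nat.eq_of_mul_eq_mul_left (pow_pos hq.pos j) hd' ▸ hdm)
      · obtain ⟨d, hdm, rfl⟩ := key e he
        exact Nat.mul_dvd_mul_left _ (h2 d (by rwa [if_pos hdm]))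
    · obtain ⟨b, m, hm, rfl⟩ := Nat.exists_eq_pow_mul_and_not_dvd hN 3 (by norm_num)
      have hm0 : m ≠ 0 := by rintro rfl; simp at hm
      obtain ⟨a, l, hl, rfl⟩ := Nat.exists_eq_pow_mul_and_not_dvd hm0 2 (by norm_num)
      obtain rfl : l = 1 := by
        by_contra hl1
        obtain ⟨p, hp, hpl⟩ := Nat.exists_prime_and_dvd hl1
        have hp2 : p ≠ 2 := by rintro rfl; exact hl hpl
        have hp3 : p ≠ 3 := by rintro rfl; exact hm (hpl.mul_left _)
        have hp4 : p ≠ 4 := by rintro rfl; norm_num at hp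
        have := hp.two_le
        exact hq ⟨p, hp, by omega, (hpl.mul_left _).mul_left _⟩
      rw [mul_one] at hsupp hX hwt
      exact isZagierRescaling_of_three_smooth hsupp hX hwt

/-- Zagier's conjecture / Mersmann's theorem: every holomorphic eta quotient of
weight `1/2` is the rescaling by some positive integer `ν` of one of the fourteen
eta quotients of Zagier's list. -/
theorem weight_half_eta_quotient_classification (N : ℕ) (hN : 0 < N) (X : ℕ → ℤ)
    (hsupp : SuppIn N X)
    (hwt : ∑ d ∈ N.divisors, X d = 1)
    (hhol : IsHolEta N X) :
    ∃ ν : ℕ, 0 < ν ∧ ∃ Y ∈ zagierList,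
      (∀ e : ℕ, ν ∣ e → X e = Y (e / ν)) ∧ (∀ e : ℕ, ¬ ν ∣ e → X e = 0) := by
  obtain ⟨ν, hν, Y, hY, h1, h2⟩ :=
    isZagierRescaling_of_cuspNonneg hN.ne' hsupp (cuspNonneg_of_isHolEta hhol) hwt
  refine ⟨ν, hν, Y, hY, ?_, fun e he => by_contra fun hne => he (h2 e hne)⟩
  rintro e ⟨g, rfl⟩
  rw [Nat.mul_div_cancel_left g hν, h1]
end

section
/- Every holomorphic eta quotient of weight 1/2 and level 2ⁿ (n ≥ 0) is a rescaling of some holomorphic eta quotient on Γ₀(4). Equivalently: if X : D_{2ⁿ} → ℤ has Σ_{d|2ⁿ} X_d = 1, has lcm{d : X_d ≠ 0} = 2ⁿ, and satisfies Σ_{d|2ⁿ} (2ⁿ·gcd(d,t)²)/(d·gcd(t²,2ⁿ))·X_d ≥ 0 for every t ∈ D_{2ⁿ}, then there exist a power ν = 2^k and a holomorphic eta quotient η^Y with Y : D_4 → ℤ such that X is the rescaling of Y by ν, i.e., X_e = Y_{e/ν} whenever ν | e and X_e = 0 whenever ν ∤ e. -/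
open Finset

/-- The level of the eta quotient `η^X` on `Γ₀(N)`: `lcm {d ∣ N : X_d ≠ 0}`. -/
def etaLevel (N : ℕ) (X : ℕ → ℤ) : ℕ :=
  (N.divisors.filter fun d => X d ≠ 0).lcm id

/-- The symmetric kernel `2^(-|i - j|)`. -/
def halfKernel (i j : ℕ) : ℚ := (1 / 2) ^ ((i - j) + (j - i))

lemma halfKernel_zero_rel (j : ℕ) :
    4 * halfKernel 0 j - 2 * halfKernel 1 j = if j = 0 then 3 else 0 := by
  unfold halfKernel
  rcases j with _ | j
  · norm_num
  · have h : (1 - (j + 1)) + (j + 1 - 1) = j := by omega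
    simp only [h, Nat.zero_sub, Nat.sub_zero, zero_add, pow_succ]
    simp; ring

lemma halfKernel_succ_rel (i j : ℕ) :
    5 * halfKernel (i + 1) j - 2 * halfKernel i j - 2 * halfKernel (i + 2) j
      = if j = i + 1 then 3 else 0 := by
  unfold halfKernel
  rcases lt_trichotomy j (i + 1) with h | rfl | h
  · obtain ⟨k, rfl⟩ : ∃ k, i = j + k := ⟨i - j, by omega⟩
    rw [show (j + k + 1 - j) + (j - (j + k + 1)) = k + 1 by omega,
      show (j + k - j) + (j - (j + k)) = k by omega,
      show (j + k + 2 - j) + (j - (j + k + 2)) = k + 2 by omega, if_neg (by omega)]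
    ring
  · rw [show (i + 1 - (i + 1)) + (i + 1 - (i + 1)) = 0 by omega,
      show (i - (i + 1)) + (i + 1 - i) = 1 by omega,
      show (i + 2 - (i + 1)) + (i + 1 - (i + 2)) = 1 by omega, if_pos rfl]
    norm_num
  · obtain ⟨k, rfl⟩ : ∃ k, j = i + 2 + k := ⟨j - (i + 2), by omega⟩
    rw [show (i + 1 - (i + 2 + k)) + (i + 2 + k - (i + 1)) = k + 1 by omega,
      show (i - (i + 2 + k)) + (i + 2 + k - i) = k + 2 by omega,
      show (i + 2 - (i + 2 + k)) + (i + 2 + k - (i + 2)) = k by omega, if_neg (by omega)]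
    ring

/-- The convolution of `z` restricted to `{0, …, L}` with `2^(-|i - j|)`. -/
def halfConv (L : ℕ) (z : ℕ → ℤ) (i : ℕ) : ℚ :=
  ∑ j ∈ range (L + 1), halfKernel i j * (z j : ℚ)

lemma halfConv_zero_rel (L : ℕ) (z : ℕ → ℤ) :
    4 * halfConv L z 0 - 2 * halfConv L z 1 = 3 * (z 0 : ℚ) := by
  have h : ∀ j, 4 * (halfKernel 0 j * (z j : ℚ)) - 2 * (halfKernel 1 j * (z j : ℚ))
      = if j = 0 then 3 * (z 0 : ℚ) else 0 := fun j => by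
    have := halfKernel_zero_rel j
    split_ifs at this ⊢ with hj
    · subst hj; linear_combination (z 0 : ℚ) * this
    · linear_combination (z j : ℚ) * this
  simp only [halfConv, mul_sum, ← sum_sub_distrib, h]
  simp

lemma halfConv_succ_rel {L i : ℕ} (z : ℕ → ℤ) (hi : i + 1 ≤ L) :
    5 * halfConv L z (i + 1) - 2 * halfConv L z i - 2 * halfConv L z (i + 2)
      = 3 * (z (i + 1) : ℚ) := by
  have h : ∀ j, 5 * (halfKernel (i + 1) j * (z j : ℚ)) - 2 * (halfKernel i j * (z j : ℚ))
      - 2 * (halfKernel (i + 2) j * (z j : ℚ))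
      = if j = i + 1 then 3 * (z (i + 1) : ℚ) else 0 := fun j => by
    have := halfKernel_succ_rel i j
    split_ifs at this ⊢ with hj
    · subst hj; linear_combination (z (i + 1) : ℚ) * this
    · linear_combination (z j : ℚ) * this
  simp only [halfConv, mul_sum, ← sum_sub_distrib, h]
  simp; omega

lemma halfConv_add (L k : ℕ) (z : ℕ → ℤ) :
    halfConv L z (L + k) = (1 / 2) ^ k * halfConv L z L := by
  simp only [halfConv, mul_sum]
  refine sum_congr rfl fun j hj => ?_
  have hj : j ≤ L := by simpa [Nat.lt_succ_iff] using hj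
  simp only [halfKernel, ← mul_assoc, ← pow_add]
  congr 2
  omega

lemma halfConv_partial_sum {L K : ℕ} (z : ℕ → ℤ) (hK : K ≤ L) :
    3 * ∑ i ∈ range (K + 1), (z i : ℚ) = halfConv L z 0 +
      ∑ i ∈ range (K + 1), halfConv L z i + 2 * halfConv L z K - 2 * halfConv L z (K + 1) := by
  induction K with
  | zero => simp only [zero_add, sum_range_one]; linear_combination -halfConv_zero_rel L z
  | succ K ih =>
    rw [sum_range_succ, sum_range_succ _ (K + 1)]
    linear_combination ih (by omega) - halfConv_succ_rel z hK

lemma halfConv_total (L : ℕ) (z : ℕ → ℤ) :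
    3 * ∑ i ∈ range (L + 1), (z i : ℚ) =
      halfConv L z 0 + ∑ i ∈ range (L + 1), halfConv L z i + halfConv L z L := by
  rw [halfConv_partial_sum z le_rfl, halfConv_add L 1]
  ring

/-- An integer sequence of sum one with nonzero end terms and nonnegative convolution with
`2^(-|i - j|)` has length at most three. -/
lemma length_le_of_halfConv_nonneg {L : ℕ} {z : ℕ → ℤ} (h0 : z 0 ≠ 0) (hL : z L ≠ 0)
    (hsum : ∑ i ∈ range (L + 1), z i = 1) (hy : ∀ i ≤ L, 0 ≤ halfConv L z i) : L ≤ 2 := by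
  by_contra! hlt
  obtain ⟨l, rfl⟩ : ∃ l, L = l + 3 := ⟨L - 3, by omega⟩
  have htot := halfConv_total (l + 3) z
  have hr0 := halfConv_zero_rel (l + 3) z
  have hr1 := halfConv_succ_rel z (show 0 + 1 ≤ l + 3 by omega)
  have hrL := halfConv_succ_rel z (show (l + 2) + 1 ≤ l + 3 by omega)
  have hout : halfConv (l + 3) z (l + 2 + 2) = 1 / 2 * halfConv (l + 3) z (l + 3) := by
    simpa using halfConv_add (l + 3) 1 z
  have hsum' : ∑ i ∈ range (l + 3 + 1), (z i : ℚ) = 1 := by exact_mod_cast hsum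
  rw [hsum'] at htot
  have hc : 0 ≤ halfConv (l + 3) z 2 := hy 2 (by omega)
  have hmid : l = 0 ∨ 2 * halfConv (l + 3) z 0 + halfConv (l + 3) z 1 + halfConv (l + 3) z 2 +
      halfConv (l + 3) z (l + 2) + 2 * halfConv (l + 3) z (l + 3) ≤ 3 := by
    rcases l with _ | l
    · exact Or.inl rfl
    · right
      rw [sum_range_succ, sum_range_succ, show l + 1 + 2 = l + 3 by rfl, sum_range_succ',
        sum_range_succ', sum_range_succ'] at htot
      have := sum_nonneg fun i (hi : i ∈ range l) =>
        hy (i + 1 + 1 + 1) (by have := mem_range.mp hi; omega)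
      simp only [zero_add, Nat.reduceAdd] at htot this ⊢
      linarith
  have hall : 2 * halfConv (l + 3) z 0 + halfConv (l + 3) z 1 +
      halfConv (l + 3) z (l + 2) + 2 * halfConv (l + 3) z (l + 3) ≤ 3 := by
    rcases hmid with rfl | h
    · simp only [sum_range_succ, sum_range_zero, zero_add] at htot ⊢
      linarith
    · linarith
  have ha := hy 0 (by omega)
  have hb := hy 1 (by omega)
  have hd := hy (l + 2) (by omega)
  have he := hy (l + 3) le_rfl
  simp only [zero_add] at hr1
  rw [hout] at hrL
  have hz0 : (z 0 : ℚ) ≤ -1 ∨ 1 ≤ (z 0 : ℚ) := by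
    rcases lt_or_gt_of_ne h0 with h | h
    · left; exact_mod_cast (by omega : z 0 ≤ -1)
    · right; exact_mod_cast (by omega : 1 ≤ z 0)
  have hzL : (z (l + 3) : ℚ) ≤ -1 ∨ 1 ≤ (z (l + 3) : ℚ) := by
    rcases lt_or_gt_of_ne hL with h | h
    · left; exact_mod_cast (by omega : z (l + 3) ≤ -1)
    · right; exact_mod_cast (by omega : 1 ≤ z (l + 3))
  have hend : (halfConv (l + 3) z 0 = 3 / 4 ∧ halfConv (l + 3) z 1 = 0) ∨
      (halfConv (l + 3) z 0 = 0 ∧ halfConv (l + 3) z 1 = 3 / 2) := by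
    rcases hz0 with h | h <;> rcases hzL with h' | h'
    all_goals first
      | (left; constructor <;> linarith)
      | (right; constructor <;> linarith)
  have hendL : halfConv (l + 3) z (l + 2) = 0 ∨ halfConv (l + 3) z (l + 2) = 3 / 2 := by
    rcases hz0 with h | h <;> rcases hzL with h' | h'
    all_goals first
      | (left; linarith)
      | (right; linarith)
  have hlower : 3 / 2 ≤ halfConv (l + 3) z (l + 2) + 2 * halfConv (l + 3) z (l + 3) := by
    rcases hzL with h | h <;> linarith
  have hc' : halfConv (l + 3) z 2 = 0 ∨ halfConv (l + 3) z 2 = 3 / 2 := by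
    rcases hmid with rfl | h
    · exact hendL
    · left; rcases hend with ⟨h, h'⟩ | ⟨h, h'⟩ <;> linarith
  have hkey : ∃ k : ℤ, 2 * (z 0 + z 1 : ℚ) = 2 * k + 1 := by
    rcases hend with ⟨h, h'⟩ | ⟨h, h'⟩ <;> rcases hc' with h'' | h''
    · exact ⟨0, by push_cast; linarith⟩
    · exact ⟨-1, by push_cast; linarith⟩
    · exact ⟨1, by push_cast; linarith⟩
    · exact ⟨0, by push_cast; linarith⟩
  obtain ⟨k, hk⟩ := hkey
  have hk' : 2 * (z 0 + z 1) = 2 * k + 1 := by exact_mod_cast hk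
  omega

lemma etaOrd_two_pow (n i : ℕ) (X : ℕ → ℤ) :
    etaOrd (2 ^ n) X (2 ^ i) = (2 ^ n * 2 ^ i / (Nat.gcd ((2 ^ i) ^ 2) (2 ^ n) : ℚ)) *
      halfConv n (fun j => X (2 ^ j)) i := by
  unfold etaOrd halfConv
  rw [Nat.sum_divisors_prime_pow Nat.prime_two, mul_sum]
  refine sum_congr rfl fun j _ => ?_
  have hG : (Nat.gcd ((2 ^ i) ^ 2) (2 ^ n) : ℚ) ≠ 0 := by
    exact_mod_cast (Nat.gcd_pos_of_pos_right _ (by positivity)).ne'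
  have hgcd : Nat.gcd (2 ^ j) (2 ^ i) = 2 ^ min j i := by
    rcases le_total j i with h | h
    · rw [min_eq_left h, Nat.gcd_eq_left (pow_dvd_pow 2 h)]
    · rw [min_eq_right h, Nat.gcd_eq_right (pow_dvd_pow 2 h)]
  have hexp : (2 : ℚ) ^ i * 2 ^ j = 2 ^ ((i - j) + (j - i)) * (2 ^ min j i) ^ 2 := by
    rw [← pow_mul, ← pow_add, ← pow_add]; congr 1; omega
  have hker : (2 : ℚ) ^ i * halfKernel i j = (2 ^ min j i) ^ 2 / 2 ^ j := by
    rw [halfKernel, div_pow, one_pow]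
    field_simp
    linear_combination hexp
  rw [hgcd]
  push_cast at hG ⊢
  rw [show (2 : ℚ) ^ n * (2 ^ min j i) ^ 2 / (2 ^ j * (Nat.gcd ((2 ^ i) ^ 2) (2 ^ n) : ℚ)) =
    2 ^ n * ((2 ^ min j i) ^ 2 / 2 ^ j) / (Nat.gcd ((2 ^ i) ^ 2) (2 ^ n) : ℚ) by field_simp, ← hker]
  ring

lemma etaOrd_two_pow_nonneg_iff (n i : ℕ) (X : ℕ → ℤ) :
    0 ≤ etaOrd (2 ^ n) X (2 ^ i) ↔ 0 ≤ halfConv n (fun j => X (2 ^ j)) i := by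
  have hG : (0 : ℚ) < (Nat.gcd ((2 ^ i) ^ 2) (2 ^ n) : ℚ) := by
    exact_mod_cast Nat.gcd_pos_of_pos_right _ (by positivity)
  rw [etaOrd_two_pow]
  exact mul_nonneg_iff_of_pos_left (by positivity)

lemma isHolEta_two_pow_iff (n : ℕ) (X : ℕ → ℤ) :
    IsHolEta (2 ^ n) X ↔ ∀ i ≤ n, 0 ≤ halfConv n (fun j => X (2 ^ j)) i := by
  simp only [IsHolEta, Nat.mem_divisors_prime_pow Nat.prime_two]
  constructor
  · exact fun h i hi => (etaOrd_two_pow_nonneg_iff n i X).mp (h _ ⟨i, hi, rfl⟩)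
  · rintro h _ ⟨i, hi, rfl⟩
    exact (etaOrd_two_pow_nonneg_iff n i X).mpr (h i hi)

lemma halfConv_shift {m L : ℕ} {x : ℕ → ℤ} (hx : ∀ j < m, x j = 0) (i : ℕ) :
    halfConv (m + L) x (m + i) = halfConv L (fun j => x (m + j)) i := by
  unfold halfConv
  rw [add_assoc, sum_range_add, sum_eq_zero fun j hj => by simp [hx j (mem_range.mp hj)], zero_add]
  refine sum_congr rfl fun j _ => ?_
  simp only [halfKernel]
  congr 2
  omega

lemma halfConv_extend {L M : ℕ} (hLM : L ≤ M) {z : ℕ → ℤ} (hz : ∀ j, L < j → z j = 0) (i : ℕ) :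
    halfConv M z i = halfConv L z i := by
  refine (sum_subset (range_mono (by omega)) fun j _ hj => ?_).symm
  rw [hz j (by simpa using hj)]
  simp

lemma etaLevel_two_pow_top_ne_zero {n : ℕ} {X : ℕ → ℤ}
    (hwt : ∑ d ∈ (2 ^ n).divisors, X d = 1) (hlev : etaLevel (2 ^ n) X = 2 ^ n) :
    X (2 ^ n) ≠ 0 := by
  intro h
  rcases n with _ | n
  · simp_all
  · have hdvd : etaLevel (2 ^ (n + 1)) X ∣ 2 ^ n := by
      refine Finset.lcm_dvd fun d hd => ?_
      rw [mem_filter, Nat.mem_divisors_prime_pow Nat.prime_two] at hd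
      obtain ⟨⟨j, hj, rfl⟩, hne⟩ := hd
      have : j ≠ n + 1 := by rintro rfl; exact hne h
      exact pow_dvd_pow 2 (by omega)
    rw [hlev, Nat.pow_dvd_pow_iff_le_right one_lt_two] at hdvd
    omega

/-- Every holomorphic eta quotient of weight `1/2` and level `2ⁿ` is a rescaling
(by a power `2^k`) of some holomorphic eta quotient on `Γ₀(4)`. -/
theorem weight_half_two_power_level_rescaling_of_level_four (n : ℕ) (X : ℕ → ℤ)
    (hsupp : SuppIn (2 ^ n) X)
    (hwt : ∑ d ∈ (2 ^ n).divisors, X d = 1)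
    (hlev : etaLevel (2 ^ n) X = 2 ^ n)
    (hhol : IsHolEta (2 ^ n) X) :
    ∃ k : ℕ, ∃ Y : ℕ → ℤ, SuppIn 4 Y ∧ IsHolEta 4 Y ∧
      (∀ e : ℕ, 2 ^ k ∣ e → X e = Y (e / 2 ^ k)) ∧ (∀ e : ℕ, ¬ 2 ^ k ∣ e → X e = 0) := by
  have htop := etaLevel_two_pow_top_ne_zero hwt hlev
  have hex : ∃ m, X (2 ^ m) ≠ 0 := ⟨n, htop⟩
  classical
  obtain ⟨m, hm, hmin⟩ : ∃ m, X (2 ^ m) ≠ 0 ∧ ∀ j < m, X (2 ^ j) = 0 :=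
    ⟨Nat.find hex, Nat.find_spec hex, fun j hj => not_not.mp (Nat.find_min hex hj)⟩
  obtain ⟨L, rfl⟩ : ∃ L, n = m + L := by
    refine Nat.exists_eq_add_of_le (not_lt.mp fun h => htop (hmin n h))
  have hshift := halfConv_shift (L := L) hmin
  rw [isHolEta_two_pow_iff] at hhol
  have hnonneg : ∀ i ≤ L, 0 ≤ halfConv L (fun j => X (2 ^ (m + j))) i := fun i hi => by
    rw [← hshift]
    exact hhol (m + i) (by omega)
  have hsum : ∑ i ∈ range (L + 1), X (2 ^ (m + i)) = 1 := by
    rw [Nat.sum_divisors_prime_pow Nat.prime_two, add_assoc, sum_range_add,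
      sum_eq_zero fun j hj => hmin j (mem_range.mp hj), zero_add] at hwt
    exact hwt
  have hL : L ≤ 2 := length_le_of_halfConv_nonneg (by simpa using hm) htop hsum hnonneg
  have hzero : ∀ j, L < j → X (2 ^ (m + j)) = 0 := fun j hj =>
    hsupp _ fun h => by
      rw [Nat.pow_dvd_pow_iff_le_right one_lt_two] at h
      omega
  have hsuppX : ∀ e, X e ≠ 0 → ∃ j ≤ L, e = 2 ^ (m + j) := fun e he => by
    obtain ⟨l, hl, rfl⟩ := (Nat.dvd_prime_pow Nat.prime_two).mp
      (not_not.mp fun h => he (hsupp e h))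
    have hml : m ≤ l := not_lt.mp fun h => he (hmin l h)
    exact ⟨l - m, by omega, by congr 1; omega⟩
  refine ⟨m, fun d => X (2 ^ m * d), fun d hd => ?_, ?_, ?_, fun e he => ?_⟩
  · by_contra hne
    obtain ⟨j, hj, he⟩ := hsuppX _ hne
    rw [pow_add, Nat.mul_right_inj (by positivity)] at he
    exact hd (he ▸ pow_dvd_pow 2 (hj.trans hL))
  · rw [show 4 = 2 ^ 2 by rfl, isHolEta_two_pow_iff]
    intro i _
    simp only [← pow_add]
    rw [halfConv_extend hL hzero]
    rcases le_total i L with hi | hi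
    · exact hnonneg i hi
    · obtain ⟨k, rfl⟩ := Nat.exists_eq_add_of_le hi
      rw [halfConv_add]
      exact mul_nonneg (by positivity) (hnonneg L le_rfl)
  · intro e he
    simp only [Nat.mul_div_cancel' he]
  · by_contra hne
    obtain ⟨j, _, rfl⟩ := hsuppX e hne
    exact he (pow_dvd_pow 2 (by omega))
end

section
/- If there exists a primitive holomorphic eta quotient of weight 1/2 and level N = 2^m·3^n, then m ≤ 3 and n ≤ 2. Equivalently: if X : D_{2^m 3^n} → ℤ satisfies Σ_d X_d = 1, lcm{d : X_d ≠ 0} = 2^m·3^n, gcd{d : X_d ≠ 0} = 1, and Σ_{d|N} (N·gcd(d,t)²)/(d·gcd(t²,N))·X_d ≥ 0 for every t ∈ D_N, then m ≤ 3 and n ≤ 2. -/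
open Finset

/-- The eta quotient `η^X` is primitive: `gcd {d ∣ N : X_d ≠ 0} = 1`. -/
def IsPrimitiveEta (N : ℕ) (X : ℕ → ℤ) : Prop :=
  (N.divisors.filter fun d => X d ≠ 0).gcd id = 1

/-- The kernel transform `i ↦ ∑_{a ≤ m} q^{|i - a|} y_a`. -/
def expKernel (q : ℚ) (m : ℕ) (y : ℕ → ℚ) (i : ℕ) : ℚ :=
  ∑ a ∈ range (m + 1), q ^ ((i - a) + (a - i)) * y a

lemma expKernel_interior (q : ℚ) {m i : ℕ} (y : ℕ → ℚ) (hi : i + 2 ≤ m) :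
    (1 + q ^ 2) * expKernel q m y (i + 1) - q * expKernel q m y i - q * expKernel q m y (i + 2)
      = (1 - q ^ 2) * y (i + 1) := by
  have h : (1 - q ^ 2) * y (i + 1)
      = ∑ a ∈ range (m + 1), if i + 1 = a then (1 - q ^ 2) * y a else 0 := by
    rw [Finset.sum_ite_eq, if_pos (by simp; omega)]
  rw [h]
  simp only [expKernel, mul_sum, ← sum_sub_distrib]
  refine sum_congr rfl fun a _ => ?_
  rcases lt_trichotomy a (i + 1) with ha | ha | ha
  · obtain ⟨k, rfl⟩ := Nat.exists_eq_add_of_le (Nat.lt_succ_iff.mp ha)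
    rw [if_neg (by omega), show a + k + 1 - a + (a - (a + k + 1)) = k + 1 by omega,
      show a + k - a + (a - (a + k)) = k by omega,
      show a + k + 2 - a + (a - (a + k + 2)) = k + 2 by omega]
    ring
  · subst ha
    rw [if_pos rfl, show i + 1 - (i + 1) + (i + 1 - (i + 1)) = 0 by omega,
      show i - (i + 1) + (i + 1 - i) = 1 by omega,
      show i + 2 - (i + 1) + (i + 1 - (i + 2)) = 1 by omega]
    ring
  · obtain ⟨k, rfl⟩ := Nat.exists_eq_add_of_lt ha
    rw [if_neg (by omega), show i + 1 - (i + 1 + k + 1) + (i + 1 + k + 1 - (i + 1)) = k + 1 by omega,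
      show i - (i + 1 + k + 1) + (i + 1 + k + 1 - i) = k + 2 by omega,
      show i + 2 - (i + 1 + k + 1) + (i + 1 + k + 1 - (i + 2)) = k by omega]
    ring

lemma expKernel_left (q : ℚ) (m : ℕ) (y : ℕ → ℚ) :
    expKernel q (m + 1) y 0 - q * expKernel q (m + 1) y 1 = (1 - q ^ 2) * y 0 := by
  simp only [expKernel, mul_sum, ← sum_sub_distrib]
  rw [sum_range_succ', sum_eq_zero]
  · simp; ring
  · intro a _
    rw [show 0 - (a + 1) + (a + 1 - 0) = a + 1 by omega,
      show 1 - (a + 1) + (a + 1 - 1) = a by omega]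
    ring

lemma expKernel_right (q : ℚ) (m : ℕ) (y : ℕ → ℚ) :
    expKernel q (m + 1) y (m + 1) - q * expKernel q (m + 1) y m = (1 - q ^ 2) * y (m + 1) := by
  simp only [expKernel, mul_sum, ← sum_sub_distrib]
  rw [sum_range_succ, sum_eq_zero]
  · rw [show m + 1 - (m + 1) + (m + 1 - (m + 1)) = 0 by omega,
      show m - (m + 1) + (m + 1 - m) = 1 by omega]
    ring
  · intro a ha
    obtain ⟨k, rfl⟩ := Nat.exists_eq_add_of_le (Nat.lt_succ_iff.mp (mem_range.mp ha))
    rw [show a + k + 1 - a + (a - (a + k + 1)) = k + 1 by omega,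
      show a + k - a + (a - (a + k)) = k by omega]
    ring

lemma sum_pow_dist (q : ℚ) (a k : ℕ) :
    (1 - q) * ∑ i ∈ range (a + k + 1), q ^ ((i - a) + (a - i)) + q ^ (a + 1) + q ^ (k + 1)
      = 1 + q := by
  induction k with
  | zero =>
    have : ∑ i ∈ range (a + 0 + 1), q ^ ((i - a) + (a - i)) = ∑ i ∈ range (a + 1), q ^ i := by
      rw [← sum_range_reflect]
      refine sum_congr rfl fun i hi => ?_
      have := mem_range.mp hi
      congr 1
      omega
    rw [this]
    have := geom_sum_mul q (a + 1)
    linear_combination -this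
  | succ k ih =>
    rw [← add_assoc, sum_range_succ, show a + k + 1 - a + (a - (a + k + 1)) = k + 1 by omega]
    linear_combination ih

/-- The total `∑ y` as a positive combination of the values of the transform. -/
lemma one_add_mul_sum_eq (q : ℚ) (m : ℕ) (y : ℕ → ℚ) :
    (1 + q) * ∑ a ∈ range (m + 1), y a
      = (1 - q) * ∑ i ∈ range (m + 1), expKernel q m y i
        + q * (expKernel q m y 0 + expKernel q m y m) := by
  simp only [expKernel]
  rw [sum_comm]
  simp only [mul_sum, ← sum_add_distrib]
  refine sum_congr rfl fun a ha => ?_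
  obtain ⟨k, rfl⟩ := Nat.exists_eq_add_of_le (Nat.lt_succ_iff.mp (mem_range.mp ha))
  rw [← sum_pow_dist q a k, ← mul_sum, ← sum_mul, show 0 - a + (a - 0) = a by omega,
    show a + k - a + (a - (a + k)) = k by omega]
  ring

/-- Bounds on the entries of `y` in terms of its total, if the transform of `y` is nonnegative. -/
lemma entry_bounds {q : ℚ} (hq : 0 < q) (hq1 : q < 1) {m : ℕ} {y : ℕ → ℚ}
    (hy : ∀ i ≤ m, 0 ≤ expKernel q m y i) {a : ℕ} (ha : a ≤ m) :
    -q * ∑ i ∈ range (m + 1), y i ≤ (1 - q) ^ 2 * y a ∧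
      (1 - q) ^ 2 * y a ≤ (1 + q ^ 2) * ∑ i ∈ range (m + 1), y i := by
  set G := expKernel q m y with hG
  set S := ∑ i ∈ range (m + 1), y i with hS
  have hT := one_add_mul_sum_eq q m y
  rw [← hG, ← hS] at hT
  have h0 := hy 0 (Nat.zero_le _)
  have hm := hy m le_rfl
  have hsum : (1 - q) * ∑ i ∈ range (m + 1), G i ≤ (1 + q) * S := by
    have : 0 ≤ q * (G 0 + G m) := by positivity
    linarith
  have hle : ∀ s ⊆ range (m + 1), ∑ i ∈ s, G i ≤ ∑ i ∈ range (m + 1), G i := fun s hs =>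
    sum_le_sum_of_subset_of_nonneg hs fun i hi _ => hy i (by simpa [Nat.lt_succ_iff] using hi)
  have hGa : G a ≤ ∑ i ∈ range (m + 1), G i := by
    simpa using hle {a} (by simp; omega)
  have key : -q * ∑ i ∈ range (m + 1), G i ≤ (1 - q ^ 2) * y a ∧
      (1 - q ^ 2) * y a ≤ (1 + q ^ 2) * G a := by
    have hya := hy a ha
    rcases Nat.eq_zero_or_pos m with rfl | hmpos
    · obtain rfl : a = 0 := by omega
      have : G 0 = y 0 := by simp [hG, expKernel]
      simp only [zero_add, sum_range_one]
      rw [← this]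
      constructor <;> nlinarith [mul_nonneg hq.le hya, mul_nonneg (sq_nonneg q) hya]
    · obtain ⟨k, rfl⟩ : ∃ k, m = k + 1 := ⟨m - 1, by omega⟩
      rcases Nat.eq_zero_or_pos a with rfl | hapos
      · have h := expKernel_left q k y
        rw [← hG] at h
        have h1 := hy 1 (by omega)
        have h2 : G 1 ≤ ∑ i ∈ range (k + 1 + 1), G i := by simpa using hle {1} (by simp)
        rw [← h]
        constructor <;> nlinarith [mul_nonneg hq.le h1, mul_nonneg (sq_nonneg q) hya]
      · obtain ⟨b, rfl⟩ : ∃ b, a = b + 1 := ⟨a - 1, by omega⟩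
        rcases Nat.lt_or_ge (b + 1) (k + 1) with hlt | hge
        · have h := expKernel_interior q (m := k + 1) (i := b) y (by omega)
          rw [← hG] at h
          have h1 := hy b (by omega)
          have h2 := hy (b + 2) (by omega)
          have h3 : G b + G (b + 2) ≤ ∑ i ∈ range (k + 1 + 1), G i := by
            have := hle {b, b + 2} (by
              intro i hi
              simp only [mem_insert, mem_singleton] at hi
              simp only [mem_range]; omega)
            rwa [sum_pair (by omega)] at this
          rw [← h]
          constructor <;> nlinarith [mul_nonneg hq.le h1, mul_nonneg hq.le h2,
            mul_nonneg (sq_nonneg q) hya]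
        · obtain rfl : b = k := by omega
          have h := expKernel_right q b y
          rw [← hG] at h
          have h1 := hy b (by omega)
          have h2 : G b ≤ ∑ i ∈ range (b + 1 + 1), G i := by simpa using hle {b} (by simp)
          rw [← h]
          constructor <;> nlinarith [mul_nonneg hq.le h1, mul_nonneg (sq_nonneg q) hya]
  have hq2 : 0 < 1 - q := by linarith
  have hq3 : 0 < 1 + q := by linarith
  constructor
  · refine le_of_mul_le_mul_left ?_ hq3
    have := mul_le_mul_of_nonneg_left key.1 hq2.le
    nlinarith [mul_le_mul_of_nonneg_left hsum hq.le]
  · refine le_of_mul_le_mul_left ?_ hq3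
    have := mul_le_mul_of_nonneg_left key.2 hq2.le
    have h2 := mul_le_mul_of_nonneg_left hGa hq2.le
    nlinarith [mul_le_mul_of_nonneg_left (h2.trans hsum) (by positivity : 0 ≤ 1 + q ^ 2)]

lemma sum_nonneg_of_expKernel_nonneg {q : ℚ} (hq : 0 < q) (hq1 : q < 1) {m : ℕ} {y : ℕ → ℚ}
    (hy : ∀ i ≤ m, 0 ≤ expKernel q m y i) : 0 ≤ ∑ i ∈ range (m + 1), y i := by
  have h := one_add_mul_sum_eq q m y
  have h1 : 0 ≤ ∑ i ∈ range (m + 1), expKernel q m y i :=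
    sum_nonneg fun i hi => hy i (by simpa [Nat.lt_succ_iff] using hi)
  have h2 := mul_nonneg (sub_nonneg.mpr hq1.le) h1
  have h3 := mul_nonneg hq.le (add_nonneg (hy 0 (Nat.zero_le _)) (hy m le_rfl))
  exact nonneg_of_mul_nonneg_right (by linarith) (by linarith : 0 < 1 + q)

lemma expKernel_comm (q r : ℚ) (m n : ℕ) (x : ℕ → ℕ → ℚ) (i j : ℕ) :
    expKernel q m (fun a => expKernel r n (x a) j) i
      = expKernel r n (fun b => expKernel q m (fun a => x a b) i) j := by
  simp only [expKernel, mul_sum]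
  rw [sum_comm]
  exact sum_congr rfl fun _ _ => sum_congr rfl fun _ _ => by ring

lemma sum_expKernel (q : ℚ) (m k : ℕ) (x : ℕ → ℕ → ℚ) (i : ℕ) :
    ∑ b ∈ range k, expKernel q m (fun a => x a b) i
      = expKernel q m (fun a => ∑ b ∈ range k, x a b) i := by
  simp only [expKernel, mul_sum]
  rw [sum_comm]

/-- A boundary column vanishes if the totals of its two nearest transforms are small. -/
lemma boundary_column_eq_zero {m : ℕ} {w₀ w₁ : ℕ → ℚ} {x : ℕ → ℤ}
    (h₀ : ∀ i ≤ m, 0 ≤ expKernel (1 / 2) m w₀ i) (h₁ : ∀ i ≤ m, 0 ≤ expKernel (1 / 2) m w₁ i)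
    (hx : ∀ a, w₀ a - 1 / 3 * w₁ a = 8 / 9 * (x a : ℚ))
    (hs : ∑ i ∈ range (m + 1), w₀ i = 1 / 3 * ∑ i ∈ range (m + 1), w₁ i)
    (hs₁ : ∑ i ∈ range (m + 1), w₁ i ≤ 1 / 3) {a : ℕ} (ha : a ≤ m) : x a = 0 := by
  obtain ⟨l₀, u₀⟩ := entry_bounds (by norm_num) (by norm_num) h₀ ha
  obtain ⟨l₁, u₁⟩ := entry_bounds (by norm_num) (by norm_num) h₁ ha
  have hxa := hx a
  have h1 : (x a : ℚ) < 1 := by linarith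
  have h2 : (-1 : ℚ) < x a := by linarith
  have h1' : x a < 1 := by exact_mod_cast h1
  have h2' : -1 < x a := by exact_mod_cast h2
  omega

/-- An integral vector of total `1` whose `1/3`-transform is nonnegative is a unit vector. -/
lemma exists_unit_vector {n : ℕ} {c : ℕ → ℤ}
    (hc : ∀ j ≤ n, 0 ≤ expKernel (1 / 3) n (fun b => (c b : ℚ)) j)
    (hsum : ∑ j ∈ range (n + 1), c j = 1) :
    ∃ k ≤ n, ∀ j, expKernel (1 / 3) n (fun b => (c b : ℚ)) j = (1 / 3) ^ ((j - k) + (k - j)) := by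
  have hsum' : ∑ j ∈ range (n + 1), (c j : ℚ) = 1 := by exact_mod_cast hsum
  have hnn : ∀ j ∈ range (n + 1), 0 ≤ c j := by
    intro j hj
    have h := (entry_bounds (by norm_num) (by norm_num) hc
      (Nat.lt_succ_iff.mp (mem_range.mp hj))).1
    rw [hsum'] at h
    have : (-1 : ℚ) < c j := by linarith
    have : -1 < c j := by exact_mod_cast this
    omega
  obtain ⟨k, hk, hkne⟩ : ∃ k ∈ range (n + 1), c k ≠ 0 := by
    by_contra! h
    rw [sum_eq_zero h] at hsum
    omega
  have hk1 : 1 ≤ c k := by have := hnn k hk; omega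
  have hsplit := add_sum_erase (range (n + 1)) c hk
  have hrest : 0 ≤ ∑ j ∈ (range (n + 1)).erase k, c j :=
    sum_nonneg fun j hj => hnn j (mem_of_mem_erase hj)
  have hz : ∀ j ∈ (range (n + 1)).erase k, c j = 0 :=
    (sum_eq_zero_iff_of_nonneg fun j hj => hnn j (mem_of_mem_erase hj)).mp (by omega)
  refine ⟨k, Nat.lt_succ_iff.mp (mem_range.mp hk), fun j => ?_⟩
  have hck : c k = 1 := by rw [sum_eq_zero hz] at hsplit; omega
  rw [expKernel, sum_eq_single_of_mem k hk, hck]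
  · simp
  · intro b hb hbk
    rw [hz b (mem_erase.mpr ⟨hbk, hb⟩)]
    simp

section Grid

variable {m n : ℕ} {x : ℕ → ℕ → ℤ}

lemma column_count_le_two
    (hg : ∀ i ≤ m, ∀ j ≤ n,
      0 ≤ expKernel (1 / 2) m (fun a => expKernel (1 / 3) n (fun b => (x a b : ℚ)) j) i)
    (hsum : ∑ i ∈ range (m + 1), ∑ j ∈ range (n + 1), x i j = 1)
    (hfirst : ∃ i ≤ m, x i 0 ≠ 0) (hlast : ∃ i ≤ m, x i n ≠ 0) : n ≤ 2 := by
  by_contra! hn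
  set w : ℕ → ℕ → ℚ := fun i j => expKernel (1 / 3) n (fun b => (x i b : ℚ)) j with hw
  have hL : ∀ j, ∑ i ∈ range (m + 1), w i j
      = expKernel (1 / 3) n (fun b => ((∑ i ∈ range (m + 1), x i b : ℤ) : ℚ)) j := by
    intro j
    push_cast
    exact sum_expKernel (1 / 3) n (m + 1) (fun b i => (x i b : ℚ)) j
  have hLnn : ∀ j ≤ n, 0 ≤ ∑ i ∈ range (m + 1), w i j := fun j hj =>
    sum_nonneg_of_expKernel_nonneg (by norm_num) (by norm_num) fun i hi => hg i hi j hj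
  obtain ⟨k, hk, hval⟩ := exists_unit_vector (n := n) (c := fun j => ∑ i ∈ range (m + 1), x i j)
    (fun j hj => by rw [← hL]; exact hLnn j hj) (by rw [sum_comm]; exact hsum)
  simp only [← hL] at hval
  obtain ⟨l, rfl⟩ : ∃ l, n = l + 1 := ⟨n - 1, by omega⟩
  have hsmall : ∀ e : ℕ, (1 / 3 : ℚ) ^ (e + 1) ≤ 1 / 3 := fun e =>
    pow_le_of_le_one (by norm_num) (by norm_num) (by omega)
  rcases Nat.lt_or_ge 1 k with hk2 | hk2
  · obtain ⟨e, rfl⟩ := Nat.exists_eq_add_of_lt hk2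
    obtain ⟨i, hi, hne⟩ := hfirst
    refine hne (boundary_column_eq_zero (w₀ := fun i => w i 0) (w₁ := fun i => w i 1)
      (x := fun i => x i 0) (fun i hi => hg i hi 0 (by omega)) (fun i hi => hg i hi 1 (by omega))
      (fun a => ?_) ?_ ?_ hi)
    · have := expKernel_left (1 / 3) l (fun b => (x a b : ℚ))
      simp only [hw]
      linarith
    · rw [hval, hval, show 0 - (1 + e + 1) + (1 + e + 1 - 0) = e + 2 by omega,
        show 1 - (1 + e + 1) + (1 + e + 1 - 1) = e + 1 by omega]
      ring
    · rw [hval, show 1 - (1 + e + 1) + (1 + e + 1 - 1) = e + 1 by omega]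
      exact hsmall e
  · obtain ⟨e, he⟩ := Nat.exists_eq_add_of_lt (show k < l by omega)
    obtain ⟨i, hi, hne⟩ := hlast
    refine hne (boundary_column_eq_zero (w₀ := fun i => w i (l + 1)) (w₁ := fun i => w i l)
      (x := fun i => x i (l + 1)) (fun i hi => hg i hi _ le_rfl)
      (fun i hi => hg i hi l (by omega)) (fun a => ?_) ?_ ?_ hi)
    · have := expKernel_right (1 / 3) l (fun b => (x a b : ℚ))
      simp only [hw]
      linarith
    · rw [hval, hval, show l + 1 - k + (k - (l + 1)) = e + 2 by omega,
        show l - k + (k - l) = e + 1 by omega]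
      ring
    · rw [hval, show l - k + (k - l) = e + 1 by omega]
      exact hsmall e

/-- A nonzero boundary row forces a definite amount of total next to that boundary. -/
lemma boundary_row_total {v₀ v₁ : ℕ → ℚ} {y : ℕ → ℤ} (hn : n ≤ 2)
    (h₀ : ∀ j ≤ n, 0 ≤ expKernel (1 / 3) n v₀ j) (h₁ : ∀ j ≤ n, 0 ≤ expKernel (1 / 3) n v₁ j)
    (hy : ∀ j, v₀ j - 1 / 2 * v₁ j = 3 / 4 * (y j : ℚ)) (hne : ∃ j ≤ n, y j ≠ 0) :
    4 / 3 ≤ 2 * ∑ j ∈ range (n + 1), v₀ j + ∑ j ∈ range (n + 1), v₁ j := by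
  set A := ∑ j ∈ range (n + 1), v₀ j with hA
  set B := ∑ j ∈ range (n + 1), v₁ j with hB
  have hA0 : 0 ≤ A := sum_nonneg_of_expKernel_nonneg (by norm_num) (by norm_num) h₀
  have hB0 : 0 ≤ B := sum_nonneg_of_expKernel_nonneg (by norm_num) (by norm_num) h₁
  have hAB : A - 1 / 2 * B = 3 / 4 * ((∑ j ∈ range (n + 1), y j : ℤ) : ℚ) := by
    push_cast
    rw [hA, hB, mul_sum, mul_sum, ← sum_sub_distrib]
    exact sum_congr rfl fun j _ => hy j
  set s := ∑ j ∈ range (n + 1), y j with hs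
  rcases lt_trichotomy s 0 with hs0 | hs0 | hs0
  · have : (s : ℚ) ≤ -1 := by exact_mod_cast (by omega : s ≤ -1)
    linarith
  · have hends : 1 ≤ n ∧ (y 0 ≠ 0 ∨ y n ≠ 0) := by
      obtain ⟨j, hj, hjne⟩ := hne
      rw [hs] at hs0
      interval_cases n <;> simp only [sum_range_succ, sum_range_zero] at hs0 <;>
        interval_cases j <;> omega
    obtain ⟨hn1, hends⟩ := hends
    obtain ⟨l, rfl⟩ : ∃ l, n = l + 1 := ⟨n - 1, by omega⟩
    have hbd : ∀ v : ℕ → ℚ, (∀ j ≤ l + 1, 0 ≤ expKernel (1 / 3) (l + 1) v j) →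
        ∀ b, b = 0 ∨ b = l + 1 → -(3 / 4) * ∑ j ∈ range (l + 1 + 1), v j ≤ v b ∧
          v b ≤ 3 / 2 * ∑ j ∈ range (l + 1 + 1), v j := by
      intro v hv b hb
      have hT := one_add_mul_sum_eq (1 / 3) (l + 1) v
      have hl := expKernel_left (1 / 3) l v
      have hr := expKernel_right (1 / 3) l v
      have hv0 := hv 0
      have hv1 := hv 1
      have hv2 := hv 2
      have hl1 : l ≤ 1 := by omega
      interval_cases l <;> simp only [sum_range_succ _ (n := _ + 1)] at hT ⊢ <;>
        norm_num [sum_range_succ] at hT hl hr hv0 hv1 hv2 ⊢ <;>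
        rcases hb with rfl | rfl <;> constructor <;> linarith
    rw [hs0] at hAB
    rcases hends with h | h
    · obtain ⟨l₀, u₀⟩ := hbd v₀ h₀ 0 (Or.inl rfl)
      obtain ⟨l₁, u₁⟩ := hbd v₁ h₁ 0 (Or.inl rfl)
      have := hy 0
      rcases lt_or_gt_of_ne h with h | h
      · have : (y 0 : ℚ) ≤ -1 := by exact_mod_cast (by omega : y 0 ≤ -1)
        push_cast at hAB; linarith
      · have : (1 : ℚ) ≤ y 0 := by exact_mod_cast h
        push_cast at hAB; linarith
    · obtain ⟨l₀, u₀⟩ := hbd v₀ h₀ (l + 1) (Or.inr rfl)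
      obtain ⟨l₁, u₁⟩ := hbd v₁ h₁ (l + 1) (Or.inr rfl)
      have := hy (l + 1)
      rcases lt_or_gt_of_ne h with h | h
      · have : (y (l + 1) : ℚ) ≤ -1 := by exact_mod_cast (by omega : y (l + 1) ≤ -1)
        push_cast at hAB; linarith
      · have : (1 : ℚ) ≤ y (l + 1) := by exact_mod_cast h
        push_cast at hAB; linarith
  · have : (1 : ℚ) ≤ s := by exact_mod_cast hs0
    linarith


/-- Integrality upgrade of the total next to a boundary. -/
lemma boundary_total_ge {M₀ M₁ M₂ : ℚ} {s₀ s₁ : ℤ} (h₀ : 0 ≤ M₀) (h₁ : 0 ≤ M₁)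
    (hs₀ : M₀ - 1 / 2 * M₁ = 3 / 4 * (s₀ : ℚ))
    (hs₁ : 5 / 4 * M₁ - 1 / 2 * M₀ - 1 / 2 * M₂ = 3 / 4 * (s₁ : ℚ))
    (hM₂ : 0 ≤ M₂) (hM₂' : M₂ ≤ 1 / 3) (h : 4 / 3 ≤ 2 * M₀ + M₁) : 3 / 2 ≤ 2 * M₀ + M₁ := by
  rcases lt_trichotomy s₀ 0 with h0 | h0 | h0
  · have : (s₀ : ℚ) ≤ -1 := by exact_mod_cast (by omega : s₀ ≤ -1)
    linarith
  · rw [h0] at hs₀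
    push_cast at hs₀
    have : (0 : ℚ) < s₁ := by linarith
    have : (1 : ℚ) ≤ s₁ := by exact_mod_cast this
    linarith
  · have : (1 : ℚ) ≤ s₀ := by exact_mod_cast h0
    linarith

lemma boundary_total_eq {M₀ M₁ : ℚ} {s₀ s₁ : ℤ} (h₀ : 0 ≤ M₀) (h₁ : 0 ≤ M₁)
    (hs₀ : M₀ - 1 / 2 * M₁ = 3 / 4 * (s₀ : ℚ))
    (hs₁ : 5 / 4 * M₁ - 1 / 2 * M₀ = 3 / 4 * (s₁ : ℚ))
    (h : 2 * M₀ + M₁ = 3 / 2) : s₀ = 0 ∧ s₁ = 1 ∧ M₁ = 3 / 4 := by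
  have e : (2 * s₁ + 3 * s₀ : ℚ) = 2 := by linarith
  have e' : 2 * s₁ + 3 * s₀ = 2 := by exact_mod_cast e
  have l : (-2 : ℚ) < s₀ := by linarith
  have u : (s₀ : ℚ) < 2 := by linarith
  have l' : -2 < s₀ := by exact_mod_cast l
  have u' : s₀ < 2 := by exact_mod_cast u
  obtain rfl : s₀ = 0 := by omega
  refine ⟨rfl, by omega, ?_⟩
  push_cast at hs₀
  linarith

lemma boundary_rows_mod_four {v₀ v₁ : ℕ → ℚ} {y₀ y₁ : ℕ → ℤ} (hn : n ≤ 2)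
    (h₀ : ∀ j ≤ n, 0 ≤ expKernel (1 / 3) n v₀ j) (h₁ : ∀ j ≤ n, 0 ≤ expKernel (1 / 3) n v₁ j)
    (hy₀ : ∀ j ≤ n, v₀ j - 1 / 2 * v₁ j = 3 / 4 * (y₀ j : ℚ))
    (hy₁ : ∀ j ≤ n, 5 / 4 * v₁ j - 1 / 2 * v₀ j = 3 / 4 * (y₁ j : ℚ))
    (hs₀ : ∑ j ∈ range (n + 1), y₀ j = 0) (hs₁ : ∑ j ∈ range (n + 1), y₁ j = 1)
    (hne : ∃ j ≤ n, y₀ j ≠ 0) : 1 ≤ n ∧ (y₀ 1 + 2 * y₁ 1) % 4 = 3 := by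
  have hv₁ : ∀ j ≤ n, v₁ j = 3 / 8 * ((y₀ j + 2 * y₁ j : ℤ) : ℚ) := by
    intro j hj; push_cast; linarith [hy₀ j hj, hy₁ j hj]
  have hv₀ : ∀ j ≤ n, v₀ j = 3 / 16 * ((5 * y₀ j + 2 * y₁ j : ℤ) : ℚ) := by
    intro j hj; push_cast; linarith [hy₀ j hj, hy₁ j hj]
  have scaled : ∀ (v : ℕ → ℚ) (z : ℕ → ℤ) (c : ℚ), 0 < c →
      (∀ j ≤ n, 0 ≤ expKernel (1 / 3) n v j) → (∀ j ≤ n, v j = c * (z j : ℚ)) →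
      ∀ j ≤ n, 0 ≤ ∑ b ∈ range (n + 1), 3 ^ (2 - ((j - b) + (b - j))) * z b := by
    intro v z c hc hv hz j hj
    have e : expKernel (1 / 3) n v j = c / 9 *
        ((∑ b ∈ range (n + 1), 3 ^ (2 - ((j - b) + (b - j))) * z b : ℤ) : ℚ) := by
      push_cast
      rw [expKernel, mul_sum]
      refine sum_congr rfl fun b hb => ?_
      have hb' := Nat.lt_succ_iff.mp (mem_range.mp hb)
      rw [hz b hb']
      have hd : (j - b) + (b - j) ≤ 2 := by omega
      generalize (j - b) + (b - j) = d at hd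
      interval_cases d <;> norm_num <;> ring
    have h := hv j hj
    rw [e] at h
    exact_mod_cast nonneg_of_mul_nonneg_right h (by positivity)
  have hA := scaled v₁ (fun j => y₀ j + 2 * y₁ j) _ (by norm_num) h₁ hv₁
  have hB := scaled v₀ (fun j => 5 * y₀ j + 2 * y₁ j) _ (by norm_num) h₀ hv₀
  obtain ⟨j, hj, hjne⟩ := hne
  have hA0 := hA 0
  have hA1 := hA 1
  have hA2 := hA 2
  have hB0 := hB 0
  have hB1 := hB 1
  have hB2 := hB 2
  clear hA hB scaled hv₁ hv₀ hy₀ hy₁ h₀ h₁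
  interval_cases n <;> simp [sum_range_succ] at hs₀ hs₁ hA0 hA1 hA2 hB0 hB1 hB2 <;>
    first | (interval_cases j; omega) | skip
  · have l1 : -1 ≤ y₀ 1 := by omega
    have u1 : y₀ 1 ≤ 1 := by omega
    refine ⟨le_rfl, ?_⟩
    obtain h | h | h : y₀ 1 = -1 ∨ y₀ 1 = 0 ∨ y₀ 1 = 1 := by omega
    · omega
    · interval_cases j <;> omega
    · omega
  · have l1 : -1 ≤ y₀ 1 := by omega
    have u1 : y₀ 1 ≤ 1 := by omega
    have l0 : -1 ≤ y₀ 0 := by omega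
    have u0 : y₀ 0 ≤ 1 := by omega
    have hne' : y₀ 0 ≠ 0 ∨ y₀ 1 ≠ 0 := by
      interval_cases j <;> omega
    clear hjne
    refine ⟨by norm_num, ?_⟩
    obtain h | h | h : y₀ 1 = -1 ∨ y₀ 1 = 0 ∨ y₀ 1 = 1 := by omega
    all_goals
      obtain h' | h' | h' : y₀ 0 = -1 ∨ y₀ 0 = 0 ∨ y₀ 0 = 1 := by omega
      all_goals
        have l : -1 ≤ y₁ 1 := by omega
        have u : y₁ 1 ≤ 3 := by omega
        obtain e | e | e | e | e :
          y₁ 1 = -1 ∨ y₁ 1 = 0 ∨ y₁ 1 = 1 ∨ y₁ 1 = 2 ∨ y₁ 1 = 3 := by omega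
        all_goals omega

lemma row_count_le_three
    (hg : ∀ i ≤ m, ∀ j ≤ n,
      0 ≤ expKernel (1 / 2) m (fun a => expKernel (1 / 3) n (fun b => (x a b : ℚ)) j) i)
    (hsum : ∑ i ∈ range (m + 1), ∑ j ∈ range (n + 1), x i j = 1) (hn : n ≤ 2)
    (hfirst : ∃ j ≤ n, x 0 j ≠ 0) (hlast : ∃ j ≤ n, x m j ≠ 0) : m ≤ 3 := by
  by_contra! hm
  obtain ⟨k, rfl⟩ := Nat.exists_eq_add_of_le' (show 4 ≤ m from hm)
  set v : ℕ → ℕ → ℚ := fun i j => expKernel (1 / 2) (k + 4) (fun a => (x a j : ℚ)) i with hv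
  have hgv : ∀ i ≤ k + 4, ∀ j ≤ n, 0 ≤ expKernel (1 / 3) n (v i) j := by
    intro i hi j hj
    rw [hv, ← expKernel_comm (1 / 2) (1 / 3) (k + 4) n (fun a b => (x a b : ℚ)) i j]
    exact hg i hi j hj
  set s : ℕ → ℤ := fun i => ∑ j ∈ range (n + 1), x i j with hs
  set M : ℕ → ℚ := fun i => ∑ j ∈ range (n + 1), v i j with hM
  have hMs : ∀ i, M i = expKernel (1 / 2) (k + 4) (fun a => (s a : ℚ)) i := by
    intro i
    simp only [hM, hs, hv]
    push_cast
    exact sum_expKernel (1 / 2) (k + 4) (n + 1) (fun a j => (x a j : ℚ)) i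
  have hM0 : ∀ i ≤ k + 4, 0 ≤ M i := fun i hi =>
    sum_nonneg_of_expKernel_nonneg (by norm_num) (by norm_num) (hgv i hi)
  have hvl : ∀ j, v 0 j - 1 / 2 * v 1 j = 3 / 4 * (x 0 j : ℚ) := by
    intro j
    have := expKernel_left (1 / 2) (k + 3) (fun a => (x a j : ℚ))
    simp only [hv]; linarith
  have hvr : ∀ j, v (k + 4) j - 1 / 2 * v (k + 3) j = 3 / 4 * (x (k + 4) j : ℚ) := by
    intro j
    have := expKernel_right (1 / 2) (k + 3) (fun a => (x a j : ℚ))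
    simp only [hv]; linarith
  have hvi : ∀ i ≤ k + 2, ∀ j,
      5 / 4 * v (i + 1) j - 1 / 2 * v i j - 1 / 2 * v (i + 2) j = 3 / 4 * (x (i + 1) j : ℚ) := by
    intro i hi j
    have := expKernel_interior (1 / 2) (m := k + 4) (i := i) (fun a => (x a j : ℚ)) (by omega)
    simp only [hv]; linarith
  have hMl : M 0 - 1 / 2 * M 1 = 3 / 4 * (s 0 : ℚ) := by
    have := expKernel_left (1 / 2) (k + 3) (fun a => (s a : ℚ))
    rw [hMs, hMs]; linarith
  have hMr : M (k + 4) - 1 / 2 * M (k + 3) = 3 / 4 * (s (k + 4) : ℚ) := by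
    have := expKernel_right (1 / 2) (k + 3) (fun a => (s a : ℚ))
    rw [hMs, hMs]; linarith
  have hMi : ∀ i ≤ k + 2,
      5 / 4 * M (i + 1) - 1 / 2 * M i - 1 / 2 * M (i + 2) = 3 / 4 * (s (i + 1) : ℚ) := by
    intro i hi
    have := expKernel_interior (1 / 2) (m := k + 4) (i := i) (fun a => (s a : ℚ)) (by omega)
    rw [hMs, hMs, hMs]; linarith
  have hbudget : 2 * M 0 + M 1 + ∑ i ∈ range (k + 1), M (i + 2) + M (k + 3) + 2 * M (k + 4) = 3 := by
    have h := one_add_mul_sum_eq (1 / 2) (k + 4) (fun a => (s a : ℚ))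
    have h1 : ∑ a ∈ range (k + 4 + 1), (s a : ℚ) = 1 := by exact_mod_cast hsum
    simp only [← hMs] at h
    rw [h1, sum_range_succ, sum_range_succ, sum_range_succ', sum_range_succ'] at h
    linarith
  have hmid : ∀ i < k + 1, M (i + 2) ≤ ∑ i ∈ range (k + 1), M (i + 2) := fun i hi =>
    single_le_sum (f := fun i => M (i + 2))
      (fun i hi => hM0 _ (by have := mem_range.mp hi; omega)) (mem_range.mpr hi)
  have hwl : 4 / 3 ≤ 2 * M 0 + M 1 :=
    boundary_row_total hn (hgv 0 (by omega)) (hgv 1 (by omega)) hvl hfirst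
  have hwr : 4 / 3 ≤ 2 * M (k + 4) + M (k + 3) :=
    boundary_row_total hn (hgv _ le_rfl) (hgv (k + 3) (by omega)) hvr hlast
  have n0 := hM0 0 (by omega)
  have n1 := hM0 1 (by omega)
  have n2 := hM0 2 (by omega)
  have n2' := hM0 (k + 2) (by omega)
  have n1' := hM0 (k + 3) (by omega)
  have n0' := hM0 (k + 4) le_rfl
  have m2 := hmid 0 (by omega)
  have m2' := hmid k (by omega)
  have i1 := hMi 0 (by omega)
  have i1' : 5 / 4 * M (k + 3) - 1 / 2 * M (k + 4) - 1 / 2 * M (k + 2)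
      = 3 / 4 * (s (k + 3) : ℚ) := by
    linarith [hMi (k + 2) le_rfl]
  simp only [zero_add] at i1 m2
  have hsl := boundary_total_ge n0 n1 hMl i1 n2 (by linarith) hwl
  have hsr := boundary_total_ge n0' n1' hMr i1' n2' (by linarith) hwr
  have z : ∀ i < k + 1, M (i + 2) = 0 := fun i hi =>
    le_antisymm ((hmid i hi).trans (by linarith)) (hM0 _ (by omega))
  have z2 := z 0 (by omega)
  have z2' := z k (by omega)
  have z0 : 0 ≤ ∑ i ∈ range (k + 1), M (i + 2) := n2.trans m2
  simp only [zero_add] at z2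
  obtain ⟨s0, s1, e1⟩ := boundary_total_eq n0 n1 hMl (s₁ := s 1) (by linarith) (by linarith)
  obtain ⟨s0', s1', e1'⟩ := boundary_total_eq n0' n1' hMr (s₁ := s (k + 3)) (by linarith)
    (by linarith)
  rcases Nat.eq_zero_or_pos k with rfl | hk
  · have hv2 : ∀ j ≤ n, v 2 j = 0 := by
      intro j hj
      have h := entry_bounds (by norm_num) (by norm_num) (hgv 2 (by omega)) hj
      have hz : ∑ i ∈ range (n + 1), v 2 i = 0 := z2
      rw [hz] at h
      linarith [h.1, h.2]
    obtain ⟨hn1, hl⟩ := boundary_rows_mod_four hn (hgv 0 (by omega)) (hgv 1 (by omega))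
      (fun j _ => hvl j) (y₁ := x 1)
      (fun j hj => by have := hvi 0 (by omega) j; simp only [zero_add, hv2 j hj] at this; linarith)
      s0 s1 hfirst
    obtain ⟨-, hr⟩ := boundary_rows_mod_four hn (hgv 4 (by omega)) (hgv 3 (by omega))
      (fun j _ => hvr j) (y₁ := x 3)
      (fun j hj => by have := hvi 2 (by omega) j; simp only [hv2 j hj] at this; norm_num at this; linarith)
      s0' s1' hlast
    have h2 := hv2 1 hn1
    simp [hv, expKernel, sum_range_succ] at h2
    have h4 : (x 0 1 + 2 * x 1 1 + 4 * x 2 1 + 2 * x 3 1 + x 4 1 : ℚ) = 0 := by linarith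
    have h4' : x 0 1 + 2 * x 1 1 + 4 * x 2 1 + 2 * x 3 1 + x 4 1 = 0 := by exact_mod_cast h4
    simp only [zero_add] at hr
    omega
  · have i2 := hMi 1 (by omega)
    have z3 := z 1 (by omega)
    norm_num at i2 z3
    rw [z2, z3, e1] at i2
    have h : (2 * s 2 : ℚ) = -1 := by linarith
    have h' : 2 * s 2 = -1 := by exact_mod_cast h
    omega

end Grid

lemma sum_divisors_two_pow_mul_three_pow {α : Type*} [AddCommMonoid α] (m n : ℕ) (f : ℕ → α) :
    ∑ d ∈ (2 ^ m * 3 ^ n).divisors, f d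
      = ∑ a ∈ range (m + 1), ∑ b ∈ range (n + 1), f (2 ^ a * 3 ^ b) := by
  have hcop : Nat.Coprime (2 ^ m) (3 ^ n) := Nat.Coprime.pow _ _ (by norm_num)
  rw [Nat.divisors_mul, Finset.mul_def, sum_image hcop.mul_injOn_divisors, sum_product,
    Nat.sum_divisors_prime_pow Nat.prime_two]
  exact sum_congr rfl fun a _ => Nat.sum_divisors_prime_pow Nat.prime_three

lemma gcd_pow_pow (p a i : ℕ) : Nat.gcd (p ^ a) (p ^ i) = p ^ min a i := by
  rcases le_total a i with h | h
  · rw [min_eq_left h, Nat.gcd_eq_left (pow_dvd_pow p h)]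
  · rw [min_eq_right h, Nat.gcd_eq_right (pow_dvd_pow p h)]

lemma gcd_two_pow_mul_three_pow (a b i j : ℕ) :
    Nat.gcd (2 ^ a * 3 ^ b) (2 ^ i * 3 ^ j) = 2 ^ min a i * 3 ^ min b j := by
  have h : ∀ k l : ℕ, Nat.Coprime (2 ^ k) (3 ^ l) := fun k l => Nat.Coprime.pow _ _ (by norm_num)
  rw [(h i j).gcd_mul, (h i b).symm.gcd_mul_right_cancel, (h a j).gcd_mul_left_cancel,
    gcd_pow_pow, gcd_pow_pow]

lemma pow_min_sq (p : ℚ) (hp : p ≠ 0) (a i : ℕ) :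
    (p ^ min a i) ^ 2 = p ^ a * p ^ i * (1 / p) ^ ((i - a) + (a - i)) := by
  rcases le_total a i with h | h
  · obtain ⟨k, rfl⟩ := Nat.exists_eq_add_of_le h
    rw [min_eq_left h, show a + k - a + (a - (a + k)) = k by omega]
    have hk : p ^ k * (1 / p) ^ k = 1 := by rw [← mul_pow, mul_one_div_cancel hp, one_pow]
    rw [pow_add]
    linear_combination -(p ^ a) ^ 2 * hk
  · obtain ⟨k, rfl⟩ := Nat.exists_eq_add_of_le h
    rw [min_eq_right h, show i - (i + k) + (i + k - i) = k by omega]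
    have hk : p ^ k * (1 / p) ^ k = 1 := by rw [← mul_pow, mul_one_div_cancel hp, one_pow]
    rw [pow_add]
    linear_combination -(p ^ i) ^ 2 * hk

/-- Up to a positive factor, the cusp orders are the iterated kernel transform of the exponents. -/
lemma expKernel_nonneg_of_isHolEta {m n : ℕ} {X : ℕ → ℤ} (hhol : IsHolEta (2 ^ m * 3 ^ n) X)
    {i j : ℕ} (hi : i ≤ m) (hj : j ≤ n) :
    0 ≤ expKernel (1 / 2) m
      (fun a => expKernel (1 / 3) n (fun b => (X (2 ^ a * 3 ^ b) : ℚ)) j) i := by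
  set N := 2 ^ m * 3 ^ n with hN
  set t := 2 ^ i * 3 ^ j with ht
  have hNpos : 0 < N := by positivity
  have h := hhol t (Nat.mem_divisors.mpr
    ⟨mul_dvd_mul (pow_dvd_pow 2 hi) (pow_dvd_pow 3 hj), hNpos.ne'⟩)
  have hgpos : 0 < Nat.gcd (t ^ 2) N := Nat.gcd_pos_of_pos_right _ hNpos
  have hc : (0 : ℚ) < N * t / (Nat.gcd (t ^ 2) N : ℚ) := by positivity
  refine nonneg_of_mul_nonneg_right (le_of_le_of_eq h ?_) hc
  rw [etaOrd, hN, sum_divisors_two_pow_mul_three_pow, ← hN, expKernel, mul_sum]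
  refine sum_congr rfl fun a _ => ?_
  rw [expKernel, mul_sum, mul_sum]
  refine sum_congr rfl fun b _ => ?_
  rw [show Nat.gcd (2 ^ a * 3 ^ b) t = 2 ^ min a i * 3 ^ min b j from
    gcd_two_pow_mul_three_pow a b i j]
  have e2 := pow_min_sq 2 (by norm_num) a i
  have e3 := pow_min_sq 3 (by norm_num) b j
  have htq : (t : ℚ) = 2 ^ i * 3 ^ j := by rw [ht]; push_cast; ring
  have hg : (Nat.gcd (t ^ 2) N : ℚ) ≠ 0 := by positivity
  generalize (Nat.gcd (t ^ 2) N : ℚ) = g at hg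
  rw [htq]
  push_cast
  rw [mul_pow, e2, e3]
  generalize (1 / 2 : ℚ) ^ ((i - a) + (a - i)) = u
  generalize (1 / 3 : ℚ) ^ ((j - b) + (b - j)) = w
  field_simp

lemma exists_exponents_of_mem_support {m n : ℕ} {X : ℕ → ℤ} {d : ℕ}
    (hd : d ∈ (2 ^ m * 3 ^ n).divisors.filter fun d => X d ≠ 0) :
    ∃ a ≤ m, ∃ b ≤ n, d = 2 ^ a * 3 ^ b ∧ X (2 ^ a * 3 ^ b) ≠ 0 := by
  obtain ⟨hdvd, hX⟩ := mem_filter.mp hd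
  obtain ⟨e, f, he, hf, rfl⟩ := Nat.dvd_mul.mp (Nat.dvd_of_mem_divisors hdvd)
  obtain ⟨a, ha, rfl⟩ := (Nat.dvd_prime_pow Nat.prime_two).mp he
  obtain ⟨b, hb, rfl⟩ := (Nat.dvd_prime_pow Nat.prime_three).mp hf
  exact ⟨a, ha, b, hb, rfl, hX⟩

section Support

variable {m n : ℕ} {X : ℕ → ℤ}

lemma exists_ne_zero_first_row (hprim : IsPrimitiveEta (2 ^ m * 3 ^ n) X) :
    ∃ j ≤ n, X (2 ^ 0 * 3 ^ j) ≠ 0 := by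
  by_contra! h
  have : 2 ∣ (((2 ^ m * 3 ^ n).divisors.filter fun d => X d ≠ 0).gcd id) := by
    refine dvd_gcd fun d hd => ?_
    obtain ⟨a, -, b, hb, rfl, hX⟩ := exists_exponents_of_mem_support hd
    have ha : a ≠ 0 := by rintro rfl; exact hX (h b hb)
    exact (dvd_pow_self 2 ha).mul_right _
  rw [hprim] at this
  omega

lemma exists_ne_zero_first_column (hprim : IsPrimitiveEta (2 ^ m * 3 ^ n) X) :
    ∃ i ≤ m, X (2 ^ i * 3 ^ 0) ≠ 0 := by
  by_contra! h
  have : 3 ∣ (((2 ^ m * 3 ^ n).divisors.filter fun d => X d ≠ 0).gcd id) := by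
    refine dvd_gcd fun d hd => ?_
    obtain ⟨a, ha, b, -, rfl, hX⟩ := exists_exponents_of_mem_support hd
    have hb : b ≠ 0 := by rintro rfl; exact hX (h a ha)
    exact (dvd_pow_self 3 hb).mul_left _
  rw [hprim] at this
  omega

lemma exists_ne_zero_last_row (hlev : etaLevel (2 ^ m * 3 ^ n) X = 2 ^ m * 3 ^ n) (hm : m ≠ 0) :
    ∃ j ≤ n, X (2 ^ m * 3 ^ j) ≠ 0 := by
  by_contra! h
  have hdvd : etaLevel (2 ^ m * 3 ^ n) X ∣ 2 ^ (m - 1) * 3 ^ n := by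
    refine lcm_dvd fun d hd => ?_
    obtain ⟨a, ha, b, hb, rfl, hX⟩ := exists_exponents_of_mem_support hd
    have : a ≠ m := by rintro rfl; exact hX (h b hb)
    exact mul_dvd_mul (pow_dvd_pow 2 (by omega)) (pow_dvd_pow 3 hb)
  rw [hlev] at hdvd
  have := (Nat.pow_dvd_pow_iff_le_right (by norm_num)).mp
    (Nat.dvd_of_mul_dvd_mul_right (by positivity) hdvd)
  omega

lemma exists_ne_zero_last_column (hlev : etaLevel (2 ^ m * 3 ^ n) X = 2 ^ m * 3 ^ n)
    (hn : n ≠ 0) : ∃ i ≤ m, X (2 ^ i * 3 ^ n) ≠ 0 := by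
  by_contra! h
  have hdvd : etaLevel (2 ^ m * 3 ^ n) X ∣ 2 ^ m * 3 ^ (n - 1) := by
    refine lcm_dvd fun d hd => ?_
    obtain ⟨a, ha, b, hb, rfl, hX⟩ := exists_exponents_of_mem_support hd
    have : b ≠ n := by rintro rfl; exact hX (h a ha)
    exact mul_dvd_mul (pow_dvd_pow 2 ha) (pow_dvd_pow 3 (by omega))
  rw [hlev] at hdvd
  have := (Nat.pow_dvd_pow_iff_le_right (by norm_num)).mp
    (Nat.dvd_of_mul_dvd_mul_left (by positivity) hdvd)
  omega

end Support

/-- If there exists a primitive holomorphic eta quotient of weight `1/2` and level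
`N = 2^m·3^n`, then `m ≤ 3` and `n ≤ 2`. -/
theorem primitive_weight_half_three_smooth_level_bound (m n : ℕ) (X : ℕ → ℤ)
    (hsupp : SuppIn (2 ^ m * 3 ^ n) X)
    (hwt : ∑ d ∈ (2 ^ m * 3 ^ n).divisors, X d = 1)
    (hlev : etaLevel (2 ^ m * 3 ^ n) X = 2 ^ m * 3 ^ n)
    (hprim : IsPrimitiveEta (2 ^ m * 3 ^ n) X)
    (hhol : IsHolEta (2 ^ m * 3 ^ n) X) :
    m ≤ 3 ∧ n ≤ 2 := by
  have hg := fun i (hi : i ≤ m) j (hj : j ≤ n) => expKernel_nonneg_of_isHolEta hhol hi hj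
  rw [sum_divisors_two_pow_mul_three_pow] at hwt
  have hn : n ≤ 2 := by
    by_contra! h
    exact absurd (column_count_le_two (x := fun a b => X (2 ^ a * 3 ^ b)) hg hwt
      (exists_ne_zero_first_column hprim) (exists_ne_zero_last_column hlev (by omega)))
      (by omega)
  refine ⟨?_, hn⟩
  by_contra! h
  exact absurd (row_count_le_three (x := fun a b => X (2 ^ a * 3 ^ b)) hg hwt hn
    (exists_ne_zero_first_row hprim) (exists_ne_zero_last_row hlev (by omega)))
    (by omega)
end
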